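/- Let L_cl = (2/(N+M−1)) Σ_{1≤i<j≤N+M} (R_{ij} − I) be the generator of the standard Kac model on N+M one-dimensional particles, where R_{ij} averages over rotations in the (i,j)-plane with a probability density ρ satisfying ∫ ρ(θ) sin θ cos θ dθ = 0 and with absolutely convergent Fourier series. If F₀(v,w) = f₀(v) e^{-π|w|²} with f₀ a probability density on ℝ^M of finite relative entropy, and f(v,t) = ∫_{ℝ^N} (e^{L_cl t} F₀)(v,w) dw, then S(f(·,t)) ≤ [M/(N+M) + (N/(N+M)) e^{−2tμ_ρ(N+M)/(N+M−1)}] S(f₀), where μ_ρ = ∫ ρ(θ) sin²θ dθ and S(g) = ∫ g log(g/e^{-π|v|²}) dv is the entropy relative to the thermal state, assuming N ≥ M. -/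

import Mathlib

open MeasureTheory Real

/-- The inverse rotation `r_{ij}(θ)^{-1}` acting on velocities: it replaces `z_i` by
`z_i cos θ − z_j sin θ` and `z_j` by `z_i sin θ + z_j cos θ`. -/
noncomputable def kacRotate {n : ℕ} (i j : Fin n) (θ : ℝ) (z : Fin n → ℝ) : Fin n → ℝ :=
  fun l => if l = i then Real.cos θ * z i - Real.sin θ * z j
    else if l = j then Real.sin θ * z i + Real.cos θ * z j
    else z l

/-- The Kac collision operator `R_{ij}`, averaging over rotations in the `(i,j)`-plane with
density `ρ`. -/
noncomputable def kacR (ρ : ℝ → ℝ) {n : ℕ} (i j : Fin n)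
    (F : (Fin n → ℝ) → ℝ) : (Fin n → ℝ) → ℝ :=
  fun z => ∫ θ in (-π)..π, ρ θ * F (kacRotate i j θ z)

/-- The averaged collision operator `Q = (2/(n(n-1))) Σ_{i<j} R_{ij}`, so that the standard
Kac generator is `L_cl = (2/(n-1)) Σ_{i<j} (R_{ij} − I) = n (Q − I)`. -/
noncomputable def kacQ (ρ : ℝ → ℝ) {n : ℕ} (F : (Fin n → ℝ) → ℝ) : (Fin n → ℝ) → ℝ :=
  fun z => (2 / ((n : ℝ) * ((n : ℝ) - 1))) *
    ∑ p ∈ Finset.univ.filter (fun p : Fin n × Fin n => p.1 < p.2), kacR ρ p.1 p.2 F z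

/-- The Kac semigroup `e^{L_cl t} = e^{-nt} Σ_k (nt)^k/k! Q^k` for the standard Kac model
on `n` particles. -/
noncomputable def kacEvol (ρ : ℝ → ℝ) {n : ℕ} (t : ℝ) (F : (Fin n → ℝ) → ℝ) :
    (Fin n → ℝ) → ℝ :=
  fun z => Real.exp (-(n : ℝ) * t) *
    ∑' k : ℕ, ((n : ℝ) * t) ^ k / (k.factorial : ℝ) * ((kacQ ρ (n := n))^[k] F z)

/-- The entropy of `g` relative to the thermal state `e^{-π|v|²}`. -/
noncomputable def relEntropy {M : ℕ} (g : (Fin M → ℝ) → ℝ) : ℝ :=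
  ∫ v : Fin M → ℝ, g v * Real.log (g v / Real.exp (-π * ∑ i, (v i) ^ 2))

open MeasureTheory Real

/-- The thermal state. -/
noncomputable def gau {n : ℕ} (z : Fin n → ℝ) : ℝ := Real.exp (-π * ∑ i, (z i) ^ 2)

/-- The Gaussian measure. -/
noncomputable def gam (n : ℕ) : Measure (Fin n → ℝ) :=
  (volume : Measure (Fin n → ℝ)).withDensity (fun z => ENNReal.ofReal (gau z))

lemma gau_pos {n : ℕ} (z : Fin n → ℝ) : 0 < gau z := Real.exp_pos _

lemma gau_cont {n : ℕ} : Continuous (gau (n := n)) := by unfold gau; fun_prop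

lemma gau_meas {n : ℕ} : Measurable (gau (n := n)) := gau_cont.measurable

lemma integral_gam {n : ℕ} (f : (Fin n → ℝ) → ℝ) :
    ∫ z, f z ∂(gam n) = ∫ z, gau z * f z := by
  unfold gam
  rw [integral_withDensity_eq_integral_toReal_smul (by have := gau_meas (n := n); fun_prop) (by simp)]
  refine integral_congr_ae (Filter.Eventually.of_forall fun z => ?_)
  simp [ENNReal.toReal_ofReal (gau_pos z).le]

lemma integrable_gam_iff {n : ℕ} (f : (Fin n → ℝ) → ℝ) :
    Integrable f (gam n) ↔ Integrable (fun z => gau z * f z) := by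
  unfold gam
  rw [integrable_withDensity_iff_integrable_smul' (by have := gau_meas (n := n); fun_prop) (by simp)]
  refine integrable_congr (Filter.Eventually.of_forall fun z => ?_)
  simp [ENNReal.toReal_ofReal (gau_pos z).le]

lemma gau_exp_integrable {n : ℕ} (c : Fin n → ℝ) :
    Integrable (fun z : Fin n → ℝ => gau z * Real.exp (∑ i, c i * z i)) := by
  have h := GaussianFourier.integrable_cexp_neg_mul_sum_add (b := (π : ℂ)) (by simpa using pi_pos)
    (fun i => (c i : ℂ))
  have h2 := h.re
  refine h2.congr (Filter.Eventually.of_forall fun z => ?_)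
  simp only [gau, ← Real.exp_add]
  have : (-(π : ℂ) * ∑ i, (z i : ℂ) ^ 2 + ∑ i, (c i : ℂ) * (z i : ℂ)) =
    ((-π * ∑ i, z i ^ 2 + ∑ i, c i * z i : ℝ) : ℂ) := by push_cast; ring
  rw [this, ← Complex.ofReal_exp]
  exact Complex.ofReal_re _

lemma gau_integral_cos {n : ℕ} (k : Fin n → ℝ) (b : ℝ) :
    ∫ z : Fin n → ℝ, gau z * Real.cos ((∑ i, k i * z i) + b)
      = Real.exp (-(∑ i, k i * k i) / (4 * π)) * Real.cos b := by
  have hpi : (π : ℂ) ≠ 0 := by exact_mod_cast pi_ne_zero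
  have h1 := GaussianFourier.integrable_cexp_neg_mul_sum_add (b := (π : ℂ)) (by simpa using pi_pos)
    (fun i => (k i : ℂ) * Complex.I)
  have h := GaussianFourier.integral_cexp_neg_mul_sum_add (b := (π : ℂ)) (by simpa using pi_pos)
    (fun i => (k i : ℂ) * Complex.I)
  rw [div_self hpi, Complex.one_cpow, one_mul] at h
  have e1 : ∀ z : Fin n → ℝ, gau z * Real.cos ((∑ i, k i * z i) + b) =
      (Complex.exp (-(π : ℂ) * ∑ i, (z i : ℂ) ^ 2 + ∑ i, (k i : ℂ) * Complex.I * (z i : ℂ)) *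
        Complex.exp (b * Complex.I)).re := by
    intro z
    rw [← Complex.exp_add]
    have : (-(π : ℂ) * ∑ i, (z i : ℂ) ^ 2 + ∑ i, (k i : ℂ) * Complex.I * (z i : ℂ) + b * Complex.I) =
      ((-π * ∑ i, z i ^ 2 : ℝ) : ℂ) + ((∑ i, k i * z i + b : ℝ) : ℂ) * Complex.I := by
      push_cast
      rw [add_mul, Finset.sum_mul, ← add_assoc]
      congr 2
      exact Finset.sum_congr rfl fun i _ => by ring
    rw [this, Complex.exp_add, ← Complex.ofReal_exp, Complex.re_ofReal_mul,
      Complex.exp_ofReal_mul_I_re, gau]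
  simp_rw [e1]
  have e2 : ∫ z : Fin n → ℝ, (Complex.exp (-(π : ℂ) * ∑ i, (z i : ℂ) ^ 2 +
      ∑ i, (k i : ℂ) * Complex.I * (z i : ℂ)) * Complex.exp (b * Complex.I)).re =
      (∫ z : Fin n → ℝ, Complex.exp (-(π : ℂ) * ∑ i, (z i : ℂ) ^ 2 +
      ∑ i, (k i : ℂ) * Complex.I * (z i : ℂ)) * Complex.exp (b * Complex.I)).re :=
    integral_re (h1.mul_const _)
  rw [e2, integral_mul_const, h]
  have : ((∑ i, ((k i : ℂ) * Complex.I) ^ 2) / (4 * π)) = ((-(∑ i, k i * k i) / (4 * π) : ℝ) : ℂ) := by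
    push_cast
    congr 1
    rw [← Finset.sum_neg_distrib]
    exact Finset.sum_congr rfl fun i _ => by rw [mul_pow, Complex.I_sq]; ring
  rw [this, ← Complex.ofReal_exp, Complex.re_ofReal_mul, Complex.exp_ofReal_mul_I_re]

lemma gau_integral {n : ℕ} : ∫ z : Fin n → ℝ, gau z = 1 := by
  simpa using gau_integral_cos (n := n) 0 0

lemma gau_integrable {n : ℕ} : Integrable (gau (n := n)) := by
  simpa using gau_exp_integrable (n := n) 0

instance gam_prob (n : ℕ) : IsProbabilityMeasure (gam n) := by
  constructor
  rw [gam, withDensity_apply _ MeasurableSet.univ, Measure.restrict_univ,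
    ← ofReal_integral_eq_lintegral_ofReal gau_integrable
      (Filter.Eventually.of_forall fun z => (gau_pos z).le), gau_integral]
  simp

lemma abs_le_exp_add (x : ℝ) : |x| ≤ Real.exp x + Real.exp (-x) := by
  rcases abs_cases x with ⟨h, _⟩ | ⟨h, _⟩ <;> rw [h]
  · linarith [Real.add_one_le_exp x, Real.exp_pos (-x)]
  · linarith [Real.add_one_le_exp (-x), Real.exp_pos (x)]

lemma gam_coord_integrable {n : ℕ} (i : Fin n) : Integrable (fun z => z i) (gam n) := by
  rw [integrable_gam_iff]
  have h1 := gau_exp_integrable (n := n) (Pi.single i 1)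
  have h2 := gau_exp_integrable (n := n) (Pi.single i (-1))
  refine (h1.add h2).mono' (by have := gau_cont (n := n); fun_prop) (Filter.Eventually.of_forall fun z => ?_)
  have e1 : ∀ c : ℝ, ∑ j, (Pi.single i c : Fin n → ℝ) j * z j = c * z i := by
    intro c
    rw [Finset.sum_eq_single i]
    · simp
    · intro j _ hj; simp [hj]
    · simp
  simp only [Pi.add_apply, e1, norm_mul, Real.norm_eq_abs, abs_of_pos (gau_pos z)]
  rw [← mul_add]
  gcongr
  · exact (gau_pos z).le
  · simpa using abs_le_exp_add (z i)

/-- sum of absolute values -/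
def l1 {n : ℕ} (z : Fin n → ℝ) : ℝ := ∑ i, |z i|

lemma l1_nonneg {n : ℕ} (z : Fin n → ℝ) : 0 ≤ l1 z := Finset.sum_nonneg fun _ _ => abs_nonneg _

lemma l1_cont {n : ℕ} : Continuous (l1 (n := n)) := by unfold l1; fun_prop

lemma l1_integrable {n : ℕ} : Integrable (l1 (n := n)) (gam n) := by
  unfold l1
  exact integrable_finsetSum _ fun i _ => (gam_coord_integrable i).abs

lemma dot_le_l1 {n : ℕ} (d z : Fin n → ℝ) : |d ⬝ᵥ z| ≤ l1 d * l1 z := by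
  unfold dotProduct l1
  refine (Finset.abs_sum_le_sum_abs _ _).trans ?_
  rw [Finset.sum_mul]
  refine Finset.sum_le_sum fun i _ => ?_
  rw [abs_mul]
  gcongr
  exact Finset.single_le_sum (f := fun i => |z i|) (fun _ _ => abs_nonneg _) (Finset.mem_univ i)

lemma gau_lineDeriv {n : ℕ} (d z : Fin n → ℝ) :
    HasLineDerivAt ℝ (gau (n := n)) (-(2 * π) * (d ⬝ᵥ z) * gau z) z d := by
  unfold HasLineDerivAt gau
  have h : HasDerivAt (fun t : ℝ => -π * ∑ i, ((z + t • d) i) ^ 2) (-(2 * π) * (d ⬝ᵥ z)) 0 := by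
    have h1 : ∀ i ∈ (Finset.univ : Finset (Fin n)),
        HasDerivAt (fun t : ℝ => ((z + t • d) i) ^ 2) (2 * (d i * z i)) 0 := by
      intro i _
      simp only [Pi.add_apply, Pi.smul_apply, smul_eq_mul]
      have := (((hasDerivAt_id (0 : ℝ)).mul_const (d i)).const_add (z i)).pow 2
      convert! this using 1
      simp; ring
    have := (HasDerivAt.fun_sum h1).const_mul (-π)
    convert! this using 1
    rw [dotProduct, ← Finset.mul_sum]; ring
  have := h.exp
  convert! this using 1
  simp; ring

/-- Stein identity. -/
lemma stein {n : ℕ} (d : Fin n → ℝ) (H H' : (Fin n → ℝ) → ℝ) (K : ℝ)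
    (hm : Measurable H) (hm' : Measurable H') (hb : ∀ z, |H z| ≤ K) (hb' : ∀ z, |H' z| ≤ K)
    (hd : ∀ z, HasLineDerivAt ℝ H (H' z) z d) :
    ∫ z, (d ⬝ᵥ z) * H z ∂(gam n) = (1 / (2 * π)) * ∫ z, H' z ∂(gam n) := by
  rw [integral_gam, integral_gam]
  have i1 : Integrable H (gam n) :=
    (integrable_const K).mono' hm.aestronglyMeasurable (Filter.Eventually.of_forall hb)
  have i2 : Integrable H' (gam n) :=
    (integrable_const K).mono' hm'.aestronglyMeasurable (Filter.Eventually.of_forall hb')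
  have hdot : Continuous fun z : Fin n → ℝ => d ⬝ᵥ z := by unfold dotProduct; fun_prop
  have i3 : Integrable (fun z => (d ⬝ᵥ z) * H z) (gam n) := by
    refine ((l1_integrable (n := n)).const_mul (l1 d * K)).mono'
      (hdot.measurable.mul hm).aestronglyMeasurable (Filter.Eventually.of_forall fun z => ?_)
    rw [norm_mul, Real.norm_eq_abs, Real.norm_eq_abs]
    calc |d ⬝ᵥ z| * |H z| ≤ (l1 d * l1 z) * K := by
          gcongr
          · exact mul_nonneg (l1_nonneg _) (l1_nonneg _)
          · exact dot_le_l1 d z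
          · exact hb z
      _ = _ := by ring
  rw [integrable_gam_iff] at i1 i2 i3
  have := integral_bilinear_hasLineDerivAt_right_eq_neg_left_of_integrable
    (μ := (volume : Measure (Fin n → ℝ))) (f := gau) (g := H)
    (f' := fun z => -(2 * π) * (d ⬝ᵥ z) * gau z) (g' := H') (v := d) (B := ContinuousLinearMap.mul ℝ ℝ)
    (by simp only [ContinuousLinearMap.mul_apply']
        refine (i3.const_mul (-(2 * π))).congr (Filter.Eventually.of_forall fun z => ?_)
        simp only []; ring)
    i2 i1 (fun z _ => gau_lineDeriv d z) (fun z _ => hd z)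
  simp only [ContinuousLinearMap.mul_apply'] at this
  rw [this, ← integral_neg, ← integral_const_mul]
  refine integral_congr_ae (Filter.Eventually.of_forall fun z => ?_)
  have := pi_ne_zero
  simp only []
  field_simp

/-- Stein identity with parameters. -/
lemma stein_prod {n : ℕ} {α : Type*} [MeasurableSpace α] (μ : Measure α) [IsProbabilityMeasure μ]
    (d : α → Fin n → ℝ) (hdm : Measurable d) (Kd : ℝ) (hdb : ∀ x, l1 (d x) ≤ Kd)
    (H H' : (Fin n → ℝ) × α → ℝ) (K : ℝ)
    (hm : Measurable H) (hm' : Measurable H') (hb : ∀ z, |H z| ≤ K) (hb' : ∀ z, |H' z| ≤ K)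
    (hd : ∀ x z, HasLineDerivAt ℝ (fun z => H (z, x)) (H' (z, x)) z (d x)) :
    Integrable (fun p => (d p.2 ⬝ᵥ p.1) * H p) ((gam n).prod μ) ∧
    ∫ p, (d p.2 ⬝ᵥ p.1) * H p ∂((gam n).prod μ) = (1 / (2 * π)) * ∫ p, H' p ∂((gam n).prod μ) := by
  have i2 : Integrable H' ((gam n).prod μ) :=
    (integrable_const K).mono' hm'.aestronglyMeasurable (Filter.Eventually.of_forall hb')
  have hdot : Measurable fun p : (Fin n → ℝ) × α => d p.2 ⬝ᵥ p.1 := by unfold dotProduct; fun_prop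
  have i3 : Integrable (fun p => (d p.2 ⬝ᵥ p.1) * H p) ((gam n).prod μ) := by
    refine (((l1_integrable (n := n)).comp_fst μ).const_mul (Kd * K)).mono'
      (hdot.mul hm).aestronglyMeasurable (Filter.Eventually.of_forall fun z => ?_)
    rw [norm_mul, Real.norm_eq_abs, Real.norm_eq_abs]
    calc |d z.2 ⬝ᵥ z.1| * |H z| ≤ (l1 (d z.2) * l1 z.1) * K := by
          gcongr
          · exact mul_nonneg (l1_nonneg _) (l1_nonneg _)
          · exact dot_le_l1 _ _
          · exact hb z
      _ ≤ (Kd * l1 z.1) * K := by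
          gcongr
          · exact (abs_nonneg _).trans (hb z)
          · exact l1_nonneg _
          · exact hdb _
      _ = _ := by ring
  refine ⟨i3, ?_⟩
  rw [integral_prod_symm _ i3, integral_prod_symm _ i2, ← integral_const_mul]
  refine integral_congr_ae (Filter.Eventually.of_forall fun x => ?_)
  exact stein (d x) (fun z => H (z, x)) (fun z => H' (z, x)) K (by fun_prop) (by fun_prop)
    (fun z => hb _) (fun z => hb' _) (hd x)
open MeasureTheory Real

section trig
set_option linter.unusedSectionVars false
variable {M : ℕ} {ι : Type} [Fintype ι]

/-- amplitude -/
noncomputable def trA (a : ι → ℝ) (k : ι → Fin M → ℝ) (τ : ℝ) (j : ι) : ℝ :=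
  a j * Real.exp (-(k j ⬝ᵥ k j) * (1 - τ ^ 2) / (4 * π))

/-- phase -/
noncomputable def trT (k : ι → Fin M → ℝ) (b : ι → ℝ) (τ : ℝ) (x : Fin M → ℝ) (j : ι) : ℝ :=
  τ * (k j ⬝ᵥ x) + b j

/-- Ornstein-Uhlenbeck evolution of a trigonometric polynomial -/
noncomputable def trP (a : ι → ℝ) (k : ι → Fin M → ℝ) (b : ι → ℝ) (τ : ℝ) (x : Fin M → ℝ) : ℝ :=
  ∑ j, trA a k τ j * Real.cos (trT k b τ x j)

/-- its time derivative -/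
noncomputable def trP' (a : ι → ℝ) (k : ι → Fin M → ℝ) (b : ι → ℝ) (τ : ℝ) (x : Fin M → ℝ) : ℝ :=
  ∑ j, trA a k τ j * ((k j ⬝ᵥ k j) * τ / (2 * π) * Real.cos (trT k b τ x j)
    - (k j ⬝ᵥ x) * Real.sin (trT k b τ x j))

/-- logarithmic gradient (up to factor `-τ`) -/
noncomputable def trQ (a : ι → ℝ) (k : ι → Fin M → ℝ) (b : ι → ℝ) (τ : ℝ) (x : Fin M → ℝ) :
    Fin M → ℝ :=
  fun l => ∑ j, trA a k τ j * Real.sin (trT k b τ x j) / trP a k b τ x * k j l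

variable (a : ι → ℝ) (k : ι → Fin M → ℝ) (b : ι → ℝ)

lemma dot_cont (d : Fin M → ℝ) : Continuous fun z : Fin M → ℝ => d ⬝ᵥ z := by
  unfold dotProduct; fun_prop

lemma trT_cont (τ : ℝ) (j : ι) : Continuous fun x => trT k b τ x j := by
  unfold trT; have := dot_cont (k j); fun_prop

lemma trP_cont (τ : ℝ) : Continuous (trP a k b τ) := by
  unfold trP; have := trT_cont k b τ; fun_prop

lemma trP'_cont (τ : ℝ) : Continuous (trP' a k b τ) := by
  unfold trP'; have := trT_cont k b τ; have := fun j => dot_cont (k j); fun_prop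

lemma trQ_meas (τ : ℝ) : Measurable (trQ a k b τ) := by
  unfold trQ
  have := fun j => (trT_cont k b τ j).measurable
  have := (trP_cont a k b τ).measurable
  fun_prop

lemma trA_deriv (τ : ℝ) (j : ι) :
    HasDerivAt (fun τ => trA a k τ j) (trA a k τ j * ((k j ⬝ᵥ k j) * τ / (2 * π))) τ := by
  unfold trA
  have h1 : HasDerivAt (fun τ : ℝ => -(k j ⬝ᵥ k j) * (1 - τ ^ 2) / (4 * π))
      ((k j ⬝ᵥ k j) * τ / (2 * π)) τ := by
    have := ((((hasDerivAt_id τ).pow 2).const_sub 1).const_mul (-(k j ⬝ᵥ k j))).div_const (4 * π)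
    convert! this using 1
    have := pi_ne_zero
    simp; field_simp; ring
  have := h1.exp.const_mul (a j)
  convert! this using 1; ring

lemma trP_deriv (τ : ℝ) (x : Fin M → ℝ) :
    HasDerivAt (fun τ => trP a k b τ x) (trP' a k b τ x) τ := by
  unfold trP trP'
  refine HasDerivAt.fun_sum fun j _ => ?_
  have h1 : HasDerivAt (fun τ => trT k b τ x j) (k j ⬝ᵥ x) τ := by
    unfold trT
    simpa using ((hasDerivAt_id τ).mul_const (k j ⬝ᵥ x)).add_const (b j)
  have := (trA_deriv a k τ j).mul h1.cos
  convert! this using 1; ring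

lemma trT_line (τ : ℝ) (x d : Fin M → ℝ) (j : ι) :
    HasLineDerivAt ℝ (fun x => trT k b τ x j) (τ * (k j ⬝ᵥ d)) x d := by
  unfold HasLineDerivAt trT
  simp only [dotProduct_add, dotProduct_smul, smul_eq_mul]
  have := ((((hasDerivAt_id (0:ℝ)).mul_const (k j ⬝ᵥ d)).const_add (k j ⬝ᵥ x)).const_mul τ).add_const (b j)
  convert! this using 1; ring

lemma trP_line (τ : ℝ) (x d : Fin M → ℝ) (hx : trP a k b τ x ≠ 0) :
    HasLineDerivAt ℝ (trP a k b τ) (-τ * (trQ a k b τ x ⬝ᵥ d) * trP a k b τ x) x d := by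
  have h : HasLineDerivAt ℝ (trP a k b τ)
      (∑ j, trA a k τ j * (-Real.sin (trT k b τ x j) * (τ * (k j ⬝ᵥ d)))) x d := by
    unfold HasLineDerivAt trP
    refine HasDerivAt.fun_sum fun j _ => ?_
    have := (trT_line k b τ x d j)
    unfold HasLineDerivAt at this
    have := this.cos.const_mul (trA a k τ j)
    convert! this using 1
    simp
  convert! h using 1
  unfold trQ
  simp only [dotProduct, Finset.sum_mul, Finset.mul_sum]
  rw [Finset.sum_comm]
  refine Finset.sum_congr rfl fun j _ => Finset.sum_congr rfl fun l _ => ?_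
  field_simp

lemma trA_abs (τ : ℝ) (h0 : 0 ≤ τ) (h1 : τ ≤ 1) (j : ι) : |trA a k τ j| ≤ |a j| := by
  unfold trA
  rw [abs_mul, abs_of_pos (Real.exp_pos _)]
  refine mul_le_of_le_one_right (abs_nonneg _) ?_
  rw [Real.exp_le_one_iff]
  have h2 : 0 ≤ k j ⬝ᵥ k j := Finset.sum_nonneg fun i _ => mul_self_nonneg _
  have h3 : 0 ≤ 1 - τ ^ 2 := by nlinarith
  have := pi_pos
  rw [div_le_iff₀ (by positivity)]
  nlinarith [mul_nonneg h2 h3]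

lemma trP_abs (τ : ℝ) (h0 : 0 ≤ τ) (h1 : τ ≤ 1) (x : Fin M → ℝ) : |trP a k b τ x| ≤ ∑ j, |a j| := by
  unfold trP
  refine (Finset.abs_sum_le_sum_abs _ _).trans (Finset.sum_le_sum fun j _ => ?_)
  rw [abs_mul]
  calc _ ≤ |a j| * 1 := mul_le_mul (trA_abs a k τ h0 h1 j) (Real.abs_cos_le_one _) (abs_nonneg _)
          (abs_nonneg _)
    _ = _ := by ring

/-- the constant in the time derivative bound -/
noncomputable def trK : ℝ := ∑ j, |a j| * ((k j ⬝ᵥ k j) / (2 * π) + l1 (k j))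

lemma trP'_abs (τ : ℝ) (h0 : 0 ≤ τ) (h1 : τ ≤ 1) (x : Fin M → ℝ) :
    |trP' a k b τ x| ≤ trK a k * (1 + l1 x) := by
  unfold trP' trK
  rw [Finset.sum_mul]
  refine (Finset.abs_sum_le_sum_abs _ _).trans (Finset.sum_le_sum fun j _ => ?_)
  rw [abs_mul, mul_assoc]
  have h2 : 0 ≤ k j ⬝ᵥ k j := Finset.sum_nonneg fun i _ => mul_self_nonneg _
  have hp := pi_pos
  have e : 0 ≤ (k j ⬝ᵥ k j) / (2 * π) := by positivity
  have e1 : |(k j ⬝ᵥ k j) * τ / (2 * π) * Real.cos (trT k b τ x j)| ≤ (k j ⬝ᵥ k j) / (2 * π) := by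
    rw [abs_mul, mul_div_right_comm, abs_mul, abs_of_nonneg e, abs_of_nonneg h0, mul_assoc]
    refine mul_le_of_le_one_right e ?_
    exact mul_le_one₀ h1 (abs_nonneg _) (Real.abs_cos_le_one _)
  have e2 : |(k j ⬝ᵥ x) * Real.sin (trT k b τ x j)| ≤ l1 (k j) * l1 x := by
    rw [abs_mul]
    exact (mul_le_of_le_one_right (abs_nonneg _) (Real.abs_sin_le_one _)).trans (dot_le_l1 _ _)
  refine mul_le_mul (trA_abs a k τ h0 h1 j) ?_ (abs_nonneg _) (abs_nonneg _)
  · refine (abs_sub _ _).trans ?_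
    have := l1_nonneg (k j)
    have := l1_nonneg x
    nlinarith [mul_nonneg e (l1_nonneg x)]

lemma trP_gauss (τ : ℝ) (h0 : 0 ≤ τ) (h1 : τ ≤ 1) (x : Fin M → ℝ) :
    trP a k b τ x = ∫ z, trP a k b 1 (τ • x + √(1 - τ ^ 2) • z) ∂(gam M) := by
  have h3 : 0 ≤ 1 - τ ^ 2 := by nlinarith
  unfold trP
  rw [integral_finsetSum]
  · refine Finset.sum_congr rfl fun j _ => ?_
    rw [integral_const_mul, integral_gam]
    have := gau_integral_cos (fun i => √(1 - τ ^ 2) * k j i) (trT k b τ x j)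
    have e : ∀ z, trT k b 1 (τ • x + √(1 - τ ^ 2) • z) j
        = (∑ i, √(1 - τ ^ 2) * k j i * z i) + trT k b τ x j := by
      intro z
      unfold trT
      simp only [dotProduct_add, dotProduct_smul, smul_eq_mul]
      have : (∑ i, √(1 - τ ^ 2) * k j i * z i) = √(1 - τ ^ 2) * (k j ⬝ᵥ z) := by
        rw [dotProduct, Finset.mul_sum]; exact Finset.sum_congr rfl fun i _ => by ring
      rw [this]; ring
    simp_rw [e]
    rw [this, ← mul_assoc]
    congr 1
    have e2 : (∑ i, √(1 - τ ^ 2) * k j i * (√(1 - τ ^ 2) * k j i)) = (1 - τ ^ 2) * (k j ⬝ᵥ k j) := by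
      rw [dotProduct, Finset.mul_sum]
      refine Finset.sum_congr rfl fun i _ => ?_
      nlinarith [Real.mul_self_sqrt h3]
    rw [e2]
    unfold trA
    simp
    left; ring_nf
  · intro j _
    refine (integrable_const |trA a k 1 j|).mono' ?_ (Filter.Eventually.of_forall fun z => ?_)
    · have := trT_cont k b 1 j
      fun_prop
    · rw [norm_mul]
      exact mul_le_of_le_one_right (abs_nonneg _) (Real.abs_cos_le_one _)

lemma trP_lower (m : ℝ) (hm : ∀ x, m ≤ trP a k b 1 x) (τ : ℝ) (h0 : 0 ≤ τ) (h1 : τ ≤ 1)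
    (x : Fin M → ℝ) : m ≤ trP a k b τ x := by
  rw [trP_gauss a k b τ h0 h1 x]
  have : m = ∫ z, m ∂(gam M) := by simp
  rw [this]
  have c := trP_cont a k b 1
  refine integral_mono (by simp) ?_ fun z => hm _
  refine (integrable_const (∑ j, |a j|)).mono' (by fun_prop)
    (Filter.Eventually.of_forall fun z => trP_abs a k b 1 zero_le_one le_rfl _)

lemma trP_zero (x : Fin M → ℝ) : trP a k b 0 x = ∫ z, trP a k b 1 z ∂(gam M) := by
  rw [trP_gauss a k b 0 le_rfl zero_le_one x]; simp

/-- bound for `trQ` -/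
noncomputable def trL (m : ℝ) : ℝ := ∑ j, |a j| / m * l1 (k j)

lemma trQ_abs (m : ℝ) (hm0 : 0 < m) (hm : ∀ x, m ≤ trP a k b 1 x) (τ : ℝ) (h0 : 0 ≤ τ) (h1 : τ ≤ 1)
    (x : Fin M → ℝ) : l1 (trQ a k b τ x) ≤ trL a k m := by
  have hP := trP_lower a k b m hm τ h0 h1 x
  have hP0 : 0 < trP a k b τ x := hm0.trans_le hP
  unfold l1 trQ trL
  calc _ ≤ ∑ l, ∑ j, |a j| / m * |k j l| := by
        refine Finset.sum_le_sum fun l _ => (Finset.abs_sum_le_sum_abs _ _).trans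
          (Finset.sum_le_sum fun j _ => ?_)
        rw [abs_mul, abs_div, abs_of_pos hP0, abs_mul]
        gcongr
        exact (mul_le_of_le_one_right (abs_nonneg _) (Real.abs_sin_le_one _)).trans
          (trA_abs a k τ h0 h1 j)
    _ = _ := by
        rw [Finset.sum_comm]
        refine Finset.sum_congr rfl fun j _ => ?_
        rw [l1, Finset.mul_sum]
end trig
open MeasureTheory Real

/-- Data for the functional inequality. -/
structure Dat (M N : ℕ) (Ω : Type) [MeasurableSpace Ω] (ι : Type) [Fintype ι] where
  ν : Measure Ω
  prob : IsProbabilityMeasure ν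
  B : Ω → Fin M → Fin M → ℝ
  D : Ω → Fin M → Fin N → ℝ
  hB : ∀ a b, Measurable fun ω => B ω a b
  hD : ∀ a b, Measurable fun ω => D ω a b
  orth : ∀ ω a a', ∑ b, B ω a b * B ω a' b + ∑ c, D ω a c * D ω a' c = if a = a' then 1 else 0
  C : ℝ
  hC : 0 < C
  hBC : ∀ e : Fin M → ℝ, ∫ ω, ∑ a, (B ω a ⬝ᵥ e) ^ 2 ∂ν ≤ C * (e ⬝ᵥ e)
  a : ι → ℝ
  k : ι → Fin M → ℝ
  b : ι → ℝ
  m : ℝ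
  hm0 : 0 < m
  hm : ∀ x, m ≤ trP a k b 1 x

lemma slice_meas {α β δ : Type*} [MeasurableSpace α] [MeasurableSpace β] [MeasurableSpace δ]
    {f : α × β → δ} (hf : Measurable f) (x : α) : Measurable fun p : β => f (x, p) :=
  hf.comp measurable_prodMk_left

namespace Dat
variable {M N : ℕ} {Ω : Type} [MeasurableSpace Ω] {ι : Type} [Fintype ι] (X : Dat M N Ω ι)

instance : IsProbabilityMeasure X.ν := X.prob

/-- joint law -/
noncomputable def κ : Measure (Ω × (Fin N → ℝ)) := X.ν.prod (gam N)

instance : IsProbabilityMeasure X.κ := by unfold κ; infer_instance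

/-- argument -/
def yy (p : Ω × (Fin N → ℝ)) (v : Fin M → ℝ) : Fin M → ℝ :=
  fun a => X.B p.1 a ⬝ᵥ v + X.D p.1 a ⬝ᵥ p.2

lemma B_abs (ω : Ω) (a b : Fin M) : |X.B ω a b| ≤ 1 := by
  have h := X.orth ω a a
  rw [if_pos rfl] at h
  have h1 := Finset.single_le_sum (f := fun b => X.B ω a b * X.B ω a b)
    (fun _ _ => mul_self_nonneg _) (Finset.mem_univ b)
  have h2 : 0 ≤ ∑ c, X.D ω a c * X.D ω a c := Finset.sum_nonneg fun _ _ => mul_self_nonneg _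
  rw [abs_le_one_iff_mul_self_le_one]
  linarith

lemma D_abs (ω : Ω) (a : Fin M) (b : Fin N) : |X.D ω a b| ≤ 1 := by
  have h := X.orth ω a a
  rw [if_pos rfl] at h
  have h1 := Finset.single_le_sum (f := fun b => X.D ω a b * X.D ω a b)
    (fun _ _ => mul_self_nonneg _) (Finset.mem_univ b)
  have h2 : 0 ≤ ∑ c, X.B ω a c * X.B ω a c := Finset.sum_nonneg fun _ _ => mul_self_nonneg _
  rw [abs_le_one_iff_mul_self_le_one]
  linarith

lemma B_l1 (ω : Ω) (a : Fin M) : l1 (X.B ω a) ≤ M := by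
  unfold l1
  refine (Finset.sum_le_sum fun b _ => X.B_abs ω a b).trans (by simp)

lemma D_l1 (ω : Ω) (a : Fin M) : l1 (X.D ω a) ≤ N := by
  unfold l1
  refine (Finset.sum_le_sum fun b _ => X.D_abs ω a b).trans (by simp)

lemma Bd_l1 (ω : Ω) (d : Fin M → ℝ) : l1 (fun a => X.B ω a ⬝ᵥ d) ≤ M * M * l1 d := by
  unfold l1
  calc _ ≤ ∑ a : Fin M, (M : ℝ) * l1 d := by
        refine Finset.sum_le_sum fun a _ => (dot_le_l1 _ _).trans ?_
        have := X.B_l1 ω a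
        have := l1_nonneg d
        gcongr
    _ = _ := by simp [l1]; ring

lemma Dd_l1 (ω : Ω) (d : Fin N → ℝ) : l1 (fun a => X.D ω a ⬝ᵥ d) ≤ M * N * l1 d := by
  unfold l1
  calc _ ≤ ∑ a : Fin M, (N : ℝ) * l1 d := by
        refine Finset.sum_le_sum fun a _ => (dot_le_l1 _ _).trans ?_
        have := X.D_l1 ω a
        have := l1_nonneg d
        gcongr
    _ = _ := by simp [l1]; ring

lemma yy_l1 (p : Ω × (Fin N → ℝ)) (v : Fin M → ℝ) :
    l1 (X.yy p v) ≤ M * M * l1 v + M * N * l1 p.2 := by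
  refine le_trans ?_ (add_le_add (X.Bd_l1 p.1 v) (X.Dd_l1 p.1 p.2))
  unfold l1 yy
  rw [← Finset.sum_add_distrib]
  exact Finset.sum_le_sum fun a _ => abs_add_le _ _

lemma yy_meas : Measurable fun q : (Fin M → ℝ) × (Ω × (Fin N → ℝ)) => X.yy q.2 q.1 := by
  unfold yy dotProduct
  have := X.hB
  have := X.hD
  refine measurable_pi_lambda _ fun a => ?_
  refine Measurable.add ?_ ?_
  · refine Finset.measurable_sum _ fun b _ => ((X.hB a b).comp (by fun_prop)).mul (by fun_prop)
  · refine Finset.measurable_sum _ fun b _ => ((X.hD a b).comp (by fun_prop)).mul (by fun_prop)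

lemma yy_meas1 (v : Fin M → ℝ) : Measurable fun p : Ω × (Fin N → ℝ) => X.yy p v :=
  slice_meas X.yy_meas v

lemma yy_line (p : Ω × (Fin N → ℝ)) (v d : Fin M → ℝ) (t : ℝ) :
    X.yy p (v + t • d) = X.yy p v + t • (fun a => X.B p.1 a ⬝ᵥ d) := by
  ext a
  simp only [yy, dotProduct_add, dotProduct_smul, smul_eq_mul, Pi.add_apply, Pi.smul_apply]
  ring

lemma yy_line2 (ω : Ω) (w d : Fin N → ℝ) (v : Fin M → ℝ) (t : ℝ) :
    X.yy (ω, w + t • d) v = X.yy (ω, w) v + t • (fun a => X.D ω a ⬝ᵥ d) := by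
  ext a
  simp only [yy, dotProduct_add, dotProduct_smul, smul_eq_mul, Pi.add_apply, Pi.smul_apply]
  ring

/-- evolved polynomial -/
noncomputable abbrev P (τ : ℝ) (x : Fin M → ℝ) : ℝ := trP X.a X.k X.b τ x
/-- evolved polynomial, derivative -/
noncomputable abbrev P' (τ : ℝ) (x : Fin M → ℝ) : ℝ := trP' X.a X.k X.b τ x
/-- log gradient -/
noncomputable abbrev Q (τ : ℝ) (x : Fin M → ℝ) : Fin M → ℝ := trQ X.a X.k X.b τ x

lemma P_lower {τ : ℝ} (h : τ ∈ Set.Icc (0 : ℝ) 1) (x : Fin M → ℝ) : X.m ≤ X.P τ x :=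
  trP_lower _ _ _ _ X.hm τ h.1 h.2 x

lemma P_pos {τ : ℝ} (h : τ ∈ Set.Icc (0 : ℝ) 1) (x : Fin M → ℝ) : 0 < X.P τ x :=
  X.hm0.trans_le (X.P_lower h x)

/-- log bound -/
noncomputable def Lg : ℝ := |Real.log X.m| + |Real.log (∑ j, |X.a j|)|

lemma log_abs {τ : ℝ} (h : τ ∈ Set.Icc (0 : ℝ) 1) (x : Fin M → ℝ) : |Real.log (X.P τ x)| ≤ X.Lg := by
  have h1 := X.P_lower h x
  have h2 : X.P τ x ≤ ∑ j, |X.a j| := (le_abs_self _).trans (trP_abs _ _ _ τ h.1 h.2 x)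
  have h3 := Real.log_le_log X.hm0 h1
  have h4 := Real.log_le_log (X.P_pos h x) h2
  unfold Lg
  rw [abs_le]
  constructor
  · linarith [neg_abs_le (Real.log X.m), abs_nonneg (Real.log (∑ j, |X.a j|))]
  · linarith [le_abs_self (Real.log (∑ j, |X.a j|)), abs_nonneg (Real.log X.m)]

lemma log_line {τ : ℝ} (h : τ ∈ Set.Icc (0 : ℝ) 1) (x d : Fin M → ℝ) :
    HasLineDerivAt ℝ (fun x => Real.log (X.P τ x)) (-τ * (X.Q τ x ⬝ᵥ d)) x d := by
  have hp := (X.P_pos h x).ne'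
  have h1 := trP_line X.a X.k X.b τ x d hp
  unfold HasLineDerivAt at *
  have := h1.log (by simpa using hp)
  convert! this using 1
  simp only [zero_smul, add_zero]
  field_simp

lemma line_shift {n : ℕ} {f : (Fin n → ℝ) → ℝ} {f' : ℝ} {x d : Fin n → ℝ} {t : ℝ}
    (h : HasLineDerivAt ℝ f f' (x + t • d) d) : HasDerivAt (fun s : ℝ => f (x + s • d)) f' t := by
  unfold HasLineDerivAt at h
  have h' : HasDerivAt (fun s : ℝ => f (x + t • d + s • d)) f' (t - t) := by simpa using h
  have := HasDerivAt.comp_sub_const t t h'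
  convert! this using 1
  funext s
  congr 1
  rw [add_assoc, ← add_smul]; congr 2; ring

/-- potential -/
noncomputable def U (τ : ℝ) (v : Fin M → ℝ) : ℝ := ∫ p, Real.log (X.P τ (X.yy p v)) ∂X.κ

/-- gradient of the potential -/
noncomputable def R (τ : ℝ) (v : Fin M → ℝ) : Fin M → ℝ :=
  fun b => ∫ p, ∑ a, X.B p.1 a b * X.Q τ (X.yy p v) a ∂X.κ

lemma logP_meas (τ : ℝ) : Measurable fun q : (Fin M → ℝ) × (Ω × (Fin N → ℝ)) =>
    Real.log (X.P τ (X.yy q.2 q.1)) :=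
  Real.measurable_log.comp ((trP_cont X.a X.k X.b τ).measurable.comp X.yy_meas)

lemma Q_meas (τ : ℝ) : Measurable fun q : (Fin M → ℝ) × (Ω × (Fin N → ℝ)) =>
    X.Q τ (X.yy q.2 q.1) :=
  (trQ_meas X.a X.k X.b τ).comp X.yy_meas

lemma Q_meas1 (τ : ℝ) (v : Fin M → ℝ) : Measurable fun p : (Ω × (Fin N → ℝ)) =>
    X.Q τ (X.yy p v) :=
  slice_meas (X.Q_meas τ) v

lemma U_meas (τ : ℝ) : Measurable (X.U τ) :=
  ((X.logP_meas τ).stronglyMeasurable.integral_prod_right' (ν := X.κ)).measurable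

lemma R_meas (τ : ℝ) : Measurable (X.R τ) := by
  refine measurable_pi_lambda _ fun b => ?_
  have : Measurable fun q : (Fin M → ℝ) × (Ω × (Fin N → ℝ)) =>
      ∑ a, X.B q.2.1 a b * X.Q τ (X.yy q.2 q.1) a := by
    refine Finset.measurable_sum _ fun a _ => ((X.hB a b).comp (by fun_prop)).mul ?_
    exact (measurable_pi_apply a).comp (X.Q_meas τ)
  exact (this.stronglyMeasurable.integral_prod_right' (ν := X.κ)).measurable

lemma U_abs {τ : ℝ} (h : τ ∈ Set.Icc (0 : ℝ) 1) (v : Fin M → ℝ) : |X.U τ v| ≤ X.Lg := by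
  have := norm_integral_le_of_norm_le_const (μ := X.κ) (f := fun p => Real.log (X.P τ (X.yy p v)))
    (Filter.Eventually.of_forall fun p => X.log_abs h _)
  simpa [U] using this

/-- gradient bound -/
noncomputable def L : ℝ := trL X.a X.k X.m

lemma Q_l1 {τ : ℝ} (h : τ ∈ Set.Icc (0 : ℝ) 1) (x : Fin M → ℝ) : l1 (X.Q τ x) ≤ X.L :=
  trQ_abs _ _ _ _ X.hm0 X.hm τ h.1 h.2 x

lemma L_nonneg : 0 ≤ X.L :=
  (l1_nonneg _).trans (X.Q_l1 (τ := 0) (by simp) 0)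

lemma coord_le_l1 {n : ℕ} (x : Fin n → ℝ) (i : Fin n) : |x i| ≤ l1 x :=
  Finset.single_le_sum (f := fun i => |x i|) (fun _ _ => abs_nonneg _) (Finset.mem_univ i)

lemma BQ_abs {τ : ℝ} (h : τ ∈ Set.Icc (0 : ℝ) 1) (ω : Ω) (x : Fin M → ℝ) (b : Fin M) :
    |∑ a, X.B ω a b * X.Q τ x a| ≤ X.L := by
  refine le_trans ?_ (X.Q_l1 h x)
  refine (Finset.abs_sum_le_sum_abs _ _).trans (Finset.sum_le_sum fun a _ => ?_)
  rw [abs_mul]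
  exact mul_le_of_le_one_left (abs_nonneg _) (X.B_abs ω a b)

lemma BQ_meas (τ : ℝ) (v : Fin M → ℝ) (b : Fin M) : Measurable fun p : Ω × (Fin N → ℝ) =>
      ∑ a, X.B p.1 a b * X.Q τ (X.yy p v) a := by
    refine Finset.measurable_sum _ fun a _ => ((X.hB a b).comp (by fun_prop)).mul ?_
    exact (measurable_pi_apply a).comp (X.Q_meas1 τ v)

lemma BQ_int {τ : ℝ} (h : τ ∈ Set.Icc (0 : ℝ) 1) (v : Fin M → ℝ) (b : Fin M) :
    Integrable (fun p => ∑ a, X.B p.1 a b * X.Q τ (X.yy p v) a) X.κ :=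
  (integrable_const X.L).mono' (X.BQ_meas τ v b).aestronglyMeasurable
    (Filter.Eventually.of_forall fun p => X.BQ_abs h _ _ b)

lemma R_abs {τ : ℝ} (h : τ ∈ Set.Icc (0 : ℝ) 1) (v : Fin M → ℝ) (b : Fin M) : |X.R τ v b| ≤ X.L := by
  have := norm_integral_le_of_norm_le_const (μ := X.κ)
    (f := fun p => ∑ a, X.B p.1 a b * X.Q τ (X.yy p v) a)
    (Filter.Eventually.of_forall fun p => X.BQ_abs h _ _ b)
  simpa [R] using this

lemma dot_BQ (ω : Ω) (x d : Fin M → ℝ) :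
    x ⬝ᵥ (fun a => X.B ω a ⬝ᵥ d) = ∑ b, d b * ∑ a, X.B ω a b * x a := by
  simp only [dotProduct, Finset.mul_sum]
  rw [Finset.sum_comm]
  exact Finset.sum_congr rfl fun _ _ => Finset.sum_congr rfl fun _ _ => by ring

lemma R_dot {τ : ℝ} (h : τ ∈ Set.Icc (0 : ℝ) 1) (v d : Fin M → ℝ) :
    X.R τ v ⬝ᵥ d = ∫ p, X.Q τ (X.yy p v) ⬝ᵥ (fun a => X.B p.1 a ⬝ᵥ d) ∂X.κ := by
  simp_rw [dot_BQ]
  rw [integral_finsetSum _ fun b _ => (X.BQ_int h v b).const_mul _]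
  unfold R dotProduct
  refine Finset.sum_congr rfl fun b _ => ?_
  rw [integral_const_mul, mul_comm]

lemma QB_abs {τ : ℝ} (h : τ ∈ Set.Icc (0 : ℝ) 1) (ω : Ω) (x d : Fin M → ℝ) :
    |X.Q τ x ⬝ᵥ (fun a => X.B ω a ⬝ᵥ d)| ≤ X.L * (M * M * l1 d) := by
  refine (dot_le_l1 _ _).trans ?_
  exact mul_le_mul (X.Q_l1 h x) (X.Bd_l1 ω d) (l1_nonneg _) X.L_nonneg

lemma U_line {τ : ℝ} (h : τ ∈ Set.Icc (0 : ℝ) 1) (v d : Fin M → ℝ) :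
    HasLineDerivAt ℝ (X.U τ) (-τ * (X.R τ v ⬝ᵥ d)) v d := by
  rw [X.R_dot h, ← integral_const_mul]
  unfold HasLineDerivAt U
  have hm : ∀ v, Measurable fun p => Real.log (X.P τ (X.yy p v)) := fun v =>
    slice_meas (X.logP_meas τ) v
  have key := hasDerivAt_integral_of_dominated_loc_of_deriv_le (μ := X.κ) (x₀ := (0 : ℝ))
    (s := Set.univ) (F := fun t p => Real.log (X.P τ (X.yy p (v + t • d))))
    (F' := fun t p => -τ * (X.Q τ (X.yy p (v + t • d)) ⬝ᵥ (fun a => X.B p.1 a ⬝ᵥ d)))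
    (bound := fun _ => X.L * (M * M * l1 d)) Filter.univ_mem
    (Filter.Eventually.of_forall fun t => (hm _).aestronglyMeasurable)
    ((integrable_const X.Lg).mono' (hm _).aestronglyMeasurable
      (Filter.Eventually.of_forall fun p => X.log_abs h _))
    (by
      simp_rw [dot_BQ]
      have := X.BQ_meas τ (v + (0:ℝ) • d)
      exact (Measurable.const_mul (Finset.measurable_sum _ fun b _ => (this b).const_mul _)
        _).aestronglyMeasurable)
    (Filter.Eventually.of_forall fun p t _ => by
      rw [norm_mul]
      refine (mul_le_of_le_one_left (norm_nonneg _) ?_).trans (X.QB_abs h _ _ _)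
      rw [norm_neg, Real.norm_eq_abs, abs_of_nonneg h.1]; exact h.2)
    (integrable_const _)
    (Filter.Eventually.of_forall fun p t _ => by
      have := X.log_line h (X.yy p v + t • (fun a => X.B p.1 a ⬝ᵥ d)) (fun a => X.B p.1 a ⬝ᵥ d)
      have := line_shift this
      simp_rw [yy_line]
      exact this)
  simpa using key.2

/-- linear growth bound of the time derivative -/
lemma dt_abs {τ : ℝ} (h : τ ∈ Set.Icc (0 : ℝ) 1) (p : Ω × (Fin N → ℝ)) (v : Fin M → ℝ) :
    |X.P' τ (X.yy p v) / X.P τ (X.yy p v)| ≤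
      trK X.a X.k / X.m * (1 + M * M * l1 v + M * N * l1 p.2) := by
  have h1 := trP'_abs X.a X.k X.b τ h.1 h.2 (X.yy p v)
  have hK : 0 ≤ trK X.a X.k := by
    have := (abs_nonneg _).trans (trP'_abs X.a X.k X.b 0 le_rfl zero_le_one 0)
    simpa [l1] using this
  rw [abs_div, abs_of_pos (X.P_pos h _), div_mul_eq_mul_div]
  refine div_le_div₀ ?_ ?_ X.hm0 (X.P_lower h _)
  · have := l1_nonneg v
    have := l1_nonneg p.2
    positivity
  · refine h1.trans ?_
    have := X.yy_l1 p v
    refine mul_le_mul_of_nonneg_left ?_ hK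
    linarith

lemma dt_meas (τ : ℝ) : Measurable fun q : (Fin M → ℝ) × (Ω × (Fin N → ℝ)) =>
    X.P' τ (X.yy q.2 q.1) / X.P τ (X.yy q.2 q.1) :=
  ((trP'_cont X.a X.k X.b τ).measurable.comp X.yy_meas).div
    ((trP_cont X.a X.k X.b τ).measurable.comp X.yy_meas)

lemma l1_κ : Integrable (fun p : Ω × (Fin N → ℝ) => l1 p.2) X.κ :=
  (l1_integrable (n := N)).comp_snd X.ν

lemma bd_int (c1 c2 c3 : ℝ) : Integrable (fun p : Ω × (Fin N → ℝ) => c1 * (c2 + c3 * l1 p.2)) X.κ :=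
  ((integrable_const _).add (X.l1_κ.const_mul _)).const_mul _

lemma U_deriv {τ : ℝ} (h : τ ∈ Set.Ioo (0 : ℝ) 1) (v : Fin M → ℝ) :
    HasDerivAt (fun τ => X.U τ v) (∫ p, X.P' τ (X.yy p v) / X.P τ (X.yy p v) ∂X.κ) τ := by
  unfold U
  have hm : ∀ τ, Measurable fun p => Real.log (X.P τ (X.yy p v)) := fun τ =>
    slice_meas (X.logP_meas τ) v
  exact (hasDerivAt_integral_of_dominated_loc_of_deriv_le (μ := X.κ) (x₀ := τ)
    (s := Set.Ioo 0 1) (F := fun τ p => Real.log (X.P τ (X.yy p v)))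
    (F' := fun τ p => X.P' τ (X.yy p v) / X.P τ (X.yy p v))
    (bound := fun p => trK X.a X.k / X.m * (1 + M * M * l1 v + M * N * l1 p.2))
    (isOpen_Ioo.mem_nhds h)
    (Filter.Eventually.of_forall fun t => (hm _).aestronglyMeasurable)
    ((integrable_const X.Lg).mono' (hm _).aestronglyMeasurable
      (Filter.Eventually.of_forall fun p => X.log_abs (Set.Ioo_subset_Icc_self h) _))
    (slice_meas (X.dt_meas τ) v).aestronglyMeasurable
    (Filter.Eventually.of_forall fun p t ht => X.dt_abs (Set.Ioo_subset_Icc_self ht) p v)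
    (X.bd_int _ _ _)
    (Filter.Eventually.of_forall fun p t ht =>
      (trP_deriv X.a X.k X.b t (X.yy p v)).log (X.P_pos (Set.Ioo_subset_Icc_self ht) _).ne')).2

lemma U_contOn (v : Fin M → ℝ) : ContinuousOn (fun τ => X.U τ v) (Set.Icc 0 1) := by
  unfold U
  have hm : ∀ τ, Measurable fun p => Real.log (X.P τ (X.yy p v)) := fun τ =>
    slice_meas (X.logP_meas τ) v
  refine continuousOn_of_dominated (bound := fun _ => X.Lg) (fun τ _ => (hm τ).aestronglyMeasurable)
    (fun τ h => Filter.Eventually.of_forall fun p => X.log_abs h _) (integrable_const _)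
    (Filter.Eventually.of_forall fun p => ?_)
  refine ContinuousOn.log ?_ fun τ h => (X.P_pos h _).ne'
  exact fun τ _ => (trP_deriv X.a X.k X.b τ (X.yy p v)).continuousAt.continuousWithinAt

/-- weight -/
noncomputable def g (τ : ℝ) (v : Fin M → ℝ) : ℝ := Real.exp (X.U τ v / X.C)

lemma g_pos (τ : ℝ) (v : Fin M → ℝ) : 0 < X.g τ v := Real.exp_pos _

lemma g_meas (τ : ℝ) : Measurable (X.g τ) := by
  unfold g; exact ((X.U_meas τ).div_const _).exp

/-- bound of the weight -/
noncomputable def Kg : ℝ := Real.exp (X.Lg / X.C)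

lemma g_abs {τ : ℝ} (h : τ ∈ Set.Icc (0 : ℝ) 1) (v : Fin M → ℝ) : |X.g τ v| ≤ X.Kg := by
  rw [abs_of_pos (X.g_pos _ _)]
  unfold g Kg
  have := X.hC
  have := (le_abs_self _).trans (X.U_abs h v)
  gcongr

lemma Kg_pos : 0 < X.Kg := Real.exp_pos _

/-- partition function -/
noncomputable def Z (τ : ℝ) : ℝ := ∫ v, X.g τ v ∂(gam M)

lemma Z_contOn : ContinuousOn X.Z (Set.Icc 0 1) := by
  unfold Z
  refine continuousOn_of_dominated (bound := fun _ => X.Kg)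
    (fun τ _ => (X.g_meas τ).aestronglyMeasurable)
    (fun τ h => Filter.Eventually.of_forall fun p => X.g_abs h _) (integrable_const _)
    (Filter.Eventually.of_forall fun v => ?_)
  unfold g
  exact ((X.U_contOn v).div_const _).rexp

/-- averaged time derivative -/
noncomputable def dU (τ : ℝ) (v : Fin M → ℝ) : ℝ := ∫ p, X.P' τ (X.yy p v) / X.P τ (X.yy p v) ∂X.κ

lemma dU_meas (τ : ℝ) : Measurable (X.dU τ) :=
  ((X.dt_meas τ).stronglyMeasurable.integral_prod_right' (ν := X.κ)).measurable

lemma dU_abs {τ : ℝ} (h : τ ∈ Set.Icc (0 : ℝ) 1) (v : Fin M → ℝ) :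
    |X.dU τ v| ≤ trK X.a X.k / X.m * ((1 + M * N * ∫ p, l1 p.2 ∂X.κ) + M * M * l1 v) := by
  unfold dU
  have := norm_integral_le_of_norm_le (μ := X.κ)
    (f := fun p => X.P' τ (X.yy p v) / X.P τ (X.yy p v)) (X.bd_int (trK X.a X.k / X.m) (1 + M * M * l1 v) (M * N))
    (Filter.Eventually.of_forall fun p => X.dt_abs h p v)
  refine this.trans_eq ?_
  rw [integral_const_mul, integral_add (integrable_const _) (X.l1_κ.const_mul _), integral_const_mul]
  simp
  left; ring

lemma Z_deriv {τ : ℝ} (h : τ ∈ Set.Ioo (0 : ℝ) 1) :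
    HasDerivAt X.Z (∫ v, X.g τ v * (X.dU τ v / X.C) ∂(gam M)) τ := by
  exact (hasDerivAt_integral_of_dominated_loc_of_deriv_le (μ := gam M) (x₀ := τ)
    (s := Set.Ioo 0 1) (F := fun τ v => X.g τ v)
    (F' := fun τ v => X.g τ v * (X.dU τ v / X.C))
    (bound := fun v => X.Kg * ((trK X.a X.k / X.m * ((1 + M * N * ∫ p, l1 p.2 ∂X.κ) + M * M * l1 v)) / X.C))
    (isOpen_Ioo.mem_nhds h)
    (Filter.Eventually.of_forall fun t => (X.g_meas t).aestronglyMeasurable)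
    ((integrable_const X.Kg).mono' (X.g_meas _).aestronglyMeasurable
      (Filter.Eventually.of_forall fun p => X.g_abs (Set.Ioo_subset_Icc_self h) _))
    ((X.g_meas τ).mul ((X.dU_meas τ).div_const _)).aestronglyMeasurable
    (Filter.Eventually.of_forall fun v t ht => by
      rw [norm_mul, norm_div]
      refine mul_le_mul (X.g_abs (Set.Ioo_subset_Icc_self ht) v) ?_ (by positivity) X.Kg_pos.le
      rw [Real.norm_eq_abs, Real.norm_eq_abs, abs_of_pos X.hC]
      have := X.hC
      have := X.dU_abs (Set.Ioo_subset_Icc_self ht) v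
      gcongr)
    (((((integrable_const _).add (l1_integrable.const_mul _)).const_mul _).div_const _).const_mul _)
    (Filter.Eventually.of_forall fun v t ht => by
      have := ((X.U_deriv ht v).div_const X.C).exp
      exact this)).2

end Dat
open MeasureTheory Real

/-- bounded real function -/
def Bd {α : Type*} (f : α → ℝ) : Prop := ∃ K, ∀ x, |f x| ≤ K

lemma Bd.mul {α : Type*} {f h : α → ℝ} (hf : Bd f) (hh : Bd h) : Bd fun x => f x * h x := by
  obtain ⟨K, hK⟩ := hf
  obtain ⟨K', hK'⟩ := hh
  refine ⟨K * K', fun x => ?_⟩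
  rw [abs_mul]
  exact mul_le_mul (hK x) (hK' x) (abs_nonneg _) ((abs_nonneg _).trans (hK x))

lemma Bd.add {α : Type*} {f h : α → ℝ} (hf : Bd f) (hh : Bd h) : Bd fun x => f x + h x := by
  obtain ⟨K, hK⟩ := hf
  obtain ⟨K', hK'⟩ := hh
  exact ⟨K + K', fun x => (abs_add_le _ _).trans (add_le_add (hK x) (hK' x))⟩

lemma Bd.sub {α : Type*} {f h : α → ℝ} (hf : Bd f) (hh : Bd h) : Bd fun x => f x - h x := by
  obtain ⟨K, hK⟩ := hf
  obtain ⟨K', hK'⟩ := hh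
  exact ⟨K + K', fun x => (abs_sub _ _).trans (add_le_add (hK x) (hK' x))⟩

lemma Bd.const {α : Type*} (c : ℝ) : Bd fun _ : α => c := ⟨|c|, fun _ => le_rfl⟩

lemma Bd.sum {α β : Type*} {s : Finset β} {f : β → α → ℝ} (h : ∀ i ∈ s, Bd (f i)) :
    Bd fun x => ∑ i ∈ s, f i x := by
  classical
  induction s using Finset.induction_on with
  | empty => simpa using Bd.const 0
  | insert i s hi ih =>
    simp_rw [Finset.sum_insert hi]
    exact (h i (by simp)).add (ih fun j hj => h j (by simp [hj]))

lemma Bd.comp {α β : Type*} {f : α → ℝ} (hf : Bd f) (e : β → α) : Bd fun x => f (e x) := by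
  obtain ⟨K, hK⟩ := hf
  exact ⟨K, fun x => hK _⟩

lemma Bd.integrable {α : Type*} [MeasurableSpace α] {μ : Measure α} [IsFiniteMeasure μ] {f : α → ℝ}
    (hf : Bd f) (hm : Measurable f) : Integrable f μ := by
  obtain ⟨K, hK⟩ := hf
  exact (integrable_const K).mono' hm.aestronglyMeasurable (Filter.Eventually.of_forall hK)

lemma Bd.both {α β : Type*} {f : α → ℝ} {h : β → ℝ} (hf : Bd f) (hh : Bd h) :
    ∃ K, (∀ x, |f x| ≤ K) ∧ ∀ x, |h x| ≤ K := by
  obtain ⟨K, hK⟩ := hf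
  obtain ⟨K', hK'⟩ := hh
  exact ⟨max K K', fun x => (hK x).trans (le_max_left _ _), fun x => (hK' x).trans (le_max_right _ _)⟩

namespace Dat
variable {M N : ℕ} {Ω : Type} [MeasurableSpace Ω] {ι : Type} [Fintype ι] (X : Dat M N Ω ι)

/-- sine over density -/
noncomputable def s (τ : ℝ) (j : ι) (x : Fin M → ℝ) : ℝ := Real.sin (trT X.k X.b τ x j) / X.P τ x

/-- cosine over density -/
noncomputable def co (τ : ℝ) (j : ι) (x : Fin M → ℝ) : ℝ := Real.cos (trT X.k X.b τ x j) / X.P τ x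

lemma s_line {τ : ℝ} (h : τ ∈ Set.Icc (0 : ℝ) 1) (j : ι) (x d : Fin M → ℝ) :
    HasLineDerivAt ℝ (X.s τ j)
      (τ * (X.co τ j x * (X.k j ⬝ᵥ d) + X.s τ j x * (X.Q τ x ⬝ᵥ d))) x d := by
  have hp := (X.P_pos h x).ne'
  have h1 := trP_line X.a X.k X.b τ x d hp
  have h2 := trT_line X.k X.b τ x d j
  unfold HasLineDerivAt at *
  have := h2.sin.div h1 (by simpa using hp)
  convert! this using 1
  simp only [zero_smul, add_zero, s, co]
  field_simp
  ring

lemma s_meas (τ : ℝ) (j : ι) : Measurable (X.s τ j) :=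
  ((trT_cont X.k X.b τ j).measurable.sin).div (trP_cont X.a X.k X.b τ).measurable

lemma co_meas (τ : ℝ) (j : ι) : Measurable (X.co τ j) :=
  ((trT_cont X.k X.b τ j).measurable.cos).div (trP_cont X.a X.k X.b τ).measurable

lemma s_bd {τ : ℝ} (h : τ ∈ Set.Icc (0 : ℝ) 1) (j : ι) : Bd (X.s τ j) := by
  refine ⟨1 / X.m, fun x => ?_⟩
  unfold s
  rw [abs_div, abs_of_pos (X.P_pos h x)]
  exact div_le_div₀ zero_le_one (Real.abs_sin_le_one _) X.hm0 (X.P_lower h x)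

lemma co_bd {τ : ℝ} (h : τ ∈ Set.Icc (0 : ℝ) 1) (j : ι) : Bd (X.co τ j) := by
  refine ⟨1 / X.m, fun x => ?_⟩
  unfold co
  rw [abs_div, abs_of_pos (X.P_pos h x)]
  exact div_le_div₀ zero_le_one (Real.abs_cos_le_one _) X.hm0 (X.P_lower h x)

lemma Q_bd {τ : ℝ} (h : τ ∈ Set.Icc (0 : ℝ) 1) (l : Fin M) : Bd fun x => X.Q τ x l :=
  ⟨X.L, fun x => (coord_le_l1 _ l).trans (X.Q_l1 h x)⟩

lemma R_bd {τ : ℝ} (h : τ ∈ Set.Icc (0 : ℝ) 1) (l : Fin M) : Bd fun x => X.R τ x l :=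
  ⟨X.L, fun x => X.R_abs h x l⟩

lemma g_bd {τ : ℝ} (h : τ ∈ Set.Icc (0 : ℝ) 1) : Bd (X.g τ) := ⟨X.Kg, fun x => X.g_abs h x⟩

lemma B_bd (a b : Fin M) : Bd fun ω => X.B ω a b := ⟨1, fun ω => X.B_abs ω a b⟩
lemma D_bd (a : Fin M) (b : Fin N) : Bd fun ω => X.D ω a b := ⟨1, fun ω => X.D_abs ω a b⟩

/-- direction -/
def dB (j : ι) (ω : Ω) : Fin M → ℝ := fun b => ∑ a, X.B ω a b * X.k j a
/-- direction -/
def dD (j : ι) (ω : Ω) : Fin N → ℝ := fun b => ∑ a, X.D ω a b * X.k j a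

lemma dB_bd (j : ι) (b : Fin M) : Bd fun ω => X.dB j ω b :=
  Bd.sum fun a _ => (X.B_bd a b).mul (Bd.const _)
lemma dD_bd (j : ι) (b : Fin N) : Bd fun ω => X.dD j ω b :=
  Bd.sum fun a _ => (X.D_bd a b).mul (Bd.const _)

lemma dB_meas (j : ι) : Measurable (X.dB j) :=
  measurable_pi_lambda _ fun b => Finset.measurable_sum _ fun a _ => (X.hB a b).mul_const _
lemma dD_meas (j : ι) : Measurable (X.dD j) :=
  measurable_pi_lambda _ fun b => Finset.measurable_sum _ fun a _ => (X.hD a b).mul_const _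

lemma l1_bd {α : Type*} {n : ℕ} {d : α → Fin n → ℝ} (h : ∀ b, Bd fun x => d x b) :
    ∃ K, ∀ x, l1 (d x) ≤ K := by
  choose K hK using h
  exact ⟨∑ b, K b, fun x => Finset.sum_le_sum fun b _ => hK b x⟩

lemma dot_bd {α : Type*} {n : ℕ} {d e : α → Fin n → ℝ} (h : ∀ b, Bd fun x => d x b)
    (h' : ∀ b, Bd fun x => e x b) : Bd fun x => d x ⬝ᵥ e x :=
  Bd.sum fun b _ => (h b).mul (h' b)

lemma dot_meas {α : Type*} [MeasurableSpace α] {n : ℕ} {d e : α → Fin n → ℝ} (h : Measurable d)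
    (h' : Measurable e) : Measurable fun x => d x ⬝ᵥ e x := by
  unfold dotProduct
  fun_prop

lemma k_yy (j : ι) (p : Ω × (Fin N → ℝ)) (v : Fin M → ℝ) :
    X.k j ⬝ᵥ X.yy p v = X.dB j p.1 ⬝ᵥ v + X.dD j p.1 ⬝ᵥ p.2 := by
  simp only [yy, dB, dD, dotProduct, mul_add, Finset.sum_add_distrib, Finset.mul_sum, Finset.sum_mul]
  congr 1
  · rw [Finset.sum_comm]
    exact Finset.sum_congr rfl fun _ _ => Finset.sum_congr rfl fun _ _ => by ring
  · rw [Finset.sum_comm]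
    exact Finset.sum_congr rfl fun _ _ => Finset.sum_congr rfl fun _ _ => by ring

lemma dir_sum (j : ι) (ω : Ω) :
    (fun a => X.B ω a ⬝ᵥ X.dB j ω) + (fun a => X.D ω a ⬝ᵥ X.dD j ω) = X.k j := by
  ext a
  have : X.k j a = ∑ a', (if a = a' then 1 else 0) * X.k j a' := by simp
  rw [this]
  simp_rw [← X.orth ω a]
  simp only [Pi.add_apply, dB, dD, dotProduct, Finset.mul_sum, add_mul, Finset.sum_mul,
    Finset.sum_add_distrib]
  congr 1
  · rw [Finset.sum_comm]
    exact Finset.sum_congr rfl fun _ _ => Finset.sum_congr rfl fun _ _ => by ring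
  · rw [Finset.sum_comm]
    exact Finset.sum_congr rfl fun _ _ => Finset.sum_congr rfl fun _ _ => by ring

lemma row_meas (a : Fin M) : Measurable fun ω => X.B ω a := measurable_pi_lambda _ fun b => X.hB a b
lemma rowD_meas (a : Fin M) : Measurable fun ω => X.D ω a := measurable_pi_lambda _ fun b => X.hD a b

lemma BdB_meas (j : ι) : Measurable fun ω => (fun a => X.B ω a ⬝ᵥ X.dB j ω) :=
  measurable_pi_lambda _ fun a => dot_meas (X.row_meas a) (X.dB_meas j)
lemma DdD_meas (j : ι) : Measurable fun ω => (fun a => X.D ω a ⬝ᵥ X.dD j ω) :=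
  measurable_pi_lambda _ fun a => dot_meas (X.rowD_meas a) (X.dD_meas j)
lemma BdB_bd (j : ι) (a : Fin M) : Bd fun ω => X.B ω a ⬝ᵥ X.dB j ω :=
  dot_bd (fun b => X.B_bd a b) (fun b => X.dB_bd j b)
lemma DdD_bd (j : ι) (a : Fin M) : Bd fun ω => X.D ω a ⬝ᵥ X.dD j ω :=
  dot_bd (fun b => X.D_bd a b) (fun b => X.dD_bd j b)

lemma g_line {τ : ℝ} (h : τ ∈ Set.Icc (0 : ℝ) 1) (v d : Fin M → ℝ) :
    HasLineDerivAt ℝ (X.g τ) (X.g τ v * (-τ * (X.R τ v ⬝ᵥ d) / X.C)) v d := by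
  have h1 := X.U_line h v d
  unfold HasLineDerivAt g at *
  have := (h1.div_const X.C).exp
  simpa using this

/-- derivative of `s` in direction `d` -/
noncomputable def ds (τ : ℝ) (j : ι) (x d : Fin M → ℝ) : ℝ :=
  τ * (X.co τ j x * (X.k j ⬝ᵥ d) + X.s τ j x * (X.Q τ x ⬝ᵥ d))

lemma ds_add (τ : ℝ) (j : ι) (x d d' : Fin M → ℝ) :
    X.ds τ j x d + X.ds τ j x d' = X.ds τ j x (d + d') := by
  unfold ds; rw [dotProduct_add, dotProduct_add]; ring

lemma ds_bd {τ : ℝ} (h : τ ∈ Set.Icc (0 : ℝ) 1) (j : ι) {α : Type*} (y d : α → Fin M → ℝ)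
    (hd : ∀ b, Bd fun x => d x b) : Bd fun x => X.ds τ j (y x) (d x) := by
  unfold ds
  exact (Bd.const _).mul ((((X.co_bd h j).comp y).mul (dot_bd (d := fun _ => X.k j) (fun b => Bd.const _) hd)).add
    (((X.s_bd h j).comp y).mul (dot_bd (fun b => (X.Q_bd h b).comp y) hd)))

lemma ds_meas {τ : ℝ} (j : ι) {α : Type*} [MeasurableSpace α] (y d : α → Fin M → ℝ)
    (hy : Measurable y) (hd : Measurable d) : Measurable fun x => X.ds τ j (y x) (d x) := by
  unfold ds
  exact Measurable.const_mul ((((X.co_meas τ j).comp hy).mul (dot_meas measurable_const hd)).add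
    (((X.s_meas τ j).comp hy).mul (dot_meas ((trQ_meas X.a X.k X.b τ).comp hy) hd))) _

/-- joint measure -/
noncomputable def J : Measure ((Fin M → ℝ) × (Ω × (Fin N → ℝ))) := (gam M).prod X.κ

instance : IsProbabilityMeasure X.J := by unfold J; infer_instance

lemma gs_meas (τ : ℝ) (j : ι) : Measurable fun q : (Fin M → ℝ) × (Ω × (Fin N → ℝ)) =>
    X.g τ q.1 * X.s τ j (X.yy q.2 q.1) :=
  ((X.g_meas τ).comp measurable_fst).mul ((X.s_meas τ j).comp X.yy_meas)

lemma gs_bd {τ : ℝ} (h : τ ∈ Set.Icc (0 : ℝ) 1) (j : ι) :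
    Bd fun q : (Fin M → ℝ) × (Ω × (Fin N → ℝ)) => X.g τ q.1 * X.s τ j (X.yy q.2 q.1) :=
  ((X.g_bd h).comp _).mul ((X.s_bd h j).comp fun q : (Fin M → ℝ) × (Ω × (Fin N → ℝ)) => X.yy q.2 q.1)

/-- v-part derivative -/
noncomputable def HV (τ : ℝ) (j : ι) (q : (Fin M → ℝ) × (Ω × (Fin N → ℝ))) : ℝ :=
  X.g τ q.1 * (-τ / X.C * (X.R τ q.1 ⬝ᵥ X.dB j q.2.1)) * X.s τ j (X.yy q.2 q.1) +
    X.g τ q.1 * X.ds τ j (X.yy q.2 q.1) (fun a => X.B q.2.1 a ⬝ᵥ X.dB j q.2.1)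

/-- w-part derivative -/
noncomputable def HW (τ : ℝ) (j : ι) (q : (Fin M → ℝ) × (Ω × (Fin N → ℝ))) : ℝ :=
    X.g τ q.1 * X.ds τ j (X.yy q.2 q.1) (fun a => X.D q.2.1 a ⬝ᵥ X.dD j q.2.1)

lemma HV_meas (τ : ℝ) (j : ι) : Measurable (X.HV τ j) := by
  unfold HV
  have hg : Measurable fun q : (Fin M → ℝ) × (Ω × (Fin N → ℝ)) => X.g τ q.1 :=
    (X.g_meas τ).comp measurable_fst
  have hs : Measurable fun q : (Fin M → ℝ) × (Ω × (Fin N → ℝ)) => X.s τ j (X.yy q.2 q.1) :=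
    (X.s_meas τ j).comp X.yy_meas
  have hR : Measurable fun q : (Fin M → ℝ) × (Ω × (Fin N → ℝ)) => X.R τ q.1 ⬝ᵥ X.dB j q.2.1 :=
    dot_meas ((X.R_meas τ).comp measurable_fst) ((X.dB_meas j).comp (measurable_fst.comp measurable_snd))
  exact ((hg.mul (hR.const_mul _)).mul hs).add (hg.mul (X.ds_meas j _ _ X.yy_meas
    ((X.BdB_meas j).comp (measurable_fst.comp measurable_snd))))

lemma HV_bd {τ : ℝ} (h : τ ∈ Set.Icc (0 : ℝ) 1) (j : ι) : Bd (X.HV τ j) := by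
  unfold HV
  have hg : Bd fun q : (Fin M → ℝ) × (Ω × (Fin N → ℝ)) => X.g τ q.1 := (X.g_bd h).comp _
  have hs : Bd fun q : (Fin M → ℝ) × (Ω × (Fin N → ℝ)) => X.s τ j (X.yy q.2 q.1) :=
    (X.s_bd h j).comp fun q : (Fin M → ℝ) × (Ω × (Fin N → ℝ)) => X.yy q.2 q.1
  have hR : Bd fun q : (Fin M → ℝ) × (Ω × (Fin N → ℝ)) => X.R τ q.1 ⬝ᵥ X.dB j q.2.1 :=
    dot_bd (fun b => (X.R_bd h b).comp _)
      (fun b => (X.dB_bd j b).comp fun q : (Fin M → ℝ) × (Ω × (Fin N → ℝ)) => q.2.1)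
  exact ((hg.mul ((Bd.const _).mul hR)).mul hs).add (hg.mul (X.ds_bd h j _ _
    (fun b => (X.BdB_bd j b).comp fun q : (Fin M → ℝ) × (Ω × (Fin N → ℝ)) => q.2.1)))

lemma HW_meas (τ : ℝ) (j : ι) : Measurable (X.HW τ j) := by
  unfold HW
  have hg : Measurable fun q : (Fin M → ℝ) × (Ω × (Fin N → ℝ)) => X.g τ q.1 :=
    (X.g_meas τ).comp measurable_fst
  exact (hg.mul (X.ds_meas j _ _ X.yy_meas
    ((X.DdD_meas j).comp (measurable_fst.comp measurable_snd))))

lemma HW_bd {τ : ℝ} (h : τ ∈ Set.Icc (0 : ℝ) 1) (j : ι) : Bd (X.HW τ j) := by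
  unfold HW
  have hg : Bd fun q : (Fin M → ℝ) × (Ω × (Fin N → ℝ)) => X.g τ q.1 := (X.g_bd h).comp _
  exact (hg.mul (X.ds_bd h j _ _
    (fun b => (X.DdD_bd j b).comp fun q : (Fin M → ℝ) × (Ω × (Fin N → ℝ)) => q.2.1)))

lemma vpart {τ : ℝ} (h : τ ∈ Set.Icc (0 : ℝ) 1) (j : ι) :
    Integrable (fun q => (X.dB j q.2.1 ⬝ᵥ q.1) * (X.g τ q.1 * X.s τ j (X.yy q.2 q.1))) X.J ∧
    ∫ q, (X.dB j q.2.1 ⬝ᵥ q.1) * (X.g τ q.1 * X.s τ j (X.yy q.2 q.1)) ∂X.J =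
      1 / (2 * π) * ∫ q, X.HV τ j q ∂X.J := by
  obtain ⟨Kd, hKd⟩ := l1_bd fun b => (X.dB_bd j b).comp fun p : Ω × (Fin N → ℝ) => p.1
  obtain ⟨K, hK, hK'⟩ := (X.gs_bd h j).both (X.HV_bd h j)
  refine stein_prod X.κ (fun p => X.dB j p.1) ((X.dB_meas j).comp measurable_fst) Kd hKd
    (fun q => X.g τ q.1 * X.s τ j (X.yy q.2 q.1)) (X.HV τ j) K (X.gs_meas τ j) (X.HV_meas τ j) hK hK' ?_
  intro p v
  have h1 := X.g_line h v (X.dB j p.1)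
  have h2 := X.s_line h j (X.yy p v) (fun a => X.B p.1 a ⬝ᵥ X.dB j p.1)
  unfold HasLineDerivAt at *
  simp_rw [← yy_line] at h2
  have := h1.mul h2
  convert! this using 1
  simp only [HV, ds, zero_smul, add_zero]
  ring

lemma wpart0 {τ : ℝ} (h : τ ∈ Set.Icc (0 : ℝ) 1) (j : ι) (v : Fin M → ℝ) :
    ∫ p, (X.dD j p.1 ⬝ᵥ p.2) * X.s τ j (X.yy p v) ∂X.κ =
      1 / (2 * π) * ∫ p, X.ds τ j (X.yy p v) (fun a => X.D p.1 a ⬝ᵥ X.dD j p.1) ∂X.κ := by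
  obtain ⟨Kd, hKd⟩ := l1_bd fun b => (X.dD_bd j b)
  have hb := (X.s_bd h j).comp fun p : (Fin N → ℝ) × Ω => X.yy p.swap v
  have hb' := X.ds_bd h j (fun p : (Fin N → ℝ) × Ω => X.yy p.swap v)
    (fun p => fun a => X.D p.2 a ⬝ᵥ X.dD j p.2) (fun b => (X.DdD_bd j b).comp _)
  have hym : Measurable fun p : (Fin N → ℝ) × Ω => X.yy p.swap v :=
    (X.yy_meas1 v).comp measurable_swap
  have hm := (X.s_meas τ j).comp hym
  have hm' := X.ds_meas (τ := τ) j (fun p : (Fin N → ℝ) × Ω => X.yy p.swap v)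
    (fun p => fun a => X.D p.2 a ⬝ᵥ X.dD j p.2) hym ((X.DdD_meas j).comp measurable_snd)
  obtain ⟨K, hK, hK'⟩ := hb.both hb'
  have := (stein_prod X.ν (X.dD j) (X.dD_meas j) Kd hKd
    (fun p : (Fin N → ℝ) × Ω => X.s τ j (X.yy p.swap v))
    (fun p => X.ds τ j (X.yy p.swap v) (fun a => X.D p.2 a ⬝ᵥ X.dD j p.2)) K hm hm' hK hK' ?_).2
  · unfold κ
    rw [← integral_prod_swap, ← integral_prod_swap (f := fun p => X.ds τ j (X.yy p v) _)]
    exact this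
  · intro ω w
    have h2 := X.s_line h j (X.yy (ω, w) v) (fun a => X.D ω a ⬝ᵥ X.dD j ω)
    unfold HasLineDerivAt at *
    simp_rw [← yy_line2] at h2
    exact h2

lemma wpart {τ : ℝ} (h : τ ∈ Set.Icc (0 : ℝ) 1) (j : ι) :
    Integrable (fun q => (X.dD j q.2.1 ⬝ᵥ q.2.2) * (X.g τ q.1 * X.s τ j (X.yy q.2 q.1))) X.J ∧
    ∫ q, (X.dD j q.2.1 ⬝ᵥ q.2.2) * (X.g τ q.1 * X.s τ j (X.yy q.2 q.1)) ∂X.J =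
      1 / (2 * π) * ∫ q, X.HW τ j q ∂X.J := by
  have i1 : Integrable (fun q => (X.dD j q.2.1 ⬝ᵥ q.2.2) * (X.g τ q.1 * X.s τ j (X.yy q.2 q.1))) X.J := by
    obtain ⟨Kd, hKd⟩ := l1_bd fun b => (X.dD_bd j b)
    obtain ⟨K, hK⟩ := X.gs_bd h j
    have hl : Integrable (fun q : (Fin M → ℝ) × (Ω × (Fin N → ℝ)) => l1 q.2.2) X.J :=
      X.l1_κ.comp_snd (gam M)
    have hdm : Measurable fun q : (Fin M → ℝ) × (Ω × (Fin N → ℝ)) => X.dD j q.2.1 ⬝ᵥ q.2.2 :=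
      dot_meas ((X.dD_meas j).comp (measurable_fst.comp measurable_snd))
        (measurable_snd.comp measurable_snd)
    refine (hl.const_mul (Kd * K)).mono' (hdm.mul (X.gs_meas τ j)).aestronglyMeasurable
      (Filter.Eventually.of_forall fun q => ?_)
    rw [norm_mul]
    calc _ ≤ (Kd * l1 q.2.2) * K := by
          refine mul_le_mul ((dot_le_l1 _ _).trans ?_) (hK q) (norm_nonneg _) ?_
          · exact mul_le_mul_of_nonneg_right (hKd _) (l1_nonneg _)
          · exact mul_nonneg ((l1_nonneg _).trans (hKd q.2.1)) (l1_nonneg _)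
      _ = _ := by ring
  refine ⟨i1, ?_⟩
  have i2 := (X.HW_bd h j).integrable (μ := X.J) (X.HW_meas τ j)
  unfold J at i1 i2 ⊢
  rw [integral_prod _ i1, integral_prod _ i2, ← integral_const_mul]
  refine integral_congr_ae (Filter.Eventually.of_forall fun v => ?_)
  simp only [HW]
  rw [integral_const_mul, mul_left_comm, ← X.wpart0 h j v, ← integral_const_mul]
  refine integral_congr_ae (Filter.Eventually.of_forall fun p => ?_)
  simp only []
  ring

lemma key_j {τ : ℝ} (h : τ ∈ Set.Icc (0 : ℝ) 1) (j : ι) :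
    Integrable (fun q => (X.k j ⬝ᵥ X.yy q.2 q.1) * (X.g τ q.1 * X.s τ j (X.yy q.2 q.1))) X.J ∧
    ∫ q, (X.k j ⬝ᵥ X.yy q.2 q.1) * (X.g τ q.1 * X.s τ j (X.yy q.2 q.1)) ∂X.J =
      1 / (2 * π) * ∫ q, (X.HV τ j q + X.HW τ j q) ∂X.J := by
  have i2 := (X.HW_bd h j).integrable (μ := X.J) (X.HW_meas τ j)
  have i3 := (X.HV_bd h j).integrable (μ := X.J) (X.HV_meas τ j)
  simp_rw [k_yy, add_mul]
  refine ⟨(X.vpart h j).1.add (X.wpart h j).1, ?_⟩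
  rw [integral_add (X.vpart h j).1 (X.wpart h j).1, (X.vpart h j).2, (X.wpart h j).2,
    integral_add i3 i2, mul_add]

lemma HVW (τ : ℝ) (j : ι) (q : (Fin M → ℝ) × (Ω × (Fin N → ℝ))) :
    X.HV τ j q + X.HW τ j q =
    X.g τ q.1 * (-τ / X.C * (X.R τ q.1 ⬝ᵥ X.dB j q.2.1)) * X.s τ j (X.yy q.2 q.1) +
      X.g τ q.1 * X.ds τ j (X.yy q.2 q.1) (X.k j) := by
  unfold HV HW
  rw [add_assoc, ← mul_add, ds_add, dir_sum]

end Dat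
open MeasureTheory Real

namespace Dat
variable {M N : ℕ} {Ω : Type} [MeasurableSpace Ω] {ι : Type} [Fintype ι] (X : Dat M N Ω ι)

/-- final integrand -/
noncomputable def W (τ : ℝ) (v : Fin M → ℝ) (p : Ω × (Fin N → ℝ)) : ℝ :=
  (1 / X.C) * (X.Q τ (X.yy p v) ⬝ᵥ fun a => X.B p.1 a ⬝ᵥ X.R τ v)
    - X.Q τ (X.yy p v) ⬝ᵥ X.Q τ (X.yy p v)

lemma Q_sum (τ : ℝ) (x d : Fin M → ℝ) :
    X.Q τ x ⬝ᵥ d = ∑ j, trA X.a X.k τ j * X.s τ j x * (X.k j ⬝ᵥ d) := by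
  simp only [Q, trQ, s, dotProduct, Finset.sum_mul, Finset.mul_sum]
  rw [Finset.sum_comm]
  exact Finset.sum_congr rfl fun _ _ => Finset.sum_congr rfl fun _ _ => by ring

lemma k_BR (j : ι) (ω : Ω) (r : Fin M → ℝ) :
    X.k j ⬝ᵥ (fun a => X.B ω a ⬝ᵥ r) = r ⬝ᵥ X.dB j ω := by
  rw [dot_BQ]; rfl

lemma P'_sum (τ : ℝ) (x : Fin M → ℝ) :
    X.P' τ x / X.P τ x = ∑ j, trA X.a X.k τ j * ((X.k j ⬝ᵥ X.k j) * τ / (2 * π) * X.co τ j x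
      - (X.k j ⬝ᵥ x) * X.s τ j x) := by
  simp only [P', trP', s, co, Finset.sum_div]
  exact Finset.sum_congr rfl fun _ _ => by ring

lemma W_sum (τ : ℝ) (q : (Fin M → ℝ) × (Ω × (Fin N → ℝ))) :
    ∑ j, trA X.a X.k τ j * ((X.k j ⬝ᵥ X.k j) * τ / (2 * π) * (X.g τ q.1 * X.co τ j (X.yy q.2 q.1))
      - 1 / (2 * π) * (X.HV τ j q + X.HW τ j q)) = τ / (2 * π) * (X.g τ q.1 * X.W τ q.1 q.2) := by
  unfold W
  rw [Q_sum, Q_sum]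
  simp_rw [k_BR]
  rw [Finset.mul_sum, ← Finset.sum_sub_distrib, Finset.mul_sum, Finset.mul_sum]
  refine Finset.sum_congr rfl fun j _ => ?_
  rw [HVW, ds, dotProduct_comm (X.k j) (X.Q τ _)]
  ring

lemma W_meas (τ : ℝ) : Measurable fun q : (Fin M → ℝ) × (Ω × (Fin N → ℝ)) => X.W τ q.1 q.2 := by
  unfold W
  have h1 := (X.Q_meas τ)
  have h2 : Measurable fun q : (Fin M → ℝ) × (Ω × (Fin N → ℝ)) =>
      (fun a => X.B q.2.1 a ⬝ᵥ X.R τ q.1) :=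
    measurable_pi_lambda _ fun a => dot_meas ((X.row_meas a).comp (measurable_fst.comp measurable_snd))
      ((X.R_meas τ).comp measurable_fst)
  exact ((dot_meas h1 h2).const_mul _).sub (dot_meas h1 h1)

lemma W_bd {τ : ℝ} (h : τ ∈ Set.Icc (0 : ℝ) 1) :
    Bd fun q : (Fin M → ℝ) × (Ω × (Fin N → ℝ)) => X.W τ q.1 q.2 := by
  unfold W
  have h1 : ∀ b, Bd fun q : (Fin M → ℝ) × (Ω × (Fin N → ℝ)) => X.Q τ (X.yy q.2 q.1) b :=
    fun b => (X.Q_bd h b).comp fun q : (Fin M → ℝ) × (Ω × (Fin N → ℝ)) => X.yy q.2 q.1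
  have h2 : ∀ a, Bd fun q : (Fin M → ℝ) × (Ω × (Fin N → ℝ)) => X.B q.2.1 a ⬝ᵥ X.R τ q.1 :=
    fun a => dot_bd (fun b => (X.B_bd a b).comp fun q : (Fin M → ℝ) × (Ω × (Fin N → ℝ)) => q.2.1)
      (fun b => (X.R_bd h b).comp Prod.fst)
  exact ((Bd.const _).mul (dot_bd h1 h2)).sub (dot_bd h1 h1)

lemma RR_le {τ : ℝ} (h : τ ∈ Set.Icc (0 : ℝ) 1) (v : Fin M → ℝ) :
    ∫ p, X.W τ v p ∂X.κ ≤ 0 := by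
  set r := X.R τ v with hr
  have hC := X.hC
  have hQm : Measurable fun p : Ω × (Fin N → ℝ) => X.Q τ (X.yy p v) := X.Q_meas1 τ v
  have hQb : ∀ b, Bd fun p : Ω × (Fin N → ℝ) => X.Q τ (X.yy p v) b :=
    fun b => (X.Q_bd h b).comp fun p : (Ω × (Fin N → ℝ)) => X.yy p v
  have hBm : ∀ a, Measurable fun ω : Ω => X.B ω a ⬝ᵥ r := fun a =>
    dot_meas (X.row_meas a) measurable_const
  have hBb : ∀ a, Bd fun ω : Ω => X.B ω a ⬝ᵥ r := fun a =>
    dot_bd (fun b => X.B_bd a b) (e := fun _ => r) (fun b => Bd.const _)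
  have hBm' : Measurable fun p : Ω × (Fin N → ℝ) => fun a => X.B p.1 a ⬝ᵥ r :=
    measurable_pi_lambda _ fun a => (hBm a).comp measurable_fst
  have hBb' : ∀ a, Bd fun p : Ω × (Fin N → ℝ) => X.B p.1 a ⬝ᵥ r := fun a => (hBb a).comp Prod.fst
  have i1 : Integrable (fun p => X.Q τ (X.yy p v) ⬝ᵥ fun a => X.B p.1 a ⬝ᵥ r) X.κ :=
    (dot_bd hQb hBb').integrable (dot_meas hQm hBm')
  have i2 : Integrable (fun p => X.Q τ (X.yy p v) ⬝ᵥ X.Q τ (X.yy p v)) X.κ :=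
    (dot_bd hQb hQb).integrable (dot_meas hQm hQm)
  have i3 : Integrable (fun ω => ∑ a, (X.B ω a ⬝ᵥ r) ^ 2) X.ν := by
    simp_rw [pow_two]
    exact (Bd.sum fun a _ => (hBb a).mul (hBb a)).integrable
      (Finset.measurable_sum _ fun a _ => (hBm a).mul (hBm a))
  have i3' : Integrable (fun p : Ω × (Fin N → ℝ) => ∑ a, (X.B p.1 a ⬝ᵥ r) ^ 2) X.κ := by
    unfold κ; exact i3.comp_fst _
  have e3 : ∫ p, ∑ a, (X.B p.1 a ⬝ᵥ r) ^ 2 ∂X.κ = ∫ ω, ∑ a, (X.B ω a ⬝ᵥ r) ^ 2 ∂X.ν := by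
    unfold κ
    rw [integral_fun_fst (fun ω => ∑ a, (X.B ω a ⬝ᵥ r) ^ 2)]
    simp
  have e1 := X.R_dot h v r
  have key : ∫ p, 2 * (X.Q τ (X.yy p v) ⬝ᵥ fun a => X.B p.1 a ⬝ᵥ r) ∂X.κ ≤
      ∫ p, ((1 / X.C) * ∑ a, (X.B p.1 a ⬝ᵥ r) ^ 2 + X.C * (X.Q τ (X.yy p v) ⬝ᵥ X.Q τ (X.yy p v))) ∂X.κ := by
    refine integral_mono (i1.const_mul _) ((i3'.const_mul _).add (i2.const_mul _)) fun p => ?_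
    have e : ∀ x y : Fin M → ℝ, x ⬝ᵥ y = ∑ a, x a * y a := fun _ _ => rfl
    rw [e (X.Q τ (X.yy p v)) (fun a => X.B p.1 a ⬝ᵥ r), e (X.Q τ (X.yy p v)) (X.Q τ (X.yy p v)),
      Finset.mul_sum, Finset.mul_sum, Finset.mul_sum, ← Finset.sum_add_distrib]
    refine Finset.sum_le_sum fun a _ => ?_
    set x := X.Q τ (X.yy p v) a
    set y := X.B p.1 a ⬝ᵥ r with hy
    change 2 * (x * y) ≤ 1 / X.C * y ^ 2 + X.C * (x * x)
    have : 1 / X.C * y ^ 2 + X.C * (x * x) - 2 * (x * y) = 1 / X.C * (y - X.C * x) ^ 2 := by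
      field_simp; ring
    have h2 : 0 ≤ 1 / X.C * (y - X.C * x) ^ 2 := by positivity
    linarith
  rw [integral_add (i3'.const_mul _) (i2.const_mul _), integral_const_mul, integral_const_mul,
    integral_const_mul, e3, ← e1] at key
  have h3 := X.hBC r
  unfold W
  rw [integral_sub (i1.const_mul _) i2, integral_const_mul, ← e1]
  have h4 : 1 / X.C * ∫ ω, ∑ a, (X.B ω a ⬝ᵥ r) ^ 2 ∂X.ν ≤ r ⬝ᵥ r := by
    rw [div_mul_eq_mul_div, one_mul, div_le_iff₀ hC]; linarith
  rw [← hr] at key ⊢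
  have : r ⬝ᵥ r ≤ X.C * ∫ p, X.Q τ (X.yy p v) ⬝ᵥ X.Q τ (X.yy p v) ∂X.κ := by linarith
  rw [sub_nonpos, div_mul_eq_mul_div, one_mul, div_le_iff₀ hC]; linarith

lemma gdU {τ : ℝ} (h : τ ∈ Set.Icc (0 : ℝ) 1) :
    ∫ v, X.g τ v * X.dU τ v ∂gam M = τ / (2 * π) * ∫ v, X.g τ v * ∫ p, X.W τ v p ∂X.κ ∂gam M := by
  have hgc : ∀ j, Integrable (fun q : (Fin M → ℝ) × (Ω × (Fin N → ℝ)) =>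
      (X.k j ⬝ᵥ X.k j) * τ / (2 * π) * (X.g τ q.1 * X.co τ j (X.yy q.2 q.1))) X.J := fun j =>
    Integrable.const_mul ((((X.g_bd h).comp Prod.fst).mul
      ((X.co_bd h j).comp fun q : (Fin M → ℝ) × (Ω × (Fin N → ℝ)) => X.yy q.2 q.1)).integrable
      (((X.g_meas τ).comp measurable_fst).mul ((X.co_meas τ j).comp X.yy_meas))) _
  have hH : ∀ j, Integrable (fun q => X.HV τ j q + X.HW τ j q) X.J := fun j =>
    ((X.HV_bd h j).integrable (X.HV_meas τ j)).add ((X.HW_bd h j).integrable (X.HW_meas τ j))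
  have hk := fun j => (X.key_j h j).1
  have e0 : ∀ q : (Fin M → ℝ) × (Ω × (Fin N → ℝ)),
      X.g τ q.1 * (X.P' τ (X.yy q.2 q.1) / X.P τ (X.yy q.2 q.1)) =
      ∑ j, trA X.a X.k τ j * ((X.k j ⬝ᵥ X.k j) * τ / (2 * π) * (X.g τ q.1 * X.co τ j (X.yy q.2 q.1))
        - (X.k j ⬝ᵥ X.yy q.2 q.1) * (X.g τ q.1 * X.s τ j (X.yy q.2 q.1))) := by
    intro q
    rw [P'_sum, Finset.mul_sum]
    exact Finset.sum_congr rfl fun _ _ => by ring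
  have i0 : Integrable (fun q : (Fin M → ℝ) × (Ω × (Fin N → ℝ)) =>
      X.g τ q.1 * (X.P' τ (X.yy q.2 q.1) / X.P τ (X.yy q.2 q.1))) X.J := by
    simp_rw [e0]
    exact integrable_finsetSum _ fun j _ => ((hgc j).sub (hk j)).const_mul _
  have i1 : Integrable (fun q : (Fin M → ℝ) × (Ω × (Fin N → ℝ)) => X.g τ q.1 * X.W τ q.1 q.2) X.J :=
    (((X.g_bd h).comp Prod.fst).mul (X.W_bd h)).integrable
      (((X.g_meas τ).comp measurable_fst).mul (X.W_meas τ))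
  have e1 : ∫ q, X.g τ q.1 * (X.P' τ (X.yy q.2 q.1) / X.P τ (X.yy q.2 q.1)) ∂X.J =
      τ / (2 * π) * ∫ q, X.g τ q.1 * X.W τ q.1 q.2 ∂X.J := by
    rw [← integral_const_mul]
    simp_rw [e0, ← W_sum]
    rw [integral_finsetSum, integral_finsetSum]
    rotate_left
    · exact fun j _ => ((hgc j).sub ((hH j).const_mul _)).const_mul _
    · exact fun j _ => ((hgc j).sub (hk j)).const_mul _
    refine Finset.sum_congr rfl fun j _ => ?_
    rw [integral_const_mul, integral_const_mul, integral_sub (hgc j) (hk j),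
      integral_sub (hgc j) ((hH j).const_mul _), (X.key_j h j).2, integral_const_mul, integral_const_mul]
  unfold J at i0 i1 e1
  rw [integral_prod _ i0, integral_prod _ i1] at e1
  simp_rw [integral_const_mul] at e1
  exact e1

lemma Z_le : X.Z 1 ≤ X.Z 0 := by
  have : AntitoneOn X.Z (Set.Icc 0 1) := by
    refine antitoneOn_of_deriv_nonpos (convex_Icc 0 1) X.Z_contOn ?_ ?_
    · rw [interior_Icc]
      exact fun τ h => (X.Z_deriv h).differentiableAt.differentiableWithinAt
    · rw [interior_Icc]
      intro τ h
      rw [(X.Z_deriv h).deriv]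
      have h' := Set.Ioo_subset_Icc_self h
      have e : ∫ v, X.g τ v * (X.dU τ v / X.C) ∂gam M = (∫ v, X.g τ v * X.dU τ v ∂gam M) / X.C := by
        rw [← integral_div]; congr 1; ext v; ring
      rw [e, X.gdU h']
      refine div_nonpos_of_nonpos_of_nonneg (mul_nonpos_of_nonneg_of_nonpos ?_ ?_) X.hC.le
      · have := h.1
        positivity
      · exact integral_nonpos fun v =>
          mul_nonpos_of_nonneg_of_nonpos (X.g_pos _ _).le (X.RR_le h' v)
  exact this (by simp) (by simp) zero_le_one

lemma Z_zero : X.Z 0 = Real.exp (Real.log (∫ z, trP X.a X.k X.b 1 z ∂(gam M)) / X.C) := by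
  unfold Z g U P
  simp_rw [trP_zero]
  simp

/-- the functional inequality -/
lemma main : ∫ v, Real.exp (X.U 1 v / X.C) ∂gam M ≤
    Real.exp (Real.log (∫ z, trP X.a X.k X.b 1 z ∂(gam M)) / X.C) := by
  rw [← Z_zero]; exact X.Z_le

end Dat
open MeasureTheory Real

lemma fourier_vanish {M : ℕ} (μ : Measure (Fin M → ℝ)) [IsFiniteMeasure μ] (h : (Fin M → ℝ) → ℝ)
    (hi : Integrable h μ)
    (h0 : ∀ (k : Fin M → ℝ) (b : ℝ), ∫ x, h x * Real.cos (k ⬝ᵥ x + b) ∂μ = 0) : h =ᵐ[μ] 0 := by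
  have hm := hi.aestronglyMeasurable.aemeasurable
  have hi' : Integrable (fun x => -h x) μ := hi.neg
  have hm' : AEMeasurable (fun x => -h x) μ := hi'.aestronglyMeasurable.aemeasurable
  have f1 : ∫⁻ x, ENNReal.ofReal (h x) ∂μ ≠ ⊤ := hi.lintegral_lt_top.ne
  have f2 : ∫⁻ x, ENNReal.ofReal (-h x) ∂μ ≠ ⊤ := hi'.lintegral_lt_top.ne
  have : IsFiniteMeasure (μ.withDensity fun x => ENNReal.ofReal (h x)) := isFiniteMeasure_withDensity f1
  have : IsFiniteMeasure (μ.withDensity fun x => ENNReal.ofReal (-h x)) := isFiniteMeasure_withDensity f2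
  have key : (μ.withDensity fun x => ENNReal.ofReal (h x)) = μ.withDensity fun x => ENNReal.ofReal (-h x) := by
    apply Measure.ext_of_charFunDual
    ext L
    rw [charFunDual_apply, charFunDual_apply,
      integral_withDensity_eq_integral_toReal_smul₀ hm.ennreal_ofReal (by simp),
      integral_withDensity_eq_integral_toReal_smul₀ hm'.ennreal_ofReal (by simp)]
    have hLm : Continuous fun x : Fin M → ℝ => Complex.exp (L x * Complex.I) := by fun_prop
    have ib : ∀ {u : (Fin M → ℝ) → ℝ}, Integrable u μ →
        Integrable (fun x => (ENNReal.ofReal (u x)).toReal • Complex.exp (L x * Complex.I)) μ := by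
      intro u hu
      refine hu.norm.mono' ((hu.aestronglyMeasurable.aemeasurable.ennreal_ofReal.ennreal_toReal.aestronglyMeasurable).smul
        hLm.aestronglyMeasurable) (Filter.Eventually.of_forall fun x => ?_)
      rw [norm_smul, Complex.norm_exp_ofReal_mul_I, mul_one, Real.norm_eq_abs, abs_of_nonneg ENNReal.toReal_nonneg,
        ENNReal.toReal_ofReal', Real.norm_eq_abs]
      exact max_le (le_abs_self _) (abs_nonneg _)
    rw [← sub_eq_zero, ← integral_sub (ib hi) (ib hi')]
    have e : ∀ x, (ENNReal.ofReal (h x)).toReal • Complex.exp (L x * Complex.I) -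
        (ENNReal.ofReal (-h x)).toReal • Complex.exp (L x * Complex.I) =
        ((h x * Real.cos (L x) : ℝ) : ℂ) + ((h x * Real.sin (L x) : ℝ) : ℂ) * Complex.I := by
      intro x
      rw [← sub_smul, Complex.exp_mul_I, ENNReal.toReal_ofReal', ENNReal.toReal_ofReal']
      have : max (h x) 0 - max (-h x) 0 = h x := by
        rcases le_total 0 (h x) with h' | h' <;> simp [h']
      rw [this, Complex.real_smul]
      push_cast
      ring
    simp_rw [e]
    obtain ⟨k, hk⟩ : ∃ k : Fin M → ℝ, ∀ x, L x = k ⬝ᵥ x := by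
      refine ⟨fun i => L (Pi.single i 1), fun x => ?_⟩
      conv_lhs => rw [← Finset.univ_sum_single x]
      rw [map_sum]
      refine Finset.sum_congr rfl fun i _ => ?_
      have : Pi.single (M := fun _ => ℝ) i (x i) = x i • Pi.single i (1 : ℝ) := by
        rw [← Pi.single_smul]; simp
      rw [this, map_smul, smul_eq_mul, mul_comm]
    have hLc : Continuous fun x : Fin M → ℝ => L x := by fun_prop
    have ic : Integrable (fun x => h x * Real.cos (L x)) μ :=
      hi.mul_bdd (c := 1) (Real.continuous_cos.comp hLc).aestronglyMeasurable (Filter.Eventually.of_forall fun x => Real.abs_cos_le_one _)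
    have is : Integrable (fun x => h x * Real.sin (L x)) μ :=
      hi.mul_bdd (c := 1) (Real.continuous_sin.comp hLc).aestronglyMeasurable (Filter.Eventually.of_forall fun x => Real.abs_sin_le_one _)
    rw [integral_add ic.ofReal (is.ofReal.mul_const _), integral_mul_const, integral_complex_ofReal,
      integral_complex_ofReal]
    have c0 := h0 k 0
    have s0 := h0 k (-(π / 2))
    simp only [← sub_eq_add_neg, Real.cos_sub_pi_div_two, add_zero, ← hk] at c0 s0
    rw [c0, s0]; simp
  rw [withDensity_eq_iff hm.ennreal_ofReal hm'.ennreal_ofReal f1] at key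
  filter_upwards [key] with x hx
  have := congrArg ENNReal.toReal hx
  rw [ENNReal.toReal_ofReal', ENNReal.toReal_ofReal'] at this
  rcases le_total 0 (h x) with h' | h' <;> simp_all

/-- trigonometric polynomials -/
def Trig {M : ℕ} (f : (Fin M → ℝ) → ℝ) : Prop :=
  ∃ (ι : Type) (_ : Fintype ι) (a : ι → ℝ) (k : ι → Fin M → ℝ) (b : ι → ℝ),
    ∀ x, f x = ∑ j, a j * Real.cos (k j ⬝ᵥ x + b j)

lemma Trig.cos {M : ℕ} (c : ℝ) (k : Fin M → ℝ) (b : ℝ) : Trig fun x => c * Real.cos (k ⬝ᵥ x + b) :=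
  ⟨Unit, inferInstance, fun _ => c, fun _ => k, fun _ => b, fun x => by simp⟩

lemma Trig.const {M : ℕ} (c : ℝ) : Trig fun _ : Fin M → ℝ => c := by
  simpa using Trig.cos (M := M) c 0 0

lemma Trig.add {M : ℕ} {f g : (Fin M → ℝ) → ℝ} (hf : Trig f) (hg : Trig g) :
    Trig fun x => f x + g x := by
  obtain ⟨ι, _, a, k, b, h⟩ := hf
  obtain ⟨ι', _, a', k', b', h'⟩ := hg
  refine ⟨ι ⊕ ι', inferInstance, Sum.elim a a', Sum.elim k k', Sum.elim b b', fun x => ?_⟩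
  simp [h, h', Fintype.sum_sum_type]

lemma Trig.sum {M : ℕ} {β : Type*} {s : Finset β} {f : β → (Fin M → ℝ) → ℝ}
    (hf : ∀ i ∈ s, Trig (f i)) : Trig fun x => ∑ i ∈ s, f i x := by
  classical
  induction s using Finset.induction_on with
  | empty => simpa using Trig.const 0
  | insert i s hi ih =>
    simp_rw [Finset.sum_insert hi]
    exact (hf i (by simp)).add (ih fun j hj => hf j (by simp [hj]))

lemma Trig.mul {M : ℕ} {f g : (Fin M → ℝ) → ℝ} (hf : Trig f) (hg : Trig g) :
    Trig fun x => f x * g x := by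
  obtain ⟨ι, _, a, k, b, h⟩ := hf
  obtain ⟨ι', _, a', k', b', h'⟩ := hg
  simp_rw [h, h', Finset.sum_mul_sum]
  refine Trig.sum fun i _ => Trig.sum fun j _ => ?_
  have e : ∀ x, a i * Real.cos (k i ⬝ᵥ x + b i) * (a' j * Real.cos (k' j ⬝ᵥ x + b' j)) =
      (a i * a' j / 2) * Real.cos ((k i - k' j) ⬝ᵥ x + (b i - b' j)) +
      (a i * a' j / 2) * Real.cos ((k i + k' j) ⬝ᵥ x + (b i + b' j)) := by
    intro x
    have h := Real.two_mul_cos_mul_cos (k i ⬝ᵥ x + b i) (k' j ⬝ᵥ x + b' j)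
    rw [sub_dotProduct, add_dotProduct]
    have e1 : k i ⬝ᵥ x - k' j ⬝ᵥ x + (b i - b' j) = k i ⬝ᵥ x + b i - (k' j ⬝ᵥ x + b' j) := by ring
    have e2 : k i ⬝ᵥ x + k' j ⬝ᵥ x + (b i + b' j) = k i ⬝ᵥ x + b i + (k' j ⬝ᵥ x + b' j) := by ring
    rw [e1, e2]
    linear_combination (a i * a' j / 2) * h
  simp_rw [e]
  exact (Trig.cos _ _ _).add (Trig.cos _ _ _)

lemma Trig.smul {M : ℕ} {f : (Fin M → ℝ) → ℝ} (c : ℝ) (hf : Trig f) : Trig fun x => c * f x :=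
  (Trig.const c).mul hf

lemma Trig.continuous {M : ℕ} {f : (Fin M → ℝ) → ℝ} (hf : Trig f) : Continuous f := by
  obtain ⟨ι, _, a, k, b, h⟩ := hf
  rw [funext h]
  refine continuous_finsetSum _ fun j _ => ?_
  have := dot_cont (k j)
  fun_prop

lemma Trig.bd {M : ℕ} {f : (Fin M → ℝ) → ℝ} (hf : Trig f) : Bd f := by
  obtain ⟨ι, _, a, k, b, h⟩ := hf
  rw [funext h]
  exact Bd.sum fun j _ => (Bd.const _).mul ⟨1, fun x => Real.abs_cos_le_one _⟩

lemma trig_dense {M : ℕ} (μ : Measure (Fin M → ℝ)) [IsFiniteMeasure μ] (s : (Fin M → ℝ) → ℝ)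
    (hm : Measurable s) (hb : Bd s) (ε : ℝ) (hε : 0 < ε) :
    ∃ p, Trig p ∧ ∫ x, (p x - s x) ^ 2 ∂μ ≤ ε ^ 2 := by
  have mem : ∀ {u : (Fin M → ℝ) → ℝ}, Measurable u → Bd u → MemLp u 2 μ := by
    intro u hu ⟨K, hK⟩
    exact MemLp.of_bound hu.aestronglyMeasurable K (Filter.Eventually.of_forall hK)
  have memT : ∀ {u : (Fin M → ℝ) → ℝ}, Trig u → MemLp u 2 μ := fun h => mem h.continuous.measurable h.bd
  let T : Submodule ℝ (Lp ℝ 2 μ) :=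
    { carrier := {f | ∃ p, Trig p ∧ f =ᵐ[μ] p}
      add_mem' := by
        rintro f g ⟨p, hp, h⟩ ⟨q, hq, h'⟩
        refine ⟨_, hp.add hq, ?_⟩
        filter_upwards [h, h', Lp.coeFn_add f g] with x h1 h2 h3
        rw [h3, Pi.add_apply, h1, h2]
      zero_mem' := ⟨_, Trig.const 0, Lp.coeFn_zero _ _ _⟩
      smul_mem' := by
        rintro c f ⟨p, hp, h⟩
        refine ⟨_, hp.smul c, ?_⟩
        filter_upwards [h, Lp.coeFn_smul c f] with x h1 h3
        rw [h3, Pi.smul_apply, h1, smul_eq_mul] }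
  have hT : T.topologicalClosure = ⊤ := by
    rw [Submodule.topologicalClosure_eq_top_iff, Submodule.eq_bot_iff]
    intro h hh
    have hv := fourier_vanish μ h ((Lp.memLp h).integrable (by norm_num)) fun k b => by
      have ht := Trig.cos 1 k b
      have hmem : (memT ht).toLp ∈ T := ⟨_, ht, (memT ht).coeFn_toLp⟩
      have := hh _ hmem
      rw [L2.inner_def] at this
      rw [← this]
      refine integral_congr_ae ?_
      filter_upwards [(memT ht).coeFn_toLp] with x hx
      rw [hx]; simp
    exact (Lp.eq_zero_iff_ae_eq_zero).2 hv
  have hs : (mem hm hb).toLp ∈ T.topologicalClosure := by rw [hT]; trivial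
  rw [← SetLike.mem_coe, Submodule.topologicalClosure_coe, Metric.mem_closure_iff] at hs
  obtain ⟨f, ⟨p, hp, hfp⟩, hd⟩ := hs ε hε
  refine ⟨p, hp, ?_⟩
  rw [dist_comm, dist_eq_norm] at hd
  have : ∫ x, (p x - s x) ^ 2 ∂μ = ‖f - (mem hm hb).toLp‖ ^ 2 := by
    rw [← real_inner_self_eq_norm_sq, L2.inner_def]
    refine integral_congr_ae ?_
    filter_upwards [Lp.coeFn_sub f (mem hm hb).toLp, (mem hm hb).coeFn_toLp, hfp] with x h1 h2 h3
    rw [h1, Pi.sub_apply, h2, h3]; simp [pow_two]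
  rw [this]
  exact pow_le_pow_left₀ (norm_nonneg _) hd.le 2

/-- approximation of a bounded function by a trigonometric polynomial keeping the lower bound -/
lemma trig_approx {M : ℕ} (μ : Measure (Fin M → ℝ)) [IsFiniteMeasure μ] (ψ : (Fin M → ℝ) → ℝ)
    (hm : Measurable ψ) (m : ℝ) (hψ : ∀ x, m ≤ ψ x) (hb : Bd ψ) (ε : ℝ) (hε : 0 < ε) :
    ∃ χ, Trig χ ∧ (∀ x, m ≤ χ x) ∧ ∫ x, |χ x - ψ x| ∂μ ≤ ε := by
  obtain ⟨K0, hK0⟩ := hb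
  set s : (Fin M → ℝ) → ℝ := fun x => √(ψ x - m) with hs
  set K := √(K0 + |m|) with hK
  have hsK : ∀ x, |s x| ≤ K := by
    intro x
    rw [abs_of_nonneg (Real.sqrt_nonneg _)]
    apply Real.sqrt_le_sqrt
    have := (le_abs_self _).trans (hK0 x)
    have := neg_abs_le m
    linarith
  have hK0 : 0 ≤ K := Real.sqrt_nonneg _
  have hsm : Measurable s := (hm.sub_const _).sqrt
  set c := 1 + K * (μ.real Set.univ + 1) with hc
  have hc1 : 1 ≤ c := by
    have : 0 ≤ K * (μ.real Set.univ + 1) := by positivity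
    linarith
  set δ := min 1 (ε / c) with hδ
  have hδ0 : 0 < δ := lt_min one_pos (by positivity)
  have hδ1 : δ ≤ 1 := min_le_left _ _
  have hδc : δ * c ≤ ε := by
    have := min_le_right 1 (ε / c)
    rwa [← hδ, le_div_iff₀ (by positivity)] at this
  obtain ⟨p, hp, hpε⟩ := trig_dense μ s hsm ⟨K, hsK⟩ δ hδ0
  refine ⟨fun x => m + p x * p x, (Trig.const m).add (hp.mul hp),
    fun x => by nlinarith [mul_self_nonneg (p x)], ?_⟩
  have i2 : Integrable (fun x => (p x - s x) ^ 2) μ := by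
    simp_rw [pow_two]
    have hb : Bd fun x => p x - s x := hp.bd.sub ⟨K, hsK⟩
    have hm' : Measurable fun x => p x - s x := hp.continuous.measurable.sub hsm
    exact (hb.mul hb).integrable (hm'.mul hm')
  calc ∫ x, |m + p x * p x - ψ x| ∂μ ≤ ∫ x, ((p x - s x) ^ 2 + K * (δ + 1 / δ * (p x - s x) ^ 2)) ∂μ := by
        refine integral_mono_of_nonneg (Filter.Eventually.of_forall fun x => abs_nonneg _)
          (i2.add (((integrable_const _).add (i2.const_mul _)).const_mul _))
          (Filter.Eventually.of_forall fun x => ?_)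
        have e : ψ x = m + s x * s x := by
          rw [hs]; simp only []
          rw [Real.mul_self_sqrt (by linarith [hψ x])]; ring
        simp only []
        rw [e]
        set u := p x - s x with hu
        have e2 : m + p x * p x - (m + s x * s x) = u ^ 2 + 2 * (s x * u) := by rw [hu]; ring
        rw [e2]
        have h1 : |s x * u| ≤ K * |u| := by
          rw [abs_mul]; exact mul_le_mul_of_nonneg_right (hsK x) (abs_nonneg _)
        have h2 : 2 * |u| ≤ δ + 1 / δ * u ^ 2 := by
          have : δ + 1 / δ * u ^ 2 - 2 * |u| = 1 / δ * (|u| - δ) ^ 2 := by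
            rw [← sq_abs u]; field_simp; ring
          have h3 : 0 ≤ 1 / δ * (|u| - δ) ^ 2 := by positivity
          linarith
        calc |u ^ 2 + 2 * (s x * u)| ≤ |u ^ 2| + |2 * (s x * u)| := abs_add_le _ _
          _ ≤ u ^ 2 + K * (2 * |u|) := by
            rw [abs_of_nonneg (sq_nonneg u), abs_mul, abs_two]; linarith
          _ ≤ _ := by
            have := mul_le_mul_of_nonneg_left h2 hK0
            linarith
    _ = (∫ x, (p x - s x) ^ 2 ∂μ) + K * (δ * μ.real Set.univ + 1 / δ * ∫ x, (p x - s x) ^ 2 ∂μ) := by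
        have i3 : Integrable (fun x => δ + 1 / δ * (p x - s x) ^ 2) μ :=
          (integrable_const _).add (i2.const_mul _)
        rw [integral_add i2 (i3.const_mul _), integral_const_mul,
          integral_add (integrable_const _) (i2.const_mul _), integral_const_mul, integral_const, smul_eq_mul,
          mul_comm (μ.real _)]
    _ ≤ δ ^ 2 + K * (δ * μ.real Set.univ + 1 / δ * δ ^ 2) := by
        gcongr
    _ ≤ δ * c := by
        have : 1 / δ * δ ^ 2 = δ := by field_simp
        rw [this, hc]
        nlinarith
    _ ≤ ε := hδc
open MeasureTheory Real

/-- Data without the test function. -/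
structure Dat0 (M N : ℕ) (Ω : Type) [MeasurableSpace Ω] where
  ν : Measure Ω
  prob : IsProbabilityMeasure ν
  B : Ω → Fin M → Fin M → ℝ
  D : Ω → Fin M → Fin N → ℝ
  hB : ∀ a b, Measurable fun ω => B ω a b
  hD : ∀ a b, Measurable fun ω => D ω a b
  orth : ∀ ω a a', ∑ b, B ω a b * B ω a' b + ∑ c, D ω a c * D ω a' c = if a = a' then 1 else 0
  C : ℝ
  hC : 0 < C
  hBC : ∀ e : Fin M → ℝ, ∫ ω, ∑ a, (B ω a ⬝ᵥ e) ^ 2 ∂ν ≤ C * (e ⬝ᵥ e)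

/-- density hypotheses -/
structure Dens {M : ℕ} (f : (Fin M → ℝ) → ℝ) : Prop where
  nonneg : ∀ v, 0 ≤ f v
  meas : Measurable f
  int : Integrable f
  one : ∫ v, f v = 1

lemma relEntropy_eq {M : ℕ} (g : (Fin M → ℝ) → ℝ) :
    relEntropy g = ∫ v, g v * Real.log (g v / gau v) := rfl

lemma gibbs_pt (x G b : ℝ) (hx : 0 ≤ x) (hG : 0 < G) :
    x * b ≤ x * Real.log (x / G) - x + G * Real.exp b := by
  rcases hx.eq_or_lt with rfl | hx
  · simp; positivity
  · have h := Real.log_le_sub_one_of_pos (x := G * Real.exp b / x) (by positivity)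
    rw [Real.log_div (by positivity) hx.ne', Real.log_mul hG.ne' (Real.exp_pos b).ne', Real.log_exp] at h
    rw [Real.log_div hx.ne' hG.ne']
    have h2 := mul_le_mul_of_nonneg_left h hx.le
    have h3 : x * (G * Real.exp b / x - 1) = G * Real.exp b - x := by field_simp
    rw [h3] at h2
    nlinarith

lemma gibbs0 {M : ℕ} {f : (Fin M → ℝ) → ℝ} (hf : Dens f)
    (he : Integrable fun v => f v * Real.log (f v / gau v)) (b : (Fin M → ℝ) → ℝ) (hbm : Measurable b)
    (hb : Bd b) : ∫ v, f v * b v ≤ relEntropy f - 1 + ∫ v, Real.exp (b v) ∂gam M := by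
  have hbe : Bd fun v => Real.exp (b v) := by
    obtain ⟨K, hK⟩ := hb
    exact ⟨Real.exp K, fun v => by
      rw [abs_of_pos (Real.exp_pos _)]; exact Real.exp_le_exp.2 ((le_abs_self _).trans (hK v))⟩
  have i1 : Integrable fun v => f v * b v := by
    obtain ⟨K, hK⟩ := hb
    exact hf.int.mul_bdd (c := K) hbm.aestronglyMeasurable (Filter.Eventually.of_forall hK)
  have i2 := (integrable_gam_iff _).1 (hbe.integrable (μ := gam M) hbm.exp)
  rw [integral_gam, relEntropy_eq, ← hf.one]
  have i3 : Integrable fun v => f v * Real.log (f v / gau v) - f v := he.sub hf.int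
  rw [← integral_sub he hf.int, ← integral_add i3 i2]
  exact integral_mono i1 (i3.add i2) fun v => gibbs_pt _ _ _ (hf.nonneg v) (gau_pos v)

lemma relEntropy_nonneg {M : ℕ} {f : (Fin M → ℝ) → ℝ} (hf : Dens f)
    (he : Integrable fun v => f v * Real.log (f v / gau v)) : 0 ≤ relEntropy f := by
  have := gibbs0 hf he (fun _ => 0) measurable_const (Bd.const 0)
  simpa using this

lemma gibbs {M : ℕ} {f : (Fin M → ℝ) → ℝ} (hf : Dens f)
    (he : Integrable fun v => f v * Real.log (f v / gau v)) (u : (Fin M → ℝ) → ℝ) (hum : Measurable u)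
    (hu : Bd u) (C : ℝ) (hC : 0 < C) (A : ℝ) (hA : ∫ v, Real.exp (u v / C) ∂gam M ≤ Real.exp (A / C)) :
    ∫ v, f v * u v ≤ C * relEntropy f + A := by
  have hb : Bd fun v => u v * (1 / C) - A / C := (hu.mul (Bd.const _)).sub (Bd.const _)
  have hbm : Measurable fun v => u v * (1 / C) - A / C := (hum.mul_const _).sub_const _
  have := gibbs0 hf he _ hbm hb
  have e1 : ∫ v, Real.exp (u v * (1 / C) - A / C) ∂gam M ≤ 1 := by
    simp_rw [Real.exp_sub, mul_one_div]
    rw [integral_div]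
    exact div_le_one_of_le₀ hA (Real.exp_pos _).le
  have i1 : Integrable fun v => f v * u v := by
    obtain ⟨K, hK⟩ := hu
    exact hf.int.mul_bdd (c := K) hum.aestronglyMeasurable (Filter.Eventually.of_forall hK)
  have e2 : ∫ v, f v * (u v * (1 / C) - A / C) = (1 / C) * (∫ v, f v * u v) - A / C := by
    have : ∀ v, f v * (u v * (1 / C) - A / C) = (1 / C) * (f v * u v) - f v * (A / C) := fun v => by ring
    simp_rw [this]
    rw [integral_sub (i1.const_mul _) (hf.int.mul_const _), integral_const_mul, integral_mul_const, hf.one,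
      one_mul]
  rw [e2] at this
  have h3 : (1 / C) * (∫ v, f v * u v) ≤ relEntropy f + A / C := by linarith
  rw [one_div_mul_eq_div, div_le_iff₀ hC] at h3
  calc _ ≤ _ := h3
    _ = _ := by field_simp

namespace Dat0
variable {M N : ℕ} {Ω : Type} [MeasurableSpace Ω] (X : Dat0 M N Ω)

/-- add a test function -/
def toDat {ι : Type} [Fintype ι] (a : ι → ℝ) (k : ι → Fin M → ℝ) (b : ι → ℝ) (m : ℝ) (hm0 : 0 < m)
    (hm : ∀ x, m ≤ trP a k b 1 x) : Dat M N Ω ι :=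
  ⟨X.ν, X.prob, X.B, X.D, X.hB, X.hD, X.orth, X.C, X.hC, X.hBC, a, k, b, m, hm0, hm⟩

/-- duality relation -/
def Dual (f₀ f : (Fin M → ℝ) → ℝ) : Prop := ∀ φ : (Fin M → ℝ) → ℝ, Measurable φ → Bd φ →
  ∫ v, f v * φ v = ∫ v, f₀ v * ∫ p, φ (fun a => X.B p.1 a ⬝ᵥ v + X.D p.1 a ⬝ᵥ p.2) ∂(X.ν.prod (gam N))

variable {X} {f₀ f : (Fin M → ℝ) → ℝ}

lemma ineq_trig (h0 : Dens f₀)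
    (he : Integrable fun v => f₀ v * Real.log (f₀ v / gau v))
    (hd : X.Dual f₀ f) (χ : (Fin M → ℝ) → ℝ) (ht : Trig χ) (m : ℝ) (hm0 : 0 < m) (hm : ∀ x, m ≤ χ x) :
    ∫ v, f v * Real.log (χ v) ≤ X.C * relEntropy f₀ + Real.log (∫ v, χ v ∂gam M) := by
  obtain ⟨ι, _, a, k, b, hχ⟩ := ht
  have e : χ = trP a k b 1 := by
    ext x; rw [hχ]; simp [trP, trA, trT]
  rw [e] at hm ⊢
  let Y := X.toDat a k b m hm0 hm
  have h1 : (1 : ℝ) ∈ Set.Icc (0 : ℝ) 1 := by simp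
  have hb : Bd fun v => Real.log (trP a k b 1 v) := ⟨Y.Lg, fun v => Y.log_abs h1 v⟩
  rw [hd _ (trP_cont a k b 1).measurable.log hb]
  exact gibbs h0 he (Y.U 1) (Y.U_meas 1) ⟨Y.Lg, fun v => Y.U_abs h1 v⟩ X.C X.hC _ Y.main

lemma log_lip {m x y : ℝ} (hm : 0 < m) (hx : m ≤ x) (hy : m ≤ y) :
    |Real.log x - Real.log y| ≤ 1 / m * |x - y| := by
  wlog h : x ≤ y generalizing x y
  · rw [abs_sub_comm, abs_sub_comm x]; exact this hy hx (le_of_not_ge h)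
  have hx0 : 0 < x := hm.trans_le hx
  have h1 : Real.log x ≤ Real.log y := Real.log_le_log hx0 h
  rw [abs_sub_comm, abs_of_nonneg (by linarith), abs_sub_comm x, abs_of_nonneg (by linarith)]
  rw [← Real.log_div (by linarith) hx0.ne']
  calc Real.log (y / x) ≤ y / x - 1 := Real.log_le_sub_one_of_pos (div_pos (by linarith) hx0)
    _ = 1 / x * (y - x) := by field_simp
    _ ≤ _ := mul_le_mul_of_nonneg_right (one_div_le_one_div_of_le hm hx) (by linarith)

lemma ineq_bdd (h0 : Dens f₀)
    (he : Integrable fun v => f₀ v * Real.log (f₀ v / gau v)) (hf : Dens f)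
    (hd : X.Dual f₀ f) (ψ : (Fin M → ℝ) → ℝ) (hψm : Measurable ψ) (hb : Bd ψ) (m : ℝ) (hm0 : 0 < m)
    (hm : ∀ x, m ≤ ψ x) :
    ∫ v, f v * Real.log (ψ v) ≤ X.C * relEntropy f₀ + Real.log (∫ v, ψ v ∂gam M) := by
  refine le_of_forall_pos_le_add fun δ hδ => ?_
  set ε := δ * m / 2 with hε
  have hε0 : 0 < ε := by positivity
  have hfe : Measurable fun v => ENNReal.ofReal (f v) := hf.meas.ennreal_ofReal
  have : IsFiniteMeasure (volume.withDensity fun v => ENNReal.ofReal (f v)) :=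
    isFiniteMeasure_withDensity hf.int.lintegral_lt_top.ne
  obtain ⟨χ, hχ, hχm, hχi⟩ := trig_approx (gam M + volume.withDensity fun v => ENNReal.ofReal (f v))
    ψ hψm m hm hb ε hε0
  have hd1 : Bd fun v => |χ v - ψ v| := by
    obtain ⟨K, hK⟩ := hχ.bd.sub hb
    exact ⟨K, fun x => by rw [abs_abs]; exact hK x⟩
  have hd1m : Measurable fun v => |χ v - ψ v| := (hχ.continuous.measurable.sub hψm).abs
  have a1 : ∫ x, |χ x - ψ x| ∂gam M ≤ ε := by
    refine le_trans ?_ hχi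
    exact integral_mono_measure (Measure.le_add_right le_rfl)
      (Filter.Eventually.of_forall fun _ => abs_nonneg _) (hd1.integrable hd1m)
  have a2 : ∫ x, f x * |χ x - ψ x| ≤ ε := by
    have h2 : ∫ x, |χ x - ψ x| ∂(volume.withDensity fun v => ENNReal.ofReal (f v)) ≤ ε := by
      refine le_trans ?_ hχi
      exact integral_mono_measure (Measure.le_add_left le_rfl)
        (Filter.Eventually.of_forall fun _ => abs_nonneg _) (hd1.integrable hd1m)
    rw [integral_withDensity_eq_integral_toReal_smul hfe (by simp)] at h2
    simpa [ENNReal.toReal_ofReal (hf.nonneg _)] using h2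
  have hlog : ∀ {u : (Fin M → ℝ) → ℝ}, Measurable u → Bd u → (∀ x, m ≤ u x) →
      Integrable fun v => f v * Real.log (u v) := by
    intro u hu ⟨K, hK⟩ hmu
    refine hf.int.mul_bdd (c := 1 / m * (K + 1) + |Real.log 1| + 1 / m * |m - 1| + |Real.log m|) hu.log.aestronglyMeasurable
      (Filter.Eventually.of_forall fun x => ?_)
    have h1 := log_lip hm0 (hmu x) le_rfl
    have h2 : |u x - m| ≤ K + 1 + |m - 1| := by
      have := abs_sub_le (u x) 1 m
      have h3 : |u x - 1| ≤ |u x| + 1 := by simpa using abs_sub (u x) 1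
      have := hK x
      rw [abs_sub_comm 1 m] at *
      linarith
    have h4 : |Real.log (u x)| ≤ |Real.log (u x) - Real.log m| + |Real.log m| := by
      simpa using abs_add_le (Real.log (u x) - Real.log m) (Real.log m)
    have h5 := mul_le_mul_of_nonneg_left h2 (by positivity : 0 ≤ 1 / m)
    rw [Real.norm_eq_abs]
    have := abs_nonneg (Real.log 1)
    linarith
  have i1 := hlog hψm hb hm
  have i2 := hlog hχ.continuous.measurable hχ.bd hχm
  have i3 : Integrable fun x => f x * |χ x - ψ x| := by
    obtain ⟨K, hK⟩ := hd1
    exact hf.int.mul_bdd (c := K) hd1m.aestronglyMeasurable (Filter.Eventually.of_forall hK)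
  have key := ineq_trig h0 he hd χ hχ m hm0 hχm
  have b1 : ∫ v, f v * Real.log (ψ v) ≤ (∫ v, f v * Real.log (χ v)) + 1 / m * ε := by
    calc _ ≤ ∫ v, (f v * Real.log (χ v) + 1 / m * (f v * |χ v - ψ v|)) := by
          refine integral_mono i1 (i2.add (i3.const_mul _)) fun v => ?_
          have h1 := log_lip hm0 (hχm v) (hm v)
          rw [abs_sub_comm] at h1
          have h2 := mul_le_mul_of_nonneg_left ((le_abs_self _).trans h1) (hf.nonneg v)
          simp only []
          linarith
      _ = (∫ v, f v * Real.log (χ v)) + 1 / m * ∫ v, (f v * |χ v - ψ v|) := by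
          rw [integral_add i2 (i3.const_mul _), integral_const_mul]
      _ ≤ _ := by gcongr
  have iψ := hb.integrable (μ := gam M) hψm
  have iχ := hχ.bd.integrable (μ := gam M) hχ.continuous.measurable
  have c1 : m ≤ ∫ v, ψ v ∂gam M := by
    have := integral_mono (integrable_const m) iψ hm
    simpa using this
  have c1' : m ≤ ∫ v, χ v ∂gam M := by
    have := integral_mono (integrable_const m) iχ hχm
    simpa using this
  have c2 : |(∫ v, χ v ∂gam M) - ∫ v, ψ v ∂gam M| ≤ ε := by
    rw [← integral_sub iχ iψ]
    exact abs_integral_le_integral_abs.trans a1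
  have c3 := (le_abs_self _).trans (log_lip hm0 c1' c1)
  have c4 := mul_le_mul_of_nonneg_left c2 (by positivity : 0 ≤ 1 / m)
  have : 1 / m * ε = δ / 2 := by rw [hε]; field_simp
  linarith

/-- abstract entropy inequality -/
lemma entropy_le (h0 : Dens f₀)
    (he : Integrable fun v => f₀ v * Real.log (f₀ v / gau v)) (hf : Dens f)
    (hd : X.Dual f₀ f) : relEntropy f ≤ X.C * relEntropy f₀ := by
  by_cases hi : Integrable fun v => f v * Real.log (f v / gau v)
  swap
  · rw [relEntropy_eq, integral_undef hi]
    exact mul_nonneg X.hC.le (relEntropy_nonneg h0 he)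
  have hgm := gau_meas (n := M)
  have hfm := hf.meas
  set q : (Fin M → ℝ) → ℝ := fun v => f v / gau v with hq
  have hqm : Measurable q := hfm.div hgm
  have hq0 : ∀ v, 0 ≤ q v := fun v => div_nonneg (hf.nonneg v) (gau_pos v).le
  let ψ : ℕ → (Fin M → ℝ) → ℝ := fun i v => max (1 / ((i : ℝ) + 1)) (min (q v) ((i : ℝ) + 1))
  have hψm : ∀ i, Measurable (ψ i) := fun i => measurable_const.max (hqm.min measurable_const)
  have hψl : ∀ (i : ℕ) v, 1 / ((i : ℝ) + 1) ≤ ψ i v := fun i v => le_max_left _ _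
  have hle1 : ∀ i : ℕ, 1 / ((i : ℝ) + 1) ≤ 1 := fun i => by
    rw [div_le_one (by positivity)]; linarith [Nat.cast_nonneg (α := ℝ) i]
  have hψu : ∀ (i : ℕ) v, ψ i v ≤ (i : ℝ) + 1 := fun i v =>
    max_le ((hle1 i).trans (by linarith [Nat.cast_nonneg (α := ℝ) i])) (min_le_right _ _)
  have hpos : ∀ i : ℕ, 0 < 1 / ((i : ℝ) + 1) := fun i => by positivity
  have hψb : ∀ i, Bd (ψ i) := fun i => ⟨(i : ℝ) + 1, fun v => by
    rw [abs_of_pos ((hpos i).trans_le (hψl i v))]; exact hψu i v⟩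
  have hintg : ∀ i : ℕ, ∫ v, ψ i v ∂gam M ≤ 1 + 1 / ((i : ℝ) + 1) := by
    intro i
    have iψ := (integrable_gam_iff _).1 ((hψb i).integrable (μ := gam M) (hψm i))
    rw [integral_gam]
    calc ∫ v, gau v * ψ i v ≤ ∫ v, (f v + gau v * (1 / ((i : ℝ) + 1))) := by
          refine integral_mono iψ (hf.int.add (gau_integrable.mul_const _)) fun v => ?_
          have h1 : ψ i v ≤ q v + 1 / ((i : ℝ) + 1) :=
            max_le (by linarith [hq0 v]) ((min_le_left _ _).trans (by linarith [hpos i]))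
          have h2 := mul_le_mul_of_nonneg_left h1 (gau_pos v).le
          have h3 : gau v * q v = f v := by
            rw [hq]; have := (gau_pos v).ne'; field_simp
          simp only []
          linarith
      _ = _ := by
          rw [integral_add hf.int (gau_integrable.mul_const _), integral_mul_const, hf.one, gau_integral, one_mul]
  have hineq : ∀ i : ℕ, ∫ v, f v * Real.log (ψ i v) ≤ X.C * relEntropy f₀ + Real.log (1 + 1 / ((i : ℝ) + 1)) := by
    intro i
    refine (ineq_bdd h0 he hf hd (ψ i) (hψm i) (hψb i) _ (hpos i) (hψl i)).trans ?_
    have : 0 < ∫ v, ψ i v ∂gam M := by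
      have h1 := integral_mono (integrable_const (1 / ((i : ℝ) + 1))) ((hψb i).integrable (μ := gam M) (hψm i)) (hψl i)
      have : 1 / ((i : ℝ) + 1) ≤ ∫ v, ψ i v ∂gam M := by simpa using h1
      exact (hpos i).trans_le this
    have := Real.log_le_log this (hintg i)
    linarith
  have hlim1 : Filter.Tendsto (fun i : ℕ => 1 / ((i : ℝ) + 1)) Filter.atTop (nhds 0) :=
    tendsto_one_div_add_atTop_nhds_zero_nat
  have hlim2 : Filter.Tendsto (fun i : ℕ => X.C * relEntropy f₀ + Real.log (1 + 1 / ((i : ℝ) + 1))) Filter.atTop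
      (nhds (X.C * relEntropy f₀)) := by
    have h1 : Filter.Tendsto (fun i : ℕ => Real.log (1 + 1 / ((i : ℝ) + 1))) Filter.atTop (nhds (Real.log (1 + 0))) :=
      (Real.continuousAt_log (by norm_num)).tendsto.comp (tendsto_const_nhds.add hlim1)
    have h2 := h1.const_add (X.C * relEntropy f₀)
    simpa using h2
  have hlim3 : Filter.Tendsto (fun i : ℕ => ∫ v, f v * Real.log (ψ i v)) Filter.atTop (nhds (relEntropy f)) := by
    rw [relEntropy_eq]
    refine tendsto_integral_of_dominated_convergence (fun v => |f v * Real.log (q v)|)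
      (fun i => (hfm.mul (hψm i).log).aestronglyMeasurable) hi.abs
      (fun i => Filter.Eventually.of_forall fun v => ?_) (Filter.Eventually.of_forall fun v => ?_)
    · rw [Real.norm_eq_abs, abs_mul, abs_mul]
      rcases (hf.nonneg v).eq_or_lt with h | h
      · rw [← h]; simp
      have hqp : 0 < q v := div_pos h (gau_pos v)
      have hi1 : (1 : ℝ) ≤ (i : ℝ) + 1 := by linarith [Nat.cast_nonneg (α := ℝ) i]
      refine mul_le_mul_of_nonneg_left ?_ (abs_nonneg _)
      rcases le_total 1 (q v) with h1 | h1
      · have h2 : 1 ≤ ψ i v := le_max_of_le_right (le_min h1 hi1)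
        have h3 : ψ i v ≤ q v := max_le ((hle1 i).trans h1) (min_le_left _ _)
        rw [abs_of_nonneg (Real.log_nonneg h2), abs_of_nonneg (Real.log_nonneg h1)]
        exact Real.log_le_log (by linarith) h3
      · have h2 : ψ i v ≤ 1 := max_le (hle1 i) ((min_le_left _ _).trans h1)
        have h3 : q v ≤ ψ i v := le_max_of_le_right (le_min le_rfl (h1.trans hi1))
        rw [abs_of_nonpos (Real.log_nonpos (hqp.le.trans h3) h2), abs_of_nonpos (Real.log_nonpos hqp.le h1)]
        exact neg_le_neg (Real.log_le_log hqp h3)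
    · rcases (hf.nonneg v).eq_or_lt with h | h
      · simp [← h]
      have hqp : 0 < q v := div_pos h (gau_pos v)
      refine Filter.Tendsto.congr' ?_ tendsto_const_nhds
      have e1 : ∀ᶠ i : ℕ in Filter.atTop, 1 / ((i : ℝ) + 1) < q v := hlim1.eventually (gt_mem_nhds hqp)
      have e2 : ∀ᶠ i : ℕ in Filter.atTop, q v ≤ (i : ℝ) :=
        (tendsto_natCast_atTop_atTop).eventually (Filter.eventually_ge_atTop _)
      filter_upwards [e1, e2] with i h1 h2
      have : ψ i v = q v := by
        simp only [ψ]
        rw [min_eq_left (by linarith), max_eq_right h1.le]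
      rw [this]
  exact le_of_tendsto_of_tendsto' hlim3 hlim2 hineq

end Dat0
open MeasureTheory Real

section rot
variable {n : ℕ}

lemma rot_sum (i j : Fin n) (hij : i ≠ j) (θ : ℝ) (z : Fin n → ℝ) (g : Fin n → ℝ → ℝ) :
    ∑ l, g l (kacRotate i j θ z l) = ∑ l, g l (z l)
      + (g i (Real.cos θ * z i - Real.sin θ * z j) - g i (z i))
      + (g j (Real.sin θ * z i + Real.cos θ * z j) - g j (z j)) := by
  have : ∀ l, g l (kacRotate i j θ z l) = g l (z l)
      + (if l = i then g i (Real.cos θ * z i - Real.sin θ * z j) - g i (z i) else 0)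
      + (if l = j then g j (Real.sin θ * z i + Real.cos θ * z j) - g j (z j) else 0) := by
    intro l
    unfold kacRotate
    by_cases h : l = i
    · subst h; simp [hij]
    · by_cases h' : l = j
      · subst h'; simp [h]
      · simp [h, h']
  simp_rw [this, Finset.sum_add_distrib]
  simp

lemma rot_sq (i j : Fin n) (hij : i ≠ j) (θ : ℝ) (z : Fin n → ℝ) :
    ∑ l, (kacRotate i j θ z l) ^ 2 = ∑ l, (z l) ^ 2 := by
  rw [rot_sum i j hij θ z fun _ x => x ^ 2]
  have := Real.sin_sq_add_cos_sq θ
  linear_combination (z i ^ 2 + z j ^ 2) * this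

lemma rot_inv (i j : Fin n) (hij : i ≠ j) (θ : ℝ) (z : Fin n → ℝ) :
    kacRotate i j (-θ) (kacRotate i j θ z) = z := by
  have h := Real.sin_sq_add_cos_sq θ
  ext l
  unfold kacRotate
  by_cases h1 : l = i
  · subst h1
    simp only [if_true, Real.cos_neg, Real.sin_neg, hij.symm, if_false]
    linear_combination (z l) * h
  · by_cases h' : l = j
    · subst h'
      simp only [if_true, Real.cos_neg, Real.sin_neg, hij.symm, if_false]
      linear_combination (z l) * h
    · simp [h1, h']

lemma iso_rows (A : Fin n → Fin n → ℝ)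
    (hA : ∀ z : Fin n → ℝ, ∑ a, (A a ⬝ᵥ z) ^ 2 = ∑ a, (z a) ^ 2) (a a' : Fin n) :
    ∑ b, A a b * A a' b = if a = a' then 1 else 0 := by
  have h1 : ∀ b c, ∑ a, A a b * A a c = if b = c then 1 else 0 := by
    intro b c
    have e1 := hA (Pi.single b 1)
    have e2 := hA (Pi.single c 1)
    have e3 := hA (Pi.single b 1 + Pi.single c 1)
    simp only [dotProduct_add, dotProduct_single, mul_one] at e1 e2 e3
    have s : ∀ b : Fin n, ∑ a, (Pi.single (M := fun _ => ℝ) b 1 a) ^ 2 = 1 := by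
      intro b; simp [Pi.single_apply]
    rw [s] at e1 e2
    have e4 : ∑ a, ((Pi.single b 1 + Pi.single c 1 : Fin n → ℝ) a) ^ 2 = 2 + 2 * if b = c then 1 else 0 := by
      simp only [Pi.add_apply, add_sq, Finset.sum_add_distrib, s]
      have : ∑ x, 2 * Pi.single (M := fun _ => ℝ) b 1 x * Pi.single (M := fun _ => ℝ) c 1 x
          = 2 * if b = c then 1 else 0 := by
        simp [Pi.single_apply, eq_comm]
      rw [this]; ring
    rw [e4] at e3
    simp only [add_sq, Finset.sum_add_distrib, e1, e2] at e3
    have : ∑ x, 2 * A x b * A x c = 2 * ∑ x, A x b * A x c := by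
      rw [Finset.mul_sum]; exact Finset.sum_congr rfl fun _ _ => by ring
    rw [this] at e3
    linarith
  have h2 : (Matrix.of A).transpose * Matrix.of A = 1 := by
    ext b c
    simp only [Matrix.mul_apply, Matrix.transpose_apply, Matrix.of_apply, h1, Matrix.one_apply]
  have h3 := mul_eq_one_comm.1 h2
  have := congrFun (congrFun h3 a) a'
  simpa only [Matrix.mul_apply, Matrix.transpose_apply, Matrix.of_apply, Matrix.one_apply] using this

/-- rotation as a linear map -/
noncomputable def rotL (i j : Fin n) (θ : ℝ) : (Fin n → ℝ) →ₗ[ℝ] (Fin n → ℝ) where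
  toFun := kacRotate i j θ
  map_add' x y := by
    ext l; simp only [kacRotate, Pi.add_apply]; split_ifs <;> ring
  map_smul' c x := by
    ext l; simp only [kacRotate, Pi.smul_apply, smul_eq_mul, RingHom.id_apply]; split_ifs <;> ring

lemma rot_mp (i j : Fin n) (hij : i ≠ j) (θ : ℝ) :
    MeasurePreserving (kacRotate i j θ) (volume : Measure (Fin n → ℝ)) volume := by
  have hL : ∀ z, (rotL i j θ) z = kacRotate i j θ z := fun _ => rfl
  have hdet : (LinearMap.det (rotL i j θ)) * (LinearMap.det (rotL i j θ)) = 1 := by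
    have : (LinearMap.toMatrix' (rotL i j θ)) * (LinearMap.toMatrix' (rotL i j θ)).transpose = 1 := by
      have := iso_rows (LinearMap.toMatrix' (rotL i j θ)) (fun z => by
        have : ∀ a, (LinearMap.toMatrix' (rotL i j θ)) a ⬝ᵥ z = kacRotate i j θ z a := by
          intro a
          have := LinearMap.toMatrix'_mulVec (rotL i j θ) z
          rw [hL] at this
          rw [← this]; rfl
        simp_rw [this]
        exact rot_sq i j hij θ z)
      ext a a'
      rw [Matrix.mul_apply, Matrix.one_apply, ← this]; rfl
    have h := congrArg Matrix.det this
    rw [Matrix.det_mul, Matrix.det_transpose, Matrix.det_one, LinearMap.det_toMatrix'] at h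
    exact h
  have hd0 : LinearMap.det (rotL i j θ) ≠ 0 := by intro h; simp [h] at hdet
  have hm : Measurable (kacRotate i j θ) := (rotL i j θ).continuous_of_finiteDimensional.measurable
  refine ⟨hm, ?_⟩
  have := Real.map_linearMap_volume_pi_eq_smul_volume_pi hd0
  have habs : |(LinearMap.det (rotL i j θ))⁻¹| = 1 := by
    have h1 : |LinearMap.det (rotL i j θ)| = 1 := by
      have := abs_mul_abs_self (LinearMap.det (rotL i j θ))
      rw [hdet] at this
      nlinarith [abs_nonneg (LinearMap.det (rotL i j θ))]
    rw [abs_inv, h1, inv_one]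
  rw [habs] at this
  have h2 : Measure.map (⇑(rotL i j θ)) volume = volume := by simpa using this
  exact h2

/-- collision pairs -/
abbrev Pr (n : ℕ) := {p : Fin n × Fin n // p.1 < p.2}

/-- collision parameters -/
abbrev Th (n : ℕ) := Pr n × ℝ

/-- rotation -/
noncomputable def rot (ω : Th n) (z : Fin n → ℝ) : Fin n → ℝ := kacRotate ω.1.1.1 ω.1.1.2 ω.2 z

/-- inverse rotation -/
noncomputable def rot' (ω : Th n) (z : Fin n → ℝ) : Fin n → ℝ := kacRotate ω.1.1.1 ω.1.1.2 (-ω.2) z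

lemma krot_meas (i j : Fin n) : Measurable fun q : ℝ × (Fin n → ℝ) => kacRotate i j q.1 q.2 := by
  refine measurable_pi_lambda _ fun l => ?_
  unfold kacRotate
  split_ifs <;> fun_prop

lemma rot_meas : Measurable fun q : Th n × (Fin n → ℝ) => rot q.1 q.2 := by
  have : Measurable fun q : Pr n × (ℝ × (Fin n → ℝ)) => kacRotate q.1.1.1 q.1.1.2 q.2.1 q.2.2 :=
    measurable_from_prod_countable_right fun p => krot_meas p.1.1 p.1.2
  exact this.comp MeasurableEquiv.prodAssoc.measurable

lemma rot'_meas : Measurable fun q : Th n × (Fin n → ℝ) => rot' q.1 q.2 := by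
  have : Measurable fun q : Th n × (Fin n → ℝ) => (((q.1.1, -q.1.2) : Th n), q.2) := by fun_prop
  exact rot_meas.comp this

lemma rot_rot' (ω : Th n) (z : Fin n → ℝ) : rot' ω (rot ω z) = z := rot_inv _ _ ω.1.2.ne _ _

end rot
open MeasureTheory Real

section kap
variable {n : ℕ}

/-- angle measure -/
noncomputable def ang (ρ : ℝ → ℝ) : Measure ℝ :=
  (volume.restrict (Set.Ioc (-π) π)).withDensity fun θ => ENNReal.ofReal (ρ θ)

/-- hypotheses on ρ -/
structure Rho (ρ : ℝ → ℝ) : Prop where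
  nonneg : ∀ θ, 0 ≤ ρ θ
  meas : Measurable ρ
  one : ∫ θ in (-π)..π, ρ θ = 1

variable {ρ : ℝ → ℝ}

lemma ang_integral (hρ : Rho ρ) (g : ℝ → ℝ) : ∫ θ, g θ ∂(ang ρ) = ∫ θ in (-π)..π, ρ θ * g θ := by
  unfold ang
  rw [intervalIntegral.integral_of_le (by linarith [pi_pos]),
    integral_withDensity_eq_integral_toReal_smul (by exact hρ.meas.ennreal_ofReal) (by simp)]
  exact integral_congr_ae (Filter.Eventually.of_forall fun θ => by
    simp [ENNReal.toReal_ofReal (hρ.nonneg θ)])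

lemma ang_prob (hρ : Rho ρ) : IsProbabilityMeasure (ang ρ) := by
  have h1 := hρ.one
  rw [intervalIntegral.integral_of_le (by linarith [pi_pos])] at h1
  have hi : Integrable ρ (volume.restrict (Set.Ioc (-π) π)) := by
    by_contra h
    rw [integral_undef h] at h1
    exact zero_ne_one h1
  constructor
  unfold ang
  rw [withDensity_apply _ MeasurableSet.univ, Measure.restrict_univ,
    ← ofReal_integral_eq_lintegral_ofReal hi (Filter.Eventually.of_forall hρ.nonneg), h1]
  simp

/-- collision measure -/
noncomputable def kap (n : ℕ) (ρ : ℝ → ℝ) : Measure (Th n) :=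
  ENNReal.ofReal (2 / ((n : ℝ) * ((n : ℝ) - 1))) • ∑ p : Pr n, (ang ρ).map (fun θ => (p, θ))

lemma card_Pr : 2 * (Fintype.card (Pr n) : ℝ) = (n : ℝ) * ((n : ℝ) - 1) := by
  have h1 : ∑ i : Fin n, ∑ j : Fin n, (1:ℝ) = ∑ i : Fin n, ∑ j : Fin n,
      ((if i < j then 1 else 0) + (if j < i then 1 else 0) + if i = j then (1:ℝ) else 0) := by
    refine Finset.sum_congr rfl fun i _ => Finset.sum_congr rfl fun j _ => ?_
    rcases lt_trichotomy i j with h | h | h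
    · simp [h, h.not_gt, h.ne]
    · simp [h]
    · simp [h, h.not_gt, h.ne']
  simp only [Finset.sum_add_distrib] at h1
  have h2 : ∑ i : Fin n, ∑ j : Fin n, (if j < i then (1:ℝ) else 0) = ∑ i : Fin n, ∑ j : Fin n, (if i < j then (1:ℝ) else 0) :=
    Finset.sum_comm
  have h3 : ∑ i : Fin n, ∑ j : Fin n, (if i < j then (1:ℝ) else 0) = Fintype.card (Pr n) := by
    rw [Fintype.card_subtype, ← Finset.sum_product' (f := fun i j => if i < j then (1:ℝ) else 0)]
    simp
  rw [h2, h3] at h1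
  simp at h1
  linarith

lemma kap_prob (hn : 2 ≤ n) (hρ : Rho ρ) : IsProbabilityMeasure (kap n ρ) := by
  have := ang_prob hρ
  have hn' : (2:ℝ) ≤ n := by exact_mod_cast hn
  have hmp : ∀ p : Pr n, Measurable (fun θ : ℝ => ((p, θ) : Th n)) := fun p => by fun_prop
  constructor
  unfold kap
  simp only [Measure.smul_apply, Measure.finsetSum_apply, smul_eq_mul]
  have : ∀ p : Pr n, (Measure.map (fun θ : ℝ => ((p, θ) : Th n)) (ang ρ)) Set.univ = 1 := by
    intro p; rw [Measure.map_apply (hmp p) MeasurableSet.univ]; simp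
  simp only [this]
  simp only [Finset.sum_const, Finset.card_univ, nsmul_eq_mul, mul_one]
  rw [← ENNReal.ofReal_natCast, ← ENNReal.ofReal_mul (by apply div_nonneg <;> nlinarith)]
  rw [← card_Pr, ← ENNReal.ofReal_one]
  congr 1
  have : 2 * (Fintype.card (Pr n) : ℝ) ≠ 0 := by rw [card_Pr]; nlinarith
  have h3 : (Fintype.card (Pr n) : ℝ) ≠ 0 := fun h => this (by rw [h, mul_zero])
  rw [div_mul_eq_mul_div, div_self this]

lemma kap_integrable (hn : 2 ≤ n) {g : Th n → ℝ} (hg : Integrable g (kap n ρ)) (p : Pr n) :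
    Integrable (fun θ => g (p, θ)) (ang ρ) := by
  have hn' : (2:ℝ) ≤ n := by exact_mod_cast hn
  have hc : ENNReal.ofReal (2 / ((n : ℝ) * ((n : ℝ) - 1))) ≠ 0 := by
    simp only [ne_eq, ENNReal.ofReal_eq_zero, not_le]
    apply div_pos <;> nlinarith
  unfold kap at hg
  rw [integrable_smul_measure hc ENNReal.ofReal_ne_top] at hg
  have hg2 := integrable_finsetSum_measure.1 hg p (Finset.mem_univ _)
  exact hg2.comp_measurable (by fun_prop)

lemma kap_integral (hn : 2 ≤ n) (hρ : Rho ρ) {g : Th n → ℝ} (hg : Integrable g (kap n ρ)) :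
    ∫ ω, g ω ∂(kap n ρ) = (2 / ((n : ℝ) * ((n : ℝ) - 1))) *
      ∑ p : Pr n, ∫ θ in (-π)..π, ρ θ * g (p, θ) := by
  have hn' : (2:ℝ) ≤ n := by exact_mod_cast hn
  have hc0 : 0 < (2 / ((n : ℝ) * ((n : ℝ) - 1))) := by apply div_pos <;> nlinarith
  have hc : ENNReal.ofReal (2 / ((n : ℝ) * ((n : ℝ) - 1))) ≠ 0 := by
    simp only [ne_eq, ENNReal.ofReal_eq_zero, not_le]
    exact hc0
  unfold kap at hg ⊢
  rw [integrable_smul_measure hc ENNReal.ofReal_ne_top] at hg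
  have hg2 := integrable_finsetSum_measure.1 hg
  rw [integral_smul_measure, integral_finsetSum_measure hg2, ENNReal.toReal_ofReal hc0.le, smul_eq_mul]
  congr 1
  refine Finset.sum_congr rfl fun p _ => ?_
  rw [integral_map (by fun_prop) (hg2 p (Finset.mem_univ _)).aestronglyMeasurable, ang_integral hρ]

lemma kacQ_eq (F : (Fin n → ℝ) → ℝ) (z : Fin n → ℝ) : kacQ ρ F z = (2 / ((n : ℝ) * ((n : ℝ) - 1))) *
      ∑ p : Pr n, ∫ θ in (-π)..π, ρ θ * F (rot (p, θ) z) := by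
  unfold kacQ
  congr 1
  rw [Finset.sum_subtype (p := fun p : Fin n × Fin n => p.1 < p.2) _ (by simp)]
  rfl

lemma kacQ_nonneg (hn : 2 ≤ n) (hρ : Rho ρ) {F : (Fin n → ℝ) → ℝ} (hF : ∀ z, 0 ≤ F z) (z : Fin n → ℝ) :
    0 ≤ kacQ ρ F z := by
  have hn' : (2:ℝ) ≤ n := by exact_mod_cast hn
  have hc0 : 0 < (2 / ((n : ℝ) * ((n : ℝ) - 1))) := by apply div_pos <;> nlinarith
  rw [kacQ_eq]
  refine mul_nonneg hc0.le (Finset.sum_nonneg fun p _ => ?_)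
  exact intervalIntegral.integral_nonneg (by linarith [pi_pos]) fun θ _ => mul_nonneg (hρ.nonneg _) (hF _)

lemma kacQ_meas (hρ : Rho ρ) {F : (Fin n → ℝ) → ℝ} (hF : Measurable F) : Measurable (kacQ ρ F) := by
  have : kacQ ρ F = fun z => (2 / ((n : ℝ) * ((n : ℝ) - 1))) *
      ∑ p : Pr n, ∫ θ, F (rot (p, θ) z) ∂ang ρ := by
    ext z; rw [kacQ_eq]; simp_rw [ang_integral hρ]
  rw [this]
  refine Measurable.const_mul (Finset.measurable_sum _ fun p _ => ?_) _
  have := ang_prob hρ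
  have hm : Measurable fun q : (Fin n → ℝ) × ℝ => F (rot (p, q.2) q.1) := by
    have h2 : Measurable fun q : (Fin n → ℝ) × ℝ => (((p, q.2) : Th n), q.1) := by fun_prop
    exact hF.comp (rot_meas.comp h2)
  exact (hm.stronglyMeasurable.integral_prod_right').measurable

lemma skew_mp (hn : 2 ≤ n) (hρ : Rho ρ) : MeasurePreserving (fun q : Th n × (Fin n → ℝ) => (q.1, rot q.1 q.2))
    ((kap n ρ).prod volume) ((kap n ρ).prod volume) := by
  have := kap_prob hn hρ
  exact (MeasurePreserving.id _).skew_product rot_meas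
    (Filter.Eventually.of_forall fun ω => (rot_mp _ _ ω.1.2.ne _).map_eq)

lemma F_rot_int (hn : 2 ≤ n) (hρ : Rho ρ) {F : (Fin n → ℝ) → ℝ} (hF : Integrable F) :
    Integrable (fun q : Th n × (Fin n → ℝ) => F (rot q.1 q.2)) ((kap n ρ).prod volume) := by
  have := kap_prob hn hρ
  have h : Integrable (fun q : Th n × (Fin n → ℝ) => F q.2) ((kap n ρ).prod volume) := hF.comp_snd _
  exact (skew_mp hn hρ).integrable_comp_of_integrable h

lemma kacQ_ae (hn : 2 ≤ n) (hρ : Rho ρ) {F : (Fin n → ℝ) → ℝ} (hF : Integrable F) :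
    kacQ ρ F =ᵐ[volume] fun z => ∫ ω, F (rot ω z) ∂kap n ρ := by
  have := kap_prob hn hρ
  filter_upwards [(F_rot_int hn hρ hF).prod_left_ae] with z hz
  rw [kacQ_eq, kap_integral hn hρ hz]

lemma kacQ_int (hn : 2 ≤ n) (hρ : Rho ρ) {F : (Fin n → ℝ) → ℝ} (hF : Integrable F) :
    Integrable (kacQ ρ F) := by
  have := kap_prob hn hρ
  exact (F_rot_int hn hρ hF).integral_prod_right.congr (kacQ_ae hn hρ hF).symm

/-- dual operator -/
noncomputable def Qs (ρ : ℝ → ℝ) (Φ : (Fin n → ℝ) → ℝ) : (Fin n → ℝ) → ℝ :=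
  fun z => ∫ ω, Φ (rot' ω z) ∂kap n ρ

lemma Qs_meas (hn : 2 ≤ n) (hρ : Rho ρ) {Φ : (Fin n → ℝ) → ℝ} (hΦ : Measurable Φ) : Measurable (Qs ρ Φ) := by
  have := kap_prob hn hρ
  have hm : Measurable fun q : Th n × (Fin n → ℝ) => Φ (rot' q.1 q.2) := hΦ.comp rot'_meas
  exact (hm.stronglyMeasurable.integral_prod_left').measurable

lemma Qs_le (hn : 2 ≤ n) (hρ : Rho ρ) {Φ : (Fin n → ℝ) → ℝ} {K : ℝ} (hΦ : ∀ z, |Φ z| ≤ K) (z) : |Qs ρ Φ z| ≤ K := by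
  have := kap_prob hn hρ
  have := norm_integral_le_of_norm_le_const (μ := kap n ρ) (f := fun ω => Φ (rot' ω z)) (C := K)
    (Filter.Eventually.of_forall fun ω => hΦ _)
  rw [probReal_univ, mul_one] at this
  exact this

lemma dual_Q (hn : 2 ≤ n) (hρ : Rho ρ) {F : (Fin n → ℝ) → ℝ} (hF : Integrable F) {Φ : (Fin n → ℝ) → ℝ}
    (hΦ : Measurable Φ) {K : ℝ} (hK : ∀ z, |Φ z| ≤ K) :
    ∫ z, kacQ ρ F z * Φ z = ∫ z, F z * Qs ρ Φ z := by
  have := kap_prob hn hρ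
  have h1 : ∫ z, kacQ ρ F z * Φ z = ∫ z, ∫ ω, F (rot ω z) * Φ z ∂kap n ρ := by
    refine integral_congr_ae ?_
    filter_upwards [kacQ_ae hn hρ hF] with z hz
    rw [hz, integral_mul_const]
  have i1 : Integrable (fun q : Th n × (Fin n → ℝ) => F (rot q.1 q.2) * Φ q.2) ((kap n ρ).prod volume) :=
    (F_rot_int hn hρ hF).mul_bdd (c := K) (hΦ.comp measurable_snd).aestronglyMeasurable
      (Filter.Eventually.of_forall fun q => hK _)
  have i2 : Integrable (fun q : Th n × (Fin n → ℝ) => F q.2 * Φ (rot' q.1 q.2)) ((kap n ρ).prod volume) :=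
    (hF.comp_snd _).mul_bdd (c := K) (hΦ.comp rot'_meas).aestronglyMeasurable
      (Filter.Eventually.of_forall fun q => hK _)
  have h2 : ∫ z, F z * Qs ρ Φ z = ∫ z, ∫ ω, F z * Φ (rot' ω z) ∂kap n ρ := by
    simp_rw [integral_const_mul]; rfl
  rw [h1, h2, ← integral_prod_symm _ i1, ← integral_prod_symm _ i2]
  have e := (skew_mp hn hρ).map_eq
  rw [← e] at i2
  conv_rhs => rw [← e]
  rw [integral_map (skew_mp hn hρ).aemeasurable i2.aestronglyMeasurable]
  simp_rw [rot_rot']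

end kap
open MeasureTheory Real

section evol
variable {n : ℕ} {ρ : ℝ → ℝ}

lemma iter_int (hn : 2 ≤ n) (hρ : Rho ρ) {F : (Fin n → ℝ) → ℝ} (hF : Integrable F) (k : ℕ) :
    Integrable ((kacQ ρ (n := n))^[k] F) := by
  induction k with
  | zero => exact hF
  | succ k ih => rw [Function.iterate_succ_apply']; exact kacQ_int hn hρ ih

lemma iter_nonneg (hn : 2 ≤ n) (hρ : Rho ρ) {F : (Fin n → ℝ) → ℝ} (hF : ∀ z, 0 ≤ F z) (k : ℕ) :
    ∀ z, 0 ≤ (kacQ ρ (n := n))^[k] F z := by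
  induction k with
  | zero => exact hF
  | succ k ih => rw [Function.iterate_succ_apply']; exact kacQ_nonneg hn hρ ih

lemma Qs_iter_meas (hn : 2 ≤ n) (hρ : Rho ρ) {Φ : (Fin n → ℝ) → ℝ} (hΦ : Measurable Φ) (k : ℕ) :
    Measurable ((Qs ρ (n := n))^[k] Φ) := by
  induction k with
  | zero => exact hΦ
  | succ k ih => rw [Function.iterate_succ_apply']; exact Qs_meas hn hρ ih

lemma Qs_iter_le (hn : 2 ≤ n) (hρ : Rho ρ) {Φ : (Fin n → ℝ) → ℝ} {K : ℝ} (hK : ∀ z, |Φ z| ≤ K) (k : ℕ) :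
    ∀ z, |(Qs ρ (n := n))^[k] Φ z| ≤ K := by
  induction k with
  | zero => exact hK
  | succ k ih => rw [Function.iterate_succ_apply']; exact Qs_le hn hρ ih

lemma dual_iter (hn : 2 ≤ n) (hρ : Rho ρ) {F : (Fin n → ℝ) → ℝ} (hF : Integrable F) {Φ : (Fin n → ℝ) → ℝ}
    (hΦ : Measurable Φ) {K : ℝ} (hK : ∀ z, |Φ z| ≤ K) (k : ℕ) :
    ∫ z, (kacQ ρ (n := n))^[k] F z * Φ z = ∫ z, F z * (Qs ρ (n := n))^[k] Φ z := by
  induction k generalizing F with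
  | zero => rfl
  | succ k ih =>
    rw [Function.iterate_succ_apply, ih (kacQ_int hn hρ hF),
      dual_Q hn hρ hF (Qs_iter_meas hn hρ hΦ k) (Qs_iter_le hn hρ hK k), Function.iterate_succ_apply']

lemma Qs_one (hn : 2 ≤ n) (hρ : Rho ρ) (k : ℕ) : (Qs ρ (n := n))^[k] (fun _ => 1) = fun _ => 1 := by
  have := kap_prob hn hρ
  induction k with
  | zero => rfl
  | succ k ih => rw [Function.iterate_succ_apply', ih]; ext z; simp [Qs]

lemma iter_mass (hn : 2 ≤ n) (hρ : Rho ρ) {F : (Fin n → ℝ) → ℝ} (hF : Integrable F) (k : ℕ) :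
    ∫ z, (kacQ ρ (n := n))^[k] F z = ∫ z, F z := by
  have := dual_iter hn hρ hF (Φ := fun _ => 1) measurable_const (K := 1) (by simp) k
  rw [Qs_one hn hρ] at this
  simpa using this

/-- Poisson weights -/
noncomputable def poi (s : ℝ) (k : ℕ) : ℝ := Real.exp (-s) * (s ^ k / (k.factorial : ℝ))

lemma poi_nonneg {s : ℝ} (hs : 0 ≤ s) (k : ℕ) : 0 ≤ poi s k := by unfold poi; positivity

lemma poi_hasSum (s l : ℝ) : HasSum (fun k => poi s k * l ^ k) (Real.exp (-s + s * l)) := by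
  have := (NormedSpace.expSeries_div_hasSum_exp (𝔸 := ℝ) (s * l)).mul_left (Real.exp (-s))
  rw [← Real.exp_eq_exp_ℝ, ← Real.exp_add] at this
  have e : (fun k => poi s k * l ^ k) = fun k => Real.exp (-s) * ((s * l) ^ k / (k.factorial : ℝ)) := by
    ext k; unfold poi; rw [mul_pow]; ring
  rw [e]; exact this

lemma poi_one (s : ℝ) : HasSum (poi s) 1 := by
  have := poi_hasSum s 1
  simpa using this

lemma evol_eq (t : ℝ) (F : (Fin n → ℝ) → ℝ) (z) :
    kacEvol ρ t F z = ∑' k, poi (n * t) k * (kacQ ρ (n := n))^[k] F z := by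
  unfold kacEvol poi
  rw [← tsum_mul_left]
  simp only [neg_mul, mul_assoc]

lemma evol_nonneg (hn : 2 ≤ n) (hρ : Rho ρ) {t : ℝ} (ht : 0 ≤ t) {F : (Fin n → ℝ) → ℝ} (hF : ∀ z, 0 ≤ F z) (z) :
    0 ≤ kacEvol ρ t F z := by
  rw [evol_eq]
  exact tsum_nonneg fun k => mul_nonneg (poi_nonneg (by positivity) k) (iter_nonneg hn hρ hF k z)

lemma evol_dual (hn : 2 ≤ n) (hρ : Rho ρ) {t : ℝ} (ht : 0 ≤ t) {F : (Fin n → ℝ) → ℝ} (hF0 : ∀ z, 0 ≤ F z)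
    (hF : Integrable F) {Φ : (Fin n → ℝ) → ℝ}
    (hΦ : Measurable Φ) {K : ℝ} (hK : ∀ z, |Φ z| ≤ K) :
    HasSum (fun k => poi (n * t) k * ∫ z, F z * (Qs ρ (n := n))^[k] Φ z)
      (∫ z, kacEvol ρ t F z * Φ z) := by
  have hs : 0 ≤ n * t := by positivity
  have hintg : ∀ k, Integrable fun z => (poi (n * t) k * (kacQ ρ (n := n))^[k] F z) * Φ z := fun k =>
    ((iter_int hn hρ hF k).const_mul _).mul_bdd (c := K) hΦ.aestronglyMeasurable
      (Filter.Eventually.of_forall hK)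
  have key := hasSum_integral_of_summable_integral_norm hintg (by
    refine Summable.of_nonneg_of_le (f := fun k => poi (n * t) k * (K * ∫ z, F z))
      (fun k => integral_nonneg fun z => norm_nonneg _) (fun k => ?_) ((poi_one _).summable.mul_right _)
    calc _ ≤ ∫ z, poi (n * t) k * (K * (kacQ ρ (n := n))^[k] F z) := by
            refine integral_mono (hintg k).norm (((iter_int hn hρ hF k).const_mul _).const_mul _) fun z => ?_
            have h1 := iter_nonneg hn hρ hF0 k z
            have h2 := poi_nonneg hs k
            simp only [Real.norm_eq_abs, abs_mul, abs_of_nonneg h1, abs_of_nonneg h2]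
            have := mul_le_mul_of_nonneg_left (hK z) (mul_nonneg h2 h1)
            linarith
      _ = _ := by rw [integral_const_mul, integral_const_mul, iter_mass hn hρ hF])
  have e1 : (fun k => ∫ z, (poi (n * t) k * (kacQ ρ (n := n))^[k] F z) * Φ z)
      = fun k => poi (n * t) k * ∫ z, F z * (Qs ρ (n := n))^[k] Φ z := by
    ext k
    simp_rw [mul_assoc]
    rw [integral_const_mul, dual_iter hn hρ hF hΦ hK]
  rw [e1] at key
  have e2 : (∫ z, kacEvol ρ t F z * Φ z) = ∫ z, ∑' k, (poi (n * t) k * (kacQ ρ (n := n))^[k] F z) * Φ z := by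
    simp_rw [evol_eq, tsum_mul_right]
  rw [e2]
  exact key

lemma evol_mass (hn : 2 ≤ n) (hρ : Rho ρ) {t : ℝ} (ht : 0 ≤ t) {F : (Fin n → ℝ) → ℝ} (hF0 : ∀ z, 0 ≤ F z)
    (hF : Integrable F) : ∫ z, kacEvol ρ t F z = ∫ z, F z := by
  have := evol_dual hn hρ ht hF0 hF (Φ := fun _ => 1) measurable_const (K := 1) (by simp)
  simp only [Qs_one hn hρ, mul_one] at this
  have h2 := (poi_one (n * t)).mul_right (∫ z, F z)
  rw [one_mul] at h2
  exact this.unique h2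

lemma evol_int (hn : 2 ≤ n) (hρ : Rho ρ) {t : ℝ} (ht : 0 ≤ t) {F : (Fin n → ℝ) → ℝ} (hF0 : ∀ z, 0 ≤ F z)
    (hF : Integrable F) (h1 : ∫ z, F z = 1) : Integrable (kacEvol ρ t F) := by
  by_contra h
  have := evol_mass hn hρ ht hF0 hF
  rw [integral_undef h, h1] at this
  exact zero_ne_one this

end evol
open MeasureTheory Real

/-- orthogonal matrices -/
abbrev OM (n : ℕ) := {A : Fin n → Fin n → ℝ // ∀ z : Fin n → ℝ, ∑ a, (A a ⬝ᵥ z) ^ 2 = ∑ a, (z a) ^ 2}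

section om
variable {n : ℕ} {ρ : ℝ → ℝ}

/-- matrix action -/
def act (A : OM n) (z : Fin n → ℝ) : Fin n → ℝ := fun a => A.1 a ⬝ᵥ z

lemma act_meas : Measurable fun q : OM n × (Fin n → ℝ) => act q.1 q.2 := by
  unfold act dotProduct
  refine measurable_pi_lambda _ fun a => Finset.measurable_sum _ fun b _ => ?_
  have : Measurable fun q : OM n × (Fin n → ℝ) => q.1.1 := measurable_subtype_coe.comp measurable_fst
  have h2 : Measurable fun q : OM n × (Fin n → ℝ) => q.1.1 a b :=
    (measurable_pi_apply b).comp ((measurable_pi_apply a).comp this)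
  have h3 : Measurable fun q : OM n × (Fin n → ℝ) => q.2 b := (measurable_pi_apply b).comp measurable_snd
  exact h2.mul h3

lemma rot'_dot (ω : Th n) (A : Fin n → Fin n → ℝ) (z : Fin n → ℝ) (a : Fin n) :
    (fun b => rot' ω (fun a' => A a' b) a) ⬝ᵥ z = rot' ω (fun a' => A a' ⬝ᵥ z) a := by
  unfold rot' kacRotate dotProduct
  split_ifs
  · rw [Finset.mul_sum, Finset.mul_sum, ← Finset.sum_sub_distrib]
    exact Finset.sum_congr rfl fun b _ => by ring
  · rw [Finset.mul_sum, Finset.mul_sum, ← Finset.sum_add_distrib]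
    exact Finset.sum_congr rfl fun b _ => by ring
  · rfl

/-- one collision -/
noncomputable def stp (q : OM n × Th n) : OM n :=
  ⟨fun a b => rot' q.2 (fun a' => q.1.1 a' b) a, fun z => by
    simp_rw [rot'_dot]
    unfold rot'
    rw [rot_sq _ _ q.2.1.2.ne]
    exact q.1.2 z⟩

lemma stp_act (q : OM n × Th n) (z : Fin n → ℝ) : act (stp q) z = rot' q.2 (act q.1 z) := by
  ext a; exact rot'_dot _ _ _ _

lemma stp_meas : Measurable (stp (n := n)) := by
  refine Measurable.subtype_mk (measurable_pi_lambda _ fun a => measurable_pi_lambda _ fun b => ?_)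
  have h1 : Measurable fun q : OM n × Th n => (q.2, fun a' => q.1.1 a' b) := by
    refine measurable_snd.prodMk (measurable_pi_lambda _ fun a' => ?_)
    exact (measurable_pi_apply b).comp ((measurable_pi_apply a').comp (measurable_subtype_coe.comp measurable_fst))
  exact (measurable_pi_apply a).comp (rot'_meas.comp h1)

/-- identity matrix -/
noncomputable def om1 : OM n := ⟨fun a b => if a = b then 1 else 0, fun z => by simp [dotProduct]⟩

lemma om1_act (z : Fin n → ℝ) : act om1 z = z := by ext a; simp [act, om1, dotProduct]

/-- law after k collisions -/
noncomputable def nuk (n : ℕ) (ρ : ℝ → ℝ) : ℕ → Measure (OM n)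
  | 0 => Measure.dirac om1
  | k + 1 => ((nuk n ρ k).prod (kap n ρ)).map stp

lemma nuk_prob (hn : 2 ≤ n) (hρ : Rho ρ) (k : ℕ) : IsProbabilityMeasure (nuk n ρ k) := by
  have := kap_prob hn hρ
  induction k with
  | zero => unfold nuk; infer_instance
  | succ k ih => unfold nuk; exact Measure.isProbabilityMeasure_map stp_meas.aemeasurable

lemma nuk_succ (hn : 2 ≤ n) (hρ : Rho ρ) (k : ℕ) {g : OM n → ℝ} (hg : Measurable g) (hb : Bd g) :
    ∫ A, g A ∂nuk n ρ (k + 1) = ∫ A, ∫ ω, g (stp (A, ω)) ∂kap n ρ ∂nuk n ρ k := by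
  have := kap_prob hn hρ
  have := nuk_prob hn hρ k
  have e : nuk n ρ (k + 1) = ((nuk n ρ k).prod (kap n ρ)).map stp := rfl
  rw [e, integral_map stp_meas.aemeasurable hg.aestronglyMeasurable, integral_prod]
  exact (hb.comp stp).integrable (hg.comp stp_meas)

lemma act_meas' (z : Fin n → ℝ) : Measurable fun A : OM n => act A z :=
  act_meas.comp (measurable_id.prodMk measurable_const)

lemma Qs_nuk (hn : 2 ≤ n) (hρ : Rho ρ) (k : ℕ) {Φ : (Fin n → ℝ) → ℝ} (hΦ : Measurable Φ) (hb : Bd Φ)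
    (z : Fin n → ℝ) : (Qs ρ (n := n))^[k] Φ z = ∫ A, Φ (act A z) ∂nuk n ρ k := by
  induction k generalizing Φ with
  | zero => simp only [nuk, Function.iterate_zero, id]; rw [integral_dirac' (fun A : OM n => Φ (act A z)) _ (hΦ.comp (act_meas' z)).stronglyMeasurable, om1_act]
  | succ k ih =>
    have hb' : Bd (Qs ρ Φ) := by obtain ⟨K, hK⟩ := hb; exact ⟨K, Qs_le hn hρ hK⟩
    rw [Function.iterate_succ_apply, ih (Qs_meas hn hρ hΦ) hb',
      nuk_succ hn hρ k (g := fun A => Φ (act A z)) (hΦ.comp (act_meas' z)) (hb.comp _)]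
    simp_rw [stp_act]; rfl

/-- Poisson mixture -/
noncomputable def nu (n : ℕ) (ρ : ℝ → ℝ) (t : ℝ) : Measure (OM n) :=
  Measure.sum fun k => ENNReal.ofReal (poi (n * t) k) • nuk n ρ k

lemma nu_prob (hn : 2 ≤ n) (hρ : Rho ρ) {t : ℝ} (ht : 0 ≤ t) : IsProbabilityMeasure (nu n ρ t) := by
  constructor
  unfold nu
  rw [Measure.sum_apply _ MeasurableSet.univ]
  have : ∀ k, (ENNReal.ofReal (poi (n * t) k) • nuk n ρ k) Set.univ = ENNReal.ofReal (poi (n * t) k) := by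
    intro k
    have := nuk_prob hn hρ k
    simp
  simp_rw [this]
  have hs : 0 ≤ n * t := by positivity
  rw [← ENNReal.ofReal_tsum_of_nonneg (poi_nonneg hs) (poi_one _).summable, (poi_one _).tsum_eq,
    ENNReal.ofReal_one]

lemma nu_hasSum (hn : 2 ≤ n) (hρ : Rho ρ) {t : ℝ} (ht : 0 ≤ t) {g : OM n → ℝ} (hg : Measurable g) (hb : Bd g) :
    HasSum (fun k => poi (n * t) k * ∫ A, g A ∂nuk n ρ k) (∫ A, g A ∂nu n ρ t) := by
  have := nu_prob hn hρ ht
  have h : Integrable g (nu n ρ t) := hb.integrable hg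
  have h2 := hasSum_integral_measure (μ := fun k => ENNReal.ofReal (poi (n * t) k) • nuk n ρ k) h
  have hs : 0 ≤ n * t := by positivity
  simp_rw [integral_smul_measure, ENNReal.toReal_ofReal (poi_nonneg hs _)] at h2
  exact h2

lemma evol_nu (hn : 2 ≤ n) (hρ : Rho ρ) {t : ℝ} (ht : 0 ≤ t) {F : (Fin n → ℝ) → ℝ} (hF0 : ∀ z, 0 ≤ F z)
    (hF : Integrable F) {Φ : (Fin n → ℝ) → ℝ} (hΦ : Measurable Φ) (hb : Bd Φ) :
    ∫ z, kacEvol ρ t F z * Φ z = ∫ z, F z * ∫ A, Φ (act A z) ∂nu n ρ t := by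
  obtain ⟨K, hK⟩ := id hb
  have hs : 0 ≤ n * t := by positivity
  have h1 := evol_dual hn hρ ht hF0 hF hΦ hK
  have hintg : ∀ k, Integrable fun z => F z * (poi (n * t) k * (Qs ρ (n := n))^[k] Φ z) := fun k =>
    hF.mul_bdd (c := poi (n * t) k * K) ((Qs_iter_meas hn hρ hΦ k).const_mul _).aestronglyMeasurable
      (Filter.Eventually.of_forall fun z => by
        rw [Real.norm_eq_abs, abs_mul, abs_of_nonneg (poi_nonneg hs k)]
        exact mul_le_mul_of_nonneg_left (Qs_iter_le hn hρ hK k z) (poi_nonneg hs k))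
  have key := hasSum_integral_of_summable_integral_norm hintg (by
    refine Summable.of_nonneg_of_le (f := fun k => poi (n * t) k * (K * ∫ z, F z))
      (fun k => integral_nonneg fun z => norm_nonneg _) (fun k => ?_) ((poi_one _).summable.mul_right _)
    calc _ ≤ ∫ z, poi (n * t) k * (K * F z) := by
            refine integral_mono (hintg k).norm ((hF.const_mul _).const_mul _) fun z => ?_
            have h1 := hF0 z
            have h2 := poi_nonneg hs k
            simp only [Real.norm_eq_abs, abs_mul, abs_of_nonneg h1, abs_of_nonneg h2]
            have := mul_le_mul_of_nonneg_left (Qs_iter_le hn hρ hK k z) (mul_nonneg h2 h1)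
            linarith
      _ = _ := by rw [integral_const_mul, integral_const_mul])
  have e1 : (fun k => ∫ z, F z * (poi (n * t) k * (Qs ρ (n := n))^[k] Φ z))
      = fun k => poi (n * t) k * ∫ z, F z * (Qs ρ (n := n))^[k] Φ z := by
    ext k
    rw [← integral_const_mul]
    exact integral_congr_ae (Filter.Eventually.of_forall fun z => by ring)
  rw [e1] at key
  rw [h1.unique key]
  refine integral_congr_ae (Filter.Eventually.of_forall fun z => ?_)
  simp only
  rw [tsum_mul_left]
  congr 1
  simp_rw [Qs_nuk hn hρ _ hΦ hb]
  exact (nu_hasSum hn hρ ht (g := fun A => Φ (act A z)) (hΦ.comp (act_meas' z)) (hb.comp _)).tsum_eq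

/-! quadratic form -/

lemma sum_Pr (h : Fin n → Fin n → ℝ) (hs : ∀ i j, h i j = h j i) (h0 : ∀ i, h i i = 0) :
    2 * ∑ p : Pr n, h p.1.1 p.1.2 = ∑ i, ∑ j, h i j := by
  have h1 : ∑ i : Fin n, ∑ j : Fin n, h i j = ∑ i : Fin n, ∑ j : Fin n,
      ((if i < j then h i j else 0) + (if j < i then h j i else 0)) := by
    refine Finset.sum_congr rfl fun i _ => Finset.sum_congr rfl fun j _ => ?_
    rcases lt_trichotomy i j with h' | h' | h'
    · simp [h', h'.not_gt]
    · simp [h', h0]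
    · simp [h', h'.not_gt, hs i j]
  simp only [Finset.sum_add_distrib] at h1
  have h2 : ∑ i : Fin n, ∑ j : Fin n, (if j < i then h j i else 0) = ∑ i : Fin n, ∑ j : Fin n, (if i < j then h i j else 0) :=
    Finset.sum_comm
  have h3 : ∑ i : Fin n, ∑ j : Fin n, (if i < j then h i j else 0) = ∑ p : Pr n, h p.1.1 p.1.2 := by
    rw [← Finset.sum_product' (f := fun i j => if i < j then h i j else 0)]
    rw [← Finset.sum_filter, Finset.sum_subtype (p := fun p : Fin n × Fin n => p.1 < p.2) _ (by simp)]
  rw [h1, h2, h3]; ring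

/-- diagonal quadratic form -/
def qf (x z : Fin n → ℝ) : ℝ := ∑ l, x l * z l ^ 2

lemma qf_abs (x z : Fin n → ℝ) : |qf x z| ≤ (∑ l, |x l|) * ∑ l, z l ^ 2 := by
  unfold qf
  refine (Finset.abs_sum_le_sum_abs _ _).trans ?_
  rw [Finset.sum_mul]
  refine Finset.sum_le_sum fun l _ => ?_
  rw [abs_mul, abs_of_nonneg (sq_nonneg (z l))]
  exact mul_le_mul_of_nonneg_left
    (Finset.single_le_sum (f := fun l => z l ^ 2) (fun i _ => sq_nonneg _) (Finset.mem_univ l)) (abs_nonneg _)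

lemma qf_meas (x : Fin n → ℝ) : Measurable (qf x) := by unfold qf; fun_prop

lemma rho_int (hρ : Rho ρ) {g : ℝ → ℝ} (hg : Measurable g) (hb : Bd g) :
    IntervalIntegrable (fun θ => ρ θ * g θ) volume (-π) π := by
  have h1 := hρ.one
  have hi : IntervalIntegrable ρ volume (-π) π := by
    by_contra h
    rw [intervalIntegral.integral_undef h] at h1
    exact zero_ne_one h1
  obtain ⟨K, hK⟩ := hb
  rw [intervalIntegrable_iff] at hi ⊢
  exact Integrable.mul_bdd (c := K) hi hg.aestronglyMeasurable (Filter.Eventually.of_forall hK)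

lemma qf_pair (hρ : Rho ρ) (hcond : ∫ θ in (-π)..π, ρ θ * Real.sin θ * Real.cos θ = 0) (x z : Fin n → ℝ)
    (p : Pr n) : ∫ θ in (-π)..π, ρ θ * qf x (rot' (p, θ) z) =
      qf x z + (∫ θ in (-π)..π, ρ θ * Real.sin θ ^ 2) * ((x p.1.1 - x p.1.2) * (z p.1.2 ^ 2 - z p.1.1 ^ 2)) := by
  obtain ⟨⟨i, j⟩, hij⟩ := p
  have hij' : i ≠ j := ne_of_lt hij
  have e : ∀ θ, ρ θ * qf x (rot' (⟨⟨i, j⟩, hij⟩, θ) z) = ρ θ * 1 * qf x z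
      + (ρ θ * Real.sin θ ^ 2) * ((x i - x j) * (z j ^ 2 - z i ^ 2))
      + (ρ θ * (Real.sin θ * Real.cos θ)) * (2 * (x i - x j) * z i * z j) := by
    intro θ
    have h := rot_sum i j hij' (-θ) z fun l y => x l * y ^ 2
    unfold qf rot'
    simp only
    rw [h, Real.cos_neg, Real.sin_neg]
    have := Real.sin_sq_add_cos_sq θ
    linear_combination (ρ θ * (x i * z i ^ 2 + x j * z j ^ 2)) * this
  have b1 : Bd fun θ => Real.sin θ := ⟨1, Real.abs_sin_le_one⟩
  have b2 : Bd fun θ => Real.cos θ := ⟨1, Real.abs_cos_le_one⟩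
  have i1 := rho_int hρ (g := fun _ => 1) measurable_const (Bd.const 1)
  have i2 := rho_int hρ (g := fun θ => Real.sin θ ^ 2) (by fun_prop) (by simpa only [sq] using b1.mul b1)
  have i3 := rho_int hρ (g := fun θ => Real.sin θ * Real.cos θ) (by fun_prop) (b1.mul b2)
  simp_rw [e]
  rw [intervalIntegral.integral_add ((i1.mul_const _).add (i2.mul_const _)) (i3.mul_const _),
    intervalIntegral.integral_add (i1.mul_const _) (i2.mul_const _)]
  simp only [intervalIntegral.integral_mul_const]
  simp only [← mul_assoc, hcond, mul_one, hρ.one]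
  ring

lemma qf_kap (hn : 2 ≤ n) (hρ : Rho ρ) (hcond : ∫ θ in (-π)..π, ρ θ * Real.sin θ * Real.cos θ = 0) (x z : Fin n → ℝ)
    (lam : ℝ) (hlam : lam = 1 - 2 * (∫ θ in (-π)..π, ρ θ * Real.sin θ ^ 2) / (n - 1)) :
    ∫ ω, qf x (rot' ω z) ∂kap n ρ = lam * qf x z + (1 - lam) * ((∑ l, x l) / n * ∑ l, z l ^ 2) := by
  have := kap_prob hn hρ
  have hn' : (2:ℝ) ≤ n := by exact_mod_cast hn
  have hb : Bd fun ω : Th n => qf x (rot' ω z) := ⟨(∑ l, |x l|) * ∑ l, z l ^ 2, fun ω => by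
    refine (qf_abs _ _).trans (le_of_eq ?_)
    unfold rot'
    rw [rot_sq _ _ ω.1.2.ne]⟩
  have hm : Measurable fun ω : Th n => qf x (rot' ω z) :=
    (qf_meas x).comp (rot'_meas.comp (measurable_id.prodMk measurable_const))
  rw [kap_integral hn hρ (hb.integrable hm)]
  simp_rw [qf_pair hρ hcond]
  rw [Finset.sum_add_distrib, ← Finset.mul_sum, Finset.sum_const, Finset.card_univ, nsmul_eq_mul]
  have hs := sum_Pr (fun i j => (x i - x j) * (z j ^ 2 - z i ^ 2)) (fun i j => by ring) (fun i => by ring)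
  have hs2 : ∑ i, ∑ j, (x i - x j) * (z j ^ 2 - z i ^ 2)
      = 2 * ((∑ l, x l) * ∑ l, z l ^ 2) - 2 * (n * qf x z) := by
    have : ∀ i j, (x i - x j) * (z j ^ 2 - z i ^ 2) = x i * z j ^ 2 + z i ^ 2 * x j - x i * z i ^ 2 - x j * z j ^ 2 := by
      intro i j; ring
    simp_rw [this, Finset.sum_sub_distrib, Finset.sum_add_distrib, ← Finset.mul_sum, ← Finset.sum_mul]
    simp only [Finset.sum_const, Finset.card_univ, Fintype.card_fin, nsmul_eq_mul]
    have e3 : ∑ l, x l * ((n : ℝ) * z l ^ 2) = n * qf x z := by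
      unfold qf; rw [Finset.mul_sum]; exact Finset.sum_congr rfl fun _ _ => by ring
    rw [e3]
    unfold qf
    ring
  rw [hs2] at hs
  have hs3 : ∑ p : Pr n, (x p.1.1 - x p.1.2) * (z p.1.2 ^ 2 - z p.1.1 ^ 2) =
      ((∑ l, x l) * ∑ l, z l ^ 2) - (n * qf x z) := by linarith
  have hc : (Fintype.card (Pr n) : ℝ) = n * (n - 1) / 2 := by have := card_Pr (n := n); linarith
  rw [hs3, hc, hlam]
  have a1 : (n : ℝ) ≠ 0 := by linarith
  have a2 : (n : ℝ) - 1 ≠ 0 := by linarith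
  field_simp
  ring

lemma qf_nuk (hn : 2 ≤ n) (hρ : Rho ρ) (hcond : ∫ θ in (-π)..π, ρ θ * Real.sin θ * Real.cos θ = 0) (x z : Fin n → ℝ)
    (lam : ℝ) (hlam : lam = 1 - 2 * (∫ θ in (-π)..π, ρ θ * Real.sin θ ^ 2) / (n - 1)) (k : ℕ) :
    ∫ A, qf x (act A z) ∂nuk n ρ k = (∑ l, x l) / n * ∑ l, z l ^ 2
      + lam ^ k * (qf x z - (∑ l, x l) / n * ∑ l, z l ^ 2) := by
  have hm : Measurable fun A : OM n => qf x (act A z) := (qf_meas x).comp (act_meas' z)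
  have hb : Bd fun A : OM n => qf x (act A z) := ⟨(∑ l, |x l|) * ∑ l, z l ^ 2, fun A => by
    refine (qf_abs _ _).trans (le_of_eq ?_)
    congr 1
    exact A.2 z⟩
  induction k with
  | zero =>
    simp only [nuk]; rw [integral_dirac' _ _ hm.stronglyMeasurable, om1_act]; ring
  | succ k ih =>
    have := nuk_prob hn hρ k
    rw [nuk_succ hn hρ k hm hb]
    simp_rw [stp_act, qf_kap hn hρ hcond _ _ lam hlam]
    have : ∀ A : OM n, ∑ l, act A z l ^ 2 = ∑ l, z l ^ 2 := fun A => A.2 z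
    simp_rw [this]
    rw [integral_add ((hb.integrable hm).const_mul _) (integrable_const _), integral_const_mul, ih]
    simp only [integral_const, probReal_univ, smul_eq_mul]
    ring

lemma qf_nu (hn : 2 ≤ n) (hρ : Rho ρ) (hcond : ∫ θ in (-π)..π, ρ θ * Real.sin θ * Real.cos θ = 0) (x z : Fin n → ℝ)
    {t : ℝ} (ht : 0 ≤ t) :
    ∫ A, qf x (act A z) ∂nu n ρ t = (∑ l, x l) / n * ∑ l, z l ^ 2
      + Real.exp (-2 * t * (∫ θ in (-π)..π, ρ θ * Real.sin θ ^ 2) * n / (n - 1)) *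
        (qf x z - (∑ l, x l) / n * ∑ l, z l ^ 2) := by
  have hn' : (2:ℝ) ≤ n := by exact_mod_cast hn
  have hm : Measurable fun A : OM n => qf x (act A z) := (qf_meas x).comp (act_meas' z)
  have hb : Bd fun A : OM n => qf x (act A z) := ⟨(∑ l, |x l|) * ∑ l, z l ^ 2, fun A => by
    refine (qf_abs _ _).trans (le_of_eq ?_)
    congr 1
    exact A.2 z⟩
  have h := nu_hasSum hn hρ ht hm hb
  set lam := 1 - 2 * (∫ θ in (-π)..π, ρ θ * Real.sin θ ^ 2) / (n - 1) with hlam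
  simp_rw [qf_nuk hn hρ hcond x z lam hlam, mul_add, ← mul_assoc] at h
  have h2 := ((poi_one (n * t)).mul_right ((∑ l, x l) / n * ∑ l, z l ^ 2)).add
    ((poi_hasSum (n * t) lam).mul_right (qf x z - (∑ l, x l) / n * ∑ l, z l ^ 2))
  simp only [← mul_assoc] at h2
  rw [h.unique h2, one_mul]
  congr 3
  rw [hlam]
  have a2 : (n : ℝ) - 1 ≠ 0 := by linarith
  field_simp
  ring

end om
open MeasureTheory Real

section fin
variable {M N : ℕ} {ρ : ℝ → ℝ}

/-- append as a measurable equivalence -/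
noncomputable def app (M N : ℕ) : ((Fin M → ℝ) × (Fin N → ℝ)) ≃ᵐ (Fin (M + N) → ℝ) :=
  (MeasurableEquiv.sumPiEquivProdPi (fun _ : Fin M ⊕ Fin N => ℝ)).symm.trans
    (MeasurableEquiv.piCongrLeft (fun _ : Fin (M + N) => ℝ) finSumFinEquiv)

lemma app_mp : MeasurePreserving (app M N) volume volume :=
  (volume_measurePreserving_sumPiEquivProdPi_symm (fun _ : Fin M ⊕ Fin N => ℝ)).trans
    (volume_measurePreserving_piCongrLeft (fun _ : Fin (M + N) => ℝ) finSumFinEquiv)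

lemma app_eq (q : (Fin M → ℝ) × (Fin N → ℝ)) : app M N q = Fin.append q.1 q.2 := by
  ext l
  have h : ∀ s : Fin M ⊕ Fin N, app M N q (finSumFinEquiv s) = Sum.elim q.1 q.2 s := by
    intro s
    unfold app
    rw [MeasurableEquiv.trans_apply, MeasurableEquiv.coe_piCongrLeft, Equiv.piCongrLeft_apply_apply]
    cases s <;> rfl
  obtain ⟨s, rfl⟩ := finSumFinEquiv.surjective l
  rw [h]
  cases s <;> simp

lemma act_append (A : OM (M + N)) (v : Fin M → ℝ) (w : Fin N → ℝ) (l : Fin (M + N)) :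
    act A (Fin.append v w) l = (fun b => A.1 l (Fin.castAdd N b)) ⬝ᵥ v + (fun c => A.1 l (Fin.natAdd M c)) ⬝ᵥ w := by
  unfold act dotProduct
  rw [Fin.sum_univ_add]
  simp

lemma om_coord (a b : Fin (M + N)) : Measurable fun A : OM (M + N) => A.1 a b :=
  (measurable_pi_apply b).comp ((measurable_pi_apply a).comp measurable_subtype_coe)

/-- the constant -/
noncomputable def cst (M N : ℕ) (ρ : ℝ → ℝ) (t : ℝ) : ℝ :=
  ((M : ℝ) / (N + M) + ((N : ℝ) / (N + M)) *
            Real.exp (-2 * t * (∫ θ in (-π)..π, ρ θ * Real.sin θ ^ 2) *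
              ((N : ℝ) + M) / ((N : ℝ) + M - 1)))

/-- the data -/
noncomputable def theDat (hM : 0 < M) (hn : 2 ≤ M + N) (hρ : Rho ρ)
    (hcond : ∫ θ in (-π)..π, ρ θ * Real.sin θ * Real.cos θ = 0) {t : ℝ} (ht : 0 ≤ t) :
    Dat0 M N (OM (M + N)) where
  ν := nu (M + N) ρ t
  prob := nu_prob hn hρ ht
  B A a b := A.1 (Fin.castAdd N a) (Fin.castAdd N b)
  D A a c := A.1 (Fin.castAdd N a) (Fin.natAdd M c)
  hB a b := om_coord _ _
  hD a c := om_coord _ _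
  orth A a a' := by
    have := iso_rows A.1 A.2 (Fin.castAdd N a) (Fin.castAdd N a')
    rw [Fin.sum_univ_add] at this
    rw [this]
    simp
  C := cst M N ρ t
  hC := by
    unfold cst
    have : (0:ℝ) < M := by exact_mod_cast hM
    positivity
  hBC e := by
    refine le_of_eq ?_
    have h := qf_nu hn hρ hcond (Fin.append (fun _ : Fin M => (1:ℝ)) (fun _ : Fin N => 0))
      (Fin.append e (fun _ : Fin N => 0)) ht
    have e1 : ∀ A : OM (M + N), qf (Fin.append (fun _ : Fin M => (1:ℝ)) (fun _ : Fin N => 0))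
        (act A (Fin.append e (fun _ : Fin N => 0)))
        = ∑ a, ((fun b => A.1 (Fin.castAdd N a) (Fin.castAdd N b)) ⬝ᵥ e) ^ 2 := by
      intro A
      unfold qf
      rw [Fin.sum_univ_add]
      simp only [Fin.append_left, Fin.append_right, one_mul, zero_mul, Finset.sum_const_zero, add_zero, act_append]
      refine Finset.sum_congr rfl fun a _ => ?_
      simp [dotProduct]
    simp_rw [e1] at h
    rw [h]
    have e2 : qf (Fin.append (fun _ : Fin M => (1:ℝ)) (fun _ : Fin N => 0)) (Fin.append e (fun _ : Fin N => 0))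
        = e ⬝ᵥ e := by
      unfold qf dotProduct
      rw [Fin.sum_univ_add]
      simp [sq]
    have e3 : ∑ l, (Fin.append e (fun _ : Fin N => 0)) l ^ 2 = e ⬝ᵥ e := by
      unfold dotProduct
      rw [Fin.sum_univ_add]
      simp [sq]
    have e4 : ∑ l, (Fin.append (fun _ : Fin M => (1:ℝ)) (fun _ : Fin N => 0)) l = M := by
      rw [Fin.sum_univ_add]
      simp
    rw [e2, e3, e4]
    unfold cst
    push_cast
    rw [add_comm (M : ℝ) (N : ℝ)]
    have : (0:ℝ) < M := by exact_mod_cast hM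
    have h3 : (N : ℝ) / (N + M) = 1 - M / (N + M) := by
      field_simp; ring
    rw [h3]
    ring

lemma F0_facts {f₀ : (Fin M → ℝ) → ℝ} (h0 : Dens f₀) {F : (Fin (M + N) → ℝ) → ℝ}
    (hF : ∀ v w, F (Fin.append v w) = f₀ v * gau w) :
    (∀ z, 0 ≤ F z) ∧ Integrable F ∧ ∫ z, F z = 1 := by
  have e : (F ∘ app M N) = fun q => f₀ q.1 * gau q.2 := by
    ext q; simp only [Function.comp_apply, app_eq, hF]
  have hi : Integrable (F ∘ app M N) := by rw [e]; exact h0.int.mul_prod gau_integrable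
  refine ⟨fun z => ?_, ?_, ?_⟩
  · obtain ⟨q, rfl⟩ := (app M N).surjective z
    rw [app_eq, hF]
    exact mul_nonneg (h0.nonneg _) (gau_pos _).le
  · exact (app_mp.integrable_comp_emb (app M N).measurableEmbedding).1 hi
  · rw [← app_mp.integral_comp (app M N).measurableEmbedding]
    have : ∀ q, F (app M N q) = f₀ q.1 * gau q.2 := congrFun e
    simp_rw [this]
    have := integral_prod_mul (μ := (volume : Measure (Fin M → ℝ))) (ν := (volume : Measure (Fin N → ℝ))) f₀ gau
    rw [h0.one, gau_integral, mul_one] at this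
    exact this

lemma final (hM : 0 < M) (hn : 2 ≤ M + N) (hρ : Rho ρ)
    (hcond : ∫ θ in (-π)..π, ρ θ * Real.sin θ * Real.cos θ = 0) {t : ℝ} (ht : 0 ≤ t)
    {f₀ : (Fin M → ℝ) → ℝ} (h0 : Dens f₀)
    (he : Integrable fun v => f₀ v * Real.log (f₀ v / gau v))
    {F : (Fin (M + N) → ℝ) → ℝ} (hF : ∀ v w, F (Fin.append v w) = f₀ v * gau w) :
    relEntropy (fun v : Fin M → ℝ => ∫ w : Fin N → ℝ, kacEvol ρ t F (Fin.append v w))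
      ≤ cst M N ρ t * relEntropy f₀ := by
  obtain ⟨hF0, hFi, hF1⟩ := F0_facts h0 hF
  set f : (Fin M → ℝ) → ℝ := fun v : Fin M → ℝ => ∫ w : Fin N → ℝ, kacEvol ρ t F (Fin.append v w) with hf
  have hE := evol_int hn hρ ht hF0 hFi hF1
  have hE0 := evol_nonneg hn hρ ht hF0
  have hEi : Integrable (fun q : (Fin M → ℝ) × (Fin N → ℝ) => kacEvol ρ t F (Fin.append q.1 q.2))
      (volume.prod volume) := by
    have := (app_mp.integrable_comp_emb (app M N).measurableEmbedding).2 hE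
    simp only [Function.comp_def, app_eq] at this
    exact this
  have hfi : Integrable f := hEi.integral_prod_left
  have hf0 : ∀ v, 0 ≤ f v := fun v => integral_nonneg fun w => hE0 _
  -- pairing
  have hpair : ∀ φ : (Fin M → ℝ) → ℝ, Measurable φ → Bd φ →
      ∫ v, f v * φ v = ∫ z, kacEvol ρ t F z * φ (fun i => z (Fin.castAdd N i)) := by
    intro φ hφ ⟨K, hK⟩
    rw [← app_mp.integral_comp (app M N).measurableEmbedding]
    simp_rw [app_eq, Fin.append_left]
    have i1 : Integrable (fun q : (Fin M → ℝ) × (Fin N → ℝ) => kacEvol ρ t F (Fin.append q.1 q.2) * φ q.1)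
        (volume.prod volume) :=
      hEi.mul_bdd (c := K) (hφ.comp measurable_fst).aestronglyMeasurable (Filter.Eventually.of_forall fun q => hK _)
    have h2 := integral_prod _ i1
    simp_rw [integral_mul_const] at h2
    exact h2.symm
  have hcast : Measurable fun z : Fin (M + N) → ℝ => (fun i => z (Fin.castAdd N i)) :=
    measurable_pi_lambda _ fun i => measurable_pi_apply _
  -- measurable representative
  have hm := hfi.aestronglyMeasurable
  set f' : (Fin M → ℝ) → ℝ := fun v => max 0 (hm.mk f v) with hf'
  have hae : f =ᵐ[volume] f' := by
    filter_upwards [hm.ae_eq_mk] with v hv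
    simp only [hf']
    rw [← hv, max_eq_right (hf0 v)]
  have hre : relEntropy f = relEntropy f' := by
    rw [relEntropy_eq, relEntropy_eq]
    refine integral_congr_ae ?_
    filter_upwards [hae] with v hv
    rw [hv]
  have hdens : Dens f' := by
    refine ⟨fun v => le_max_left _ _, measurable_const.max hm.stronglyMeasurable_mk.measurable, hfi.congr hae, ?_⟩
    rw [← integral_congr_ae hae]
    have := hpair (fun _ => 1) measurable_const (Bd.const 1)
    simp only [mul_one] at this
    rw [this, evol_mass hn hρ ht hF0 hFi, hF1]
  rw [hre]
  refine (theDat hM hn hρ hcond ht).entropy_le h0 he hdens ?_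
  intro φ hφ hb
  have hν := nu_prob hn hρ ht
  have e1 : ∫ v, f' v * φ v = ∫ v, f v * φ v := by
    refine integral_congr_ae ?_
    filter_upwards [hae] with v hv
    rw [hv]
  rw [e1, hpair φ hφ hb, evol_nu hn hρ ht hF0 hFi (Φ := fun z => φ (fun i => z (Fin.castAdd N i))) (hφ.comp hcast) (hb.comp _)]
  rw [← app_mp.integral_comp (app M N).measurableEmbedding]
  simp_rw [app_eq, hF]
  have hmm : Measurable fun q : OM (M + N) × (Fin (M + N) → ℝ) =>
      φ (fun a => act q.1 q.2 (Fin.castAdd N a)) := hφ.comp (hcast.comp act_meas)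
  have happ : Measurable fun q : (Fin M → ℝ) × (Fin N → ℝ) => Fin.append q.1 q.2 := by
    have := (app M N).measurable
    simpa only [funext app_eq] using this
  obtain ⟨K, hK⟩ := id hb
  have i2 : Integrable (fun q : (Fin M → ℝ) × (Fin N → ℝ) => (f₀ q.1 * gau q.2) *
      ∫ A, φ (fun a => act A (Fin.append q.1 q.2) (Fin.castAdd N a)) ∂nu (M + N) ρ t) (volume.prod volume) := by
    refine (h0.int.mul_prod gau_integrable).mul_bdd (c := K) ?_ (Filter.Eventually.of_forall fun q => ?_)
    · have := (hmm.stronglyMeasurable.integral_prod_left' (μ := nu (M + N) ρ t)).measurable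
      exact (this.comp happ).aestronglyMeasurable
    · have := norm_integral_le_of_norm_le_const (μ := nu (M + N) ρ t)
        (f := fun A => φ (fun a => act A (Fin.append q.1 q.2) (Fin.castAdd N a))) (C := K)
        (Filter.Eventually.of_forall fun ω => hK _)
      rw [probReal_univ, mul_one] at this
      exact this
  refine (integral_prod _ i2).trans ?_
  refine integral_congr_ae (Filter.Eventually.of_forall fun v => ?_)
  simp only [mul_assoc]
  rw [integral_const_mul]
  congr 1
  have i3 : Integrable (fun p : OM (M + N) × (Fin N → ℝ) =>
      φ (fun a => act p.1 (Fin.append v p.2) (Fin.castAdd N a))) ((nu (M + N) ρ t).prod (gam N)) := by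
    refine Bd.integrable (hb.comp _) ?_
    have hv : Measurable fun p : OM (M + N) × (Fin N → ℝ) => (v, p.2) := measurable_const.prodMk measurable_snd
    have hv2 : Measurable fun p : OM (M + N) × (Fin N → ℝ) => (p.1, Fin.append v p.2) :=
      measurable_fst.prodMk (happ.comp hv)
    exact hmm.comp hv2
  have h4 := integral_prod_symm _ i3
  rw [integral_gam] at h4
  simp_rw [act_append] at h4
  simp_rw [act_append]
  refine Eq.trans ?_ h4.symm
  refine integral_congr_ae (Filter.Eventually.of_forall fun w => ?_)
  simp only [mul_comm]

end fin

theorem kac_entropy_decay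
    (M N : ℕ) (hM : 0 < M) (hMN : M ≤ N)
    (ρ : ℝ → ℝ) (hρ_per : Function.Periodic ρ (2 * π))
    (hρ_nonneg : ∀ θ, 0 ≤ ρ θ) (hρ_meas : Measurable ρ)
    (hρ_prob : ∫ θ in (-π)..π, ρ θ = 1)
    (c : ℤ → ℂ)
    (hc : ∀ m : ℤ, c m = (1 / (2 * π)) *
      ∫ θ in (-π)..π, (ρ θ : ℂ) * Complex.exp (-Complex.I * (m : ℂ) * (θ : ℂ)))
    (hsumm : Summable (fun m : ℤ => ‖c m‖))
    (hrep : ∀ θ : ℝ, (ρ θ : ℂ) = ∑' m : ℤ, c m * Complex.exp (Complex.I * (m : ℂ) * (θ : ℂ)))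
    (hcond : ∫ θ in (-π)..π, ρ θ * Real.sin θ * Real.cos θ = 0)
    (f₀ : (Fin M → ℝ) → ℝ)
    (hf₀_nonneg : ∀ v, 0 ≤ f₀ v) (hf₀_meas : Measurable f₀)
    (hf₀_int : Integrable f₀)
    (hf₀_prob : ∫ v : Fin M → ℝ, f₀ v = 1)
    (hf₀_ent : Integrable (fun v : Fin M → ℝ =>
      f₀ v * Real.log (f₀ v / Real.exp (-π * ∑ i, (v i) ^ 2))))
    (t : ℝ) (ht : 0 ≤ t) :
    relEntropy (fun v : Fin M → ℝ =>
        ∫ w : Fin N → ℝ,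
          kacEvol ρ t
            (fun z : Fin (M + N) → ℝ =>
              f₀ (fun i => z (Fin.castAdd N i)) *
                Real.exp (-π * ∑ j : Fin N, (z (Fin.natAdd M j)) ^ 2))
            (Fin.append v w))
      ≤ ((M : ℝ) / (N + M) + ((N : ℝ) / (N + M)) *
            Real.exp (-2 * t * (∫ θ in (-π)..π, ρ θ * Real.sin θ ^ 2) *
              ((N : ℝ) + M) / ((N : ℝ) + M - 1))) *
          relEntropy f₀ := by

  refine final hM (by omega) ⟨hρ_nonneg, hρ_meas, hρ_prob⟩ hcond ht
    ⟨hf₀_nonneg, hf₀_meas, hf₀_int, hf₀_prob⟩ hf₀_ent ?_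
  intro v w
  simp only [Fin.append_left, Fin.append_right]
  rfl
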